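/- arXiv:1704.00273 — 2 statements merged into one kernel-verified Lean document; each statement's English description precedes it below -/
import Mathlib

section
/- (Geometric rigidity, L^p version.) Let Ω ⊂ ℝ² be a bounded domain with Lipschitz boundary and let p ∈ [2, ∞). There exists a constant C > 0, depending only on p and Ω, such that for every u ∈ W^{1,p}(Ω, ℝ²) there exists a rotation R ∈ SO(2) with ‖∇u − R‖_{L^p(Ω)} ≤ C ‖dist(∇u, SO(2))‖_{L^p(Ω)}. -/
open MeasureTheory Matrix

noncomputable section

abbrev V2 := Fin 2 → ℝ
abbrev Mat2 := Matrix (Fin 2) (Fin 2) ℝ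

/-- Partial derivative `∂ᵢ f`. -/
def pd (i : Fin 2) (f : V2 → ℝ) (x : V2) : ℝ := fderiv ℝ f x (Pi.single i 1)

/-- Frobenius norm of a matrix. -/
def frob (M : Mat2) : ℝ := Real.sqrt (∑ i, ∑ j, (M i j)^2)

/-- Euclidean norm on ℝ². -/
def norm2 (y : V2) : ℝ := Real.sqrt (∑ i, (y i)^2)

/-- The rotation group `SO(2)`. -/
def SO2 : Set Mat2 := {R | Rᵀ * R = 1 ∧ R.det = 1}

/-- Frobenius distance from a matrix to `SO(2)`. -/
def distSO2 (F : Mat2) : ℝ := sInf {d | ∃ R ∈ SO2, d = frob (F - R)}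

/-- `L^p` norm over `Ω` of a matrix field. -/
def lpM (p : ℝ) (Ω : Set V2) (M : V2 → Mat2) : ℝ := (∫ x in Ω, frob (M x) ^ p) ^ (1/p)

/-- `G` is the distributional (weak) gradient of `u` on `Ω`,
with `G x i j = ∂ⱼ uᵢ (x)`. -/
def IsWeakGradient (Ω : Set V2) (u : V2 → V2) (G : V2 → Mat2) : Prop :=
  ∀ φ : V2 → ℝ, ContDiff ℝ (⊤ : ℕ∞) φ → HasCompactSupport φ → tsupport φ ⊆ Ω →
    ∀ i j, ∫ x in Ω, u x i * pd j φ x = - ∫ x in Ω, G x i j * φ x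

/-- `Ω` has Lipschitz boundary: near every boundary point, after a rotation,
`Ω` coincides with the subgraph of a Lipschitz function. -/
def HasLipschitzBoundary (Ω : Set V2) : Prop :=
  ∀ x ∈ frontier Ω, ∃ R ∈ SO2, ∃ (φ : ℝ → ℝ) (K : NNReal) (U : Set V2),
    LipschitzWith K φ ∧ IsOpen U ∧ x ∈ U ∧
    ∀ y ∈ U, (y ∈ Ω ↔ R.mulVec y 1 < φ (R.mulVec y 0))

section PartA1
open MeasureTheory Metric Set Filter Topology
open scoped ENNReal NNReal

namespace GR

lemma circle_submean {h : ℂ → ℂ} {x : ℂ} {r ρ : ℝ} (hρ : 0 < ρ) (hρr : ρ < r)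
    (hh : DifferentiableOn ℂ h (ball x r)) :
    ENNReal.ofReal (2 * Real.pi) * ‖h x‖ₑ ≤
      ∫⁻ θ in Ioo (-Real.pi) Real.pi, ‖h (circleMap x ρ θ)‖ₑ := by
  have hd : DiffContOnCl ℂ h (ball x |ρ|) := by
    apply DifferentiableOn.diffContOnCl
    apply hh.mono
    rw [closure_ball _ (by positivity), abs_of_pos hρ]
    exact closedBall_subset_ball hρr
  have h1 := hd.circleAverage
  rw [Real.circleAverage_eq_integral_add (-Real.pi)] at h1
  have h2 : ∫ θ in (0:ℝ)..2 * Real.pi, h (circleMap x ρ (θ + -Real.pi)) =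
      ∫ θ in (-Real.pi)..Real.pi, h (circleMap x ρ θ) := by
    rw [intervalIntegral.integral_comp_add_right (fun θ => h (circleMap x ρ θ))]
    congr 1 <;> ring
  rw [h2] at h1
  have h3 : (2 * Real.pi) • h x = ∫ θ in (-Real.pi)..Real.pi, h (circleMap x ρ θ) := by
    rw [← h1, smul_smul, mul_inv_cancel₀ (by positivity), one_smul]
  calc ENNReal.ofReal (2 * Real.pi) * ‖h x‖ₑ = ‖(2 * Real.pi) • h x‖ₑ := by
        rw [enorm_smul, Real.enorm_eq_ofReal (by positivity)]
    _ ≤ _ := by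
        rw [h3, intervalIntegral.integral_of_le (by linarith [Real.pi_pos]),
          integral_Ioc_eq_integral_Ioo]
        exact enorm_integral_le_lintegral_enorm _

lemma submean {h : ℂ → ℂ} {x : ℂ} {r : ℝ} (hr : 0 < r)
    (hh : DifferentiableOn ℂ h (ball x r)) :
    ENNReal.ofReal (Real.pi * r ^ 2) * ‖h x‖ₑ ≤ ∫⁻ y in ball x r, ‖h y‖ₑ := by
  classical
  have hm : Measurable ((ball x r).indicator (fun y => ‖h y‖ₑ)) := by
    have : Measurable ((ball x r).piecewise h (fun _ => (0:ℂ))) :=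
      ContinuousOn.measurable_piecewise hh.continuousOn continuousOn_const isOpen_ball.measurableSet
    convert this.enorm using 1
    ext y
    by_cases hy : y ∈ ball x r <;> simp [indicator, piecewise, hy]
  rw [← lintegral_indicator isOpen_ball.measurableSet, ← lintegral_add_left_eq_self _ x,
    ← Complex.lintegral_comp_polarCoord_symm]
  have ht : polarCoord.target = Ioi (0:ℝ) ×ˢ Ioo (-Real.pi) Real.pi := rfl
  rw [ht, Measure.volume_eq_prod, ← Measure.prod_restrict, lintegral_prod]
  swap
  · apply Measurable.aemeasurable
    simp only [Complex.polarCoord_symm_apply, smul_eq_mul]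
    refine Measurable.mul (by fun_prop) (hm.comp ?_)
    fun_prop
  have key : ∀ ρ ∈ Ioo 0 r, ENNReal.ofReal (2 * Real.pi * ρ) * ‖h x‖ₑ ≤
      ∫⁻ θ in Ioo (-Real.pi) Real.pi, ENNReal.ofReal ρ •
        (ball x r).indicator (fun y => ‖h y‖ₑ) (x + Complex.polarCoord.symm (ρ, θ)) := by
    intro ρ hρ
    have e : ∀ θ : ℝ, (ball x r).indicator (fun y => ‖h y‖ₑ) (x + Complex.polarCoord.symm (ρ, θ)) =
        ‖h (circleMap x ρ θ)‖ₑ := by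
      intro θ
      have : x + Complex.polarCoord.symm (ρ, θ) = circleMap x ρ θ := by
        rw [Complex.polarCoord_symm_apply, circleMap, Complex.exp_mul_I]
        simp
      rw [this, indicator_of_mem]
      rw [mem_ball, dist_eq_norm, circleMap_sub_center, norm_circleMap_zero, abs_of_pos hρ.1]
      exact hρ.2
    simp only [e, smul_eq_mul]
    rw [lintegral_const_mul' _ _ ENNReal.ofReal_ne_top, mul_comm (2 * Real.pi),
      ENNReal.ofReal_mul hρ.1.le, mul_assoc]
    gcongr
    exact circle_submean hρ.1 hρ.2 hh
  calc ENNReal.ofReal (Real.pi * r ^ 2) * ‖h x‖ₑ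
      = ∫⁻ ρ in Ioo 0 r, ENNReal.ofReal (2 * Real.pi * ρ) * ‖h x‖ₑ := by
        rw [lintegral_mul_const' _ _ enorm_ne_top]
        congr 1
        rw [← ofReal_integral_eq_lintegral_ofReal]
        · rw [← integral_Ioc_eq_integral_Ioo, ← intervalIntegral.integral_of_le hr.le,
            intervalIntegral.integral_const_mul, integral_id]
          congr 1
          ring
        · apply Continuous.integrableOn_Ioc (by fun_prop) |>.mono_set Ioo_subset_Ioc_self
        · filter_upwards [ae_restrict_mem measurableSet_Ioo] with ρ hρ
          have := hρ.1
          simp; positivity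
    _ ≤ ∫⁻ ρ in Ioo 0 r, ∫⁻ θ in Ioo (-Real.pi) Real.pi, ENNReal.ofReal ρ •
        (ball x r).indicator (fun y => ‖h y‖ₑ) (x + Complex.polarCoord.symm (ρ, θ)) :=
        setLIntegral_mono' measurableSet_Ioo key
    _ ≤ _ := lintegral_mono_set Ioo_subset_Ioi_self

end GR

end PartA1

section PartA2
open MeasureTheory Metric Set Filter Topology
open scoped ENNReal NNReal

namespace GR

lemma vol_ball (x : ℂ) {r : ℝ} (hr : 0 ≤ r) : volume (ball x r) = ENNReal.ofReal (Real.pi * r ^ 2) := by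
  rw [Complex.volume_ball, mul_comm, ENNReal.ofReal_mul Real.pi_pos.le, ENNReal.ofReal_pow hr]
  congr 1
  rw [← NNReal.coe_real_pi, ENNReal.ofReal_coe_nnreal]

lemma vol_cball (x : ℂ) {r : ℝ} (hr : 0 ≤ r) :
    volume (closedBall x r) = ENNReal.ofReal (Real.pi * r ^ 2) := by
  rw [Complex.volume_closedBall, mul_comm, ENNReal.ofReal_mul Real.pi_pos.le, ENNReal.ofReal_pow hr]
  congr 1
  rw [← NNReal.coe_real_pi, ENNReal.ofReal_coe_nnreal]

lemma osc_real {g : ℂ → ℂ} {x : ℂ} {d δ : ℝ} (hd : 0 < d) (hδ : 0 ≤ δ)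
    (hg : DifferentiableOn ℂ g (ball x d))
    (hI : ∫⁻ y in ball x d, ‖‖g y‖ - 1‖ₑ ≤ ENNReal.ofReal (Real.pi * d ^ 2 * δ))
    {z : ℂ} (hz : z ∈ ball x (d / 8)) : ‖g z - g x‖ ≤ 544 * δ := by
  have hpi := Real.pi_pos
  -- upper bound
  have up : ∀ y ∈ ball x (d / 2), ‖g y‖ ≤ 1 + 4 * δ := by
    intro y hy
    have hsub : ball y (d / 2) ⊆ ball x d := by
      apply ball_subset_ball'
      rw [mem_ball] at hy; linarith
    have h1 := submean (half_pos hd) (hg.mono hsub)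
    have h2 : ∫⁻ w in ball y (d / 2), ‖g w‖ₑ ≤
        ∫⁻ w in ball y (d / 2), (1 + ‖‖g w‖ - 1‖ₑ) := by
      apply lintegral_mono
      intro w
      have : ‖g w‖ₑ = ‖(1 : ℝ) + (‖g w‖ - 1)‖ₑ := by simp
      show ‖g w‖ₑ ≤ 1 + ‖‖g w‖ - 1‖ₑ
      rw [this]
      refine (enorm_add_le _ _).trans ?_
      simp
    rw [lintegral_add_left (by fun_prop), setLIntegral_const, one_mul, vol_ball _ (by positivity)] at h2
    have h3 := h1.trans (h2.trans (add_le_add_right ((lintegral_mono_set hsub).trans hI) _))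
    rw [← ofReal_norm, ← ENNReal.ofReal_mul (by positivity),
      ← ENNReal.ofReal_add (by positivity) (by positivity),
      ENNReal.ofReal_le_ofReal_iff (by positivity)] at h3
    have : Real.pi * (d / 2) ^ 2 * ‖g y‖ ≤ Real.pi * (d / 2) ^ 2 * (1 + 4 * δ) := by
      nlinarith
    exact le_of_mul_le_mul_left this (by positivity)
  refine le_of_forall_pos_le_add fun η' hη' => ?_
  set η := η' / 8 with hηdef
  have hη : 0 < η := by positivity
  -- lower bound
  obtain ⟨y0, hy0, hlow⟩ : ∃ y ∈ ball x (d / 8), 1 - 64 * δ - η ≤ ‖g y‖ := by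
    by_contra! hcon
    have h1 : ∫⁻ y in ball x (d / 8), ENNReal.ofReal (64 * δ + η) ≤ ∫⁻ y in ball x d, ‖‖g y‖ - 1‖ₑ := by
      refine le_trans (setLIntegral_mono' isOpen_ball.measurableSet fun y hy => ?_)
        (lintegral_mono_set (ball_subset_ball (by linarith)))
      rw [← ofReal_norm, Real.norm_eq_abs]
      apply ENNReal.ofReal_le_ofReal
      have := hcon y hy
      rw [abs_sub_comm]
      refine le_trans ?_ (le_abs_self _)
      linarith
    rw [setLIntegral_const, vol_ball _ (by positivity), ← ENNReal.ofReal_mul (by positivity)] at h1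
    have h2 := h1.trans hI
    rw [ENNReal.ofReal_le_ofReal_iff (by positivity)] at h2
    have : 0 < Real.pi * d ^ 2 * η := by positivity
    nlinarith
  obtain ⟨c, hc, hcg⟩ : ∃ c : ℂ, ‖c‖ = 1 ∧ (‖g y0‖ : ℂ) = c * g y0 := RCLike.exists_norm_eq_mul_self (g y0)
  have hd38 : ball y0 (3 * d / 8) ⊆ ball x (d / 2) := by
    apply ball_subset_ball'
    rw [mem_ball] at hy0; linarith
  have bc : ∀ w ∈ ball x (d / 8), ‖g w - g y0‖ ≤ 4 * (68 * δ + η) := by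
    intro w hw
    set f : ℂ → ℂ := fun v => c * (g (y0 + v) - g y0) with hf
    have hwy : ‖w - y0‖ < d / 4 := by
      rw [← dist_eq_norm]
      rw [mem_ball] at hw hy0
      have := dist_triangle_right w y0 x
      linarith
    have hmem : ∀ v ∈ ball (0:ℂ) (3 * d / 8), y0 + v ∈ ball x (d / 2) := by
      intro v hv
      apply hd38
      simpa using hv
    have hdf : DifferentiableOn ℂ f (ball 0 (3 * d / 8)) := by
      apply DifferentiableOn.const_mul
      apply DifferentiableOn.sub_const
      apply hg.comp (by fun_prop)
      intro v hv
      exact ball_subset_ball (by linarith) (hmem v hv)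
    have := Complex.borelCaratheodory_zero (f := f) (M := 68 * δ + η) (R := 3 * d / 8) (z := w - y0)
      (by positivity) hdf ?_ (by positivity) (by simp only [mem_ball, dist_zero_right]; linarith) (by simp [hf])
    · have e : ‖f (w - y0)‖ = ‖g w - g y0‖ := by simp [hf, hc]
      rw [e] at this
      refine this.trans ?_
      rw [div_le_iff₀ (by linarith)]
      have : 0 < 68 * δ + η := by positivity
      nlinarith [norm_nonneg (w - y0)]
    · intro v hv
      have h1 := up _ (hmem v hv)
      have h2 : (f v).re = (c * g (y0 + v)).re - ‖g y0‖ := by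
        simp only [hf, mul_sub, ← hcg, Complex.sub_re, Complex.ofReal_re]
      show (f v).re ≤ _
      rw [h2]
      have h3 := Complex.re_le_norm (c * g (y0 + v))
      rw [norm_mul, hc, one_mul] at h3
      linarith
  have a1 := bc z hz
  have a2 := bc x (by simpa using hd)
  have a3 := norm_sub_le_norm_sub_add_norm_sub (g z) (g y0) (g x)
  rw [norm_sub_rev (g y0)] at a3
  linarith

lemma osc {g : ℂ → ℂ} {x : ℂ} {d : ℝ} (hd : 0 < d)
    (hg : DifferentiableOn ℂ g (ball x d)) {z : ℂ} (hz : z ∈ ball x (d / 8)) :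
    ‖g z - g x‖ₑ ≤ 544 * ((ENNReal.ofReal (Real.pi * d ^ 2))⁻¹ * ∫⁻ y in ball x d, ‖‖g y‖ - 1‖ₑ) := by
  have hp : 0 < Real.pi * d ^ 2 := by positivity
  set A := (ENNReal.ofReal (Real.pi * d ^ 2))⁻¹ * ∫⁻ y in ball x d, ‖‖g y‖ - 1‖ₑ with hA
  by_cases htop : A = ⊤
  · rw [htop]; simp
  have := osc_real (δ := A.toReal) hd ENNReal.toReal_nonneg hg ?_ hz
  · rw [← ofReal_norm]
    refine (ENNReal.ofReal_le_ofReal this).trans ?_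
    rw [ENNReal.ofReal_mul (by norm_num), ENNReal.ofReal_toReal htop]
    simp
  · rw [ENNReal.ofReal_mul hp.le, ENNReal.ofReal_toReal htop, hA, ← mul_assoc, ENNReal.mul_inv_cancel, one_mul]
    · simpa using hp
    · exact ENNReal.ofReal_ne_top

end GR

end PartA2

section PartA3
open MeasureTheory Metric Set Filter Topology
open scoped ENNReal NNReal Convolution

namespace GR

/-- twice the dbar derivative of a real function -/
noncomputable def db (φ : ℂ → ℝ) (z : ℂ) : ℂ :=
  (fderiv ℝ φ z 1 : ℂ) + Complex.I * (fderiv ℝ φ z Complex.I : ℂ)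

/-- twice the d derivative of a real function -/
noncomputable def dd (φ : ℂ → ℝ) (z : ℂ) : ℂ :=
  (fderiv ℝ φ z 1 : ℂ) - Complex.I * (fderiv ℝ φ z Complex.I : ℂ)

/-- test functions -/
structure IsTest (U : Set ℂ) (φ : ℂ → ℝ) : Prop where
  smooth : ContDiff ℝ (⊤ : ℕ∞) φ
  cpt : HasCompactSupport φ
  supp : tsupport φ ⊆ U

/-- `∂̄ s = ∂ f` weakly in `U`. -/
def WeakEq (U : Set ℂ) (s f : ℂ → ℂ) : Prop :=
  ∀ φ, IsTest U φ → ∫ z, s z * db φ z = ∫ z, f z * dd φ z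

noncomputable def bump (n : ℕ) : ContDiffBump (0 : ℂ) where
  rIn := 1 / (2 * (n + 1))
  rOut := 1 / (n + 1)
  rIn_pos := by positivity
  rIn_lt_rOut := by
    have : (0:ℝ) ≤ n := by positivity
    apply one_div_lt_one_div_of_lt
    · positivity
    · linarith

noncomputable def moll (g : ℂ → ℂ) (n : ℕ) : ℂ → ℂ :=
  ((bump n).normed volume) ⋆[ContinuousLinearMap.lsmul ℝ ℝ, volume] g

lemma moll_deriv {g : ℂ → ℂ} (hg : LocallyIntegrable g) (n : ℕ) (x : ℂ) :
    DifferentiableAt ℝ (moll g n) x ∧ ∀ v, fderiv ℝ (moll g n) x v =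
      ∫ t, (fderiv ℝ ((bump n).normed volume) (x - t) v) • g t := by
  have h := HasCompactSupport.hasFDerivAt_convolution_left (ContinuousLinearMap.lsmul ℝ ℝ)
    (μ := volume) ((bump n).hasCompactSupport_normed (μ := volume))
    ((bump n).contDiff_normed (μ := volume) (n := 1)) hg x
  refine ⟨h.differentiableAt, fun v => ?_⟩
  have h' : HasFDerivAt (moll g n) _ x := h
  rw [h'.fderiv, convolution_eq_swap, ContinuousLinearMap.integral_apply]
  · simp
  · have hc : HasCompactSupport (fderiv ℝ ((bump n).normed volume)) :=
      ((bump n).hasCompactSupport_normed (μ := volume)).fderiv ℝ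
    have hcont : Continuous (fderiv ℝ ((bump n).normed volume)) :=
      ((bump n).contDiff_normed (μ := volume) (n := 1)).continuous_fderiv (by norm_num)
    have := (hc.convolutionExists_left
      ((ContinuousLinearMap.lsmul ℝ ℝ (E := ℂ)).precompL ℂ) (μ := volume) hcont hg) x
    have := this.integrable_swap
    exact this

lemma moll_holo {U : Set ℂ} {g : ℂ → ℂ} (hg : LocallyIntegrable g)
    (hw : WeakEq U g 0) {n : ℕ} {x : ℂ} (hx : closedBall x (1 / (n + 1)) ⊆ U) :
    DifferentiableAt ℂ (moll g n) x := by
  obtain ⟨h1, h2⟩ := moll_deriv hg n x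
  rw [differentiableAt_complex_iff_differentiableAt_real]
  refine ⟨h1, ?_⟩
  set ρ := (bump n).normed (volume : Measure ℂ) with hρ
  have hρs : ContDiff ℝ (⊤ : ℕ∞) ρ := (bump n).contDiff_normed
  have htest : IsTest U (fun y => ρ (x - y)) := by
    refine ⟨hρs.comp (by fun_prop), ?_, ?_⟩
    · exact ((bump n).hasCompactSupport_normed (μ := volume)).comp_homeomorph (Homeomorph.subLeft x)
    · refine (closure_minimal ?_ isClosed_closedBall).trans hx
      intro y hy
      have : x - y ∈ Function.support ρ := hy
      rw [hρ, ContDiffBump.support_normed_eq] at this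
      rw [mem_ball, dist_zero_right] at this
      rw [mem_closedBall, dist_comm, dist_eq_norm]
      exact this.le
  have hfd : ∀ y v, fderiv ℝ (fun y => ρ (x - y)) y v = - fderiv ℝ ρ (x - y) v := by
    intro y v
    have hd : HasFDerivAt (fun y : ℂ => x - y) (-ContinuousLinearMap.id ℝ ℂ) y :=
      (hasFDerivAt_id y).const_sub x
    have := ((hρs.differentiable (by simp)) (x - y)).hasFDerivAt.comp y hd
    have e := this.fderiv
    rw [Function.comp_def] at e
    rw [e]; simp
  have h3 := hw _ htest
  simp only [Pi.zero_apply, zero_mul, integral_zero] at h3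
  have hInt : ∀ v, Integrable (fun t => (fderiv ℝ ρ (x - t) v) • g t) := by
    intro v
    have hc : HasCompactSupport (fun t => fderiv ℝ ρ (x - t) v) := by
      have : HasCompactSupport (fun t => fderiv ℝ ρ t v) :=
        (((bump n).hasCompactSupport_normed (μ := volume)).fderiv_apply ℝ v)
      exact this.comp_homeomorph (Homeomorph.subLeft x)
    have hcont : Continuous (fun t => fderiv ℝ ρ (x - t) v) := by
      have := (hρs.continuous_fderiv (by simp)).clm_apply (continuous_const (y := v))
      exact this.comp (by fun_prop)
    exact hg.integrable_smul_left_of_hasCompactSupport hcont hc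
  have e : ∀ y, g y * db (fun y => ρ (x - y)) y =
      -((fderiv ℝ ρ (x - y) 1) • g y + Complex.I * ((fderiv ℝ ρ (x - y) Complex.I) • g y)) := by
    intro y
    simp only [db, hfd, Complex.real_smul, Complex.ofReal_neg]
    ring
  simp only [e] at h3
  rw [integral_neg, integral_add (hInt 1) ((hInt Complex.I).const_mul _), integral_const_mul,
    ← h2, ← h2, neg_eq_zero] at h3
  have : fderiv ℝ (moll g n) x 1 = - (Complex.I * fderiv ℝ (moll g n) x Complex.I) :=
    eq_neg_of_add_eq_zero_left h3
  rw [this, smul_eq_mul, mul_neg, ← mul_assoc, Complex.I_mul_I]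
  ring

lemma moll_ae {g : ℂ → ℂ} (hg : LocallyIntegrable g) :
    ∀ᵐ x, Tendsto (fun n => moll g n x) atTop (𝓝 (g x)) := by
  apply ContDiffBump.ae_convolution_tendsto_right_of_locallyIntegrable (K := 2) _ _ hg
  · exact tendsto_one_div_add_atTop_nhds_zero_nat
  · filter_upwards with n
    show (1:ℝ) / (n + 1) ≤ 2 * (1 / (2 * (n + 1)))
    rw [one_div, one_div, mul_inv, ← mul_assoc]; norm_num

lemma moll_L1 {g : ℂ → ℂ} (hg : LocallyIntegrable g) {n : ℕ} {x : ℂ} {r R : ℝ}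
    (hrR : r + 1 / (n + 1) ≤ R) :
    ∫⁻ y in ball x r, ‖moll g n y‖ₑ ≤ ∫⁻ y in ball x R, ‖g y‖ₑ := by
  set ρ := (bump n).normed (volume : Measure ℂ) with hρ
  have hρ1 : ∫⁻ t, ‖ρ t‖ₑ = 1 := by
    have := (bump n).integral_normed (μ := (volume : Measure ℂ))
    rw [← ofReal_integral_norm_eq_lintegral_enorm (bump n).integrable_normed]
    simp only [Real.norm_eq_abs, abs_of_nonneg ((bump n).nonneg_normed _), this]
    simp
  have hgm : AEStronglyMeasurable g volume := hg.aestronglyMeasurable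
  have hcm : Continuous ρ := (bump n).continuous_normed
  calc ∫⁻ y in ball x r, ‖moll g n y‖ₑ
      ≤ ∫⁻ y in ball x r, ∫⁻ t, ‖ρ t‖ₑ * ‖g (y - t)‖ₑ := by
        gcongr with y
        refine (enorm_integral_le_lintegral_enorm _).trans (le_of_eq ?_)
        congr with t
        show ‖ρ t • g (y - t)‖ₑ = _
        rw [enorm_smul]
    _ = ∫⁻ t, ∫⁻ y in ball x r, ‖ρ t‖ₑ * ‖g (y - t)‖ₑ := by
        rw [lintegral_lintegral_swap]
        have h00 : Measurable (fun p : ℂ × ℂ => ‖ρ p.2‖ₑ) := (hcm.measurable.comp measurable_snd).enorm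
        refine AEMeasurable.mul h00.aemeasurable ?_
        have h0 := (hgm.comp_quasiMeasurePreserving
          (quasiMeasurePreserving_sub_of_right_invariant (volume : Measure ℂ) (volume : Measure ℂ))).enorm
        refine AEMeasurable.mono_measure h0 ?_
        exact Measure.prod_mono Measure.restrict_le_self le_rfl
    _ ≤ ∫⁻ t, ‖ρ t‖ₑ * ∫⁻ y in ball x R, ‖g y‖ₑ := by
        gcongr with t
        rw [lintegral_const_mul' _ _ enorm_ne_top]
        by_cases ht : ρ t = 0
        · simp [ht]
        have ht' : t ∈ Function.support ρ := ht
        rw [hρ, ContDiffBump.support_normed_eq, mem_ball, dist_zero_right] at ht'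
        have ht2 : ‖t‖ < 1 / (n + 1) := ht'
        refine mul_le_mul_right ?_ _
        rw [← lintegral_indicator isOpen_ball.measurableSet,
          ← lintegral_indicator isOpen_ball.measurableSet,
          ← lintegral_sub_right_eq_self ((ball x R).indicator (fun y => ‖g y‖ₑ)) t]
        gcongr with y
        by_cases hy : y ∈ ball x r
        · rw [indicator_of_mem hy, indicator_of_mem]
          rw [mem_ball, dist_eq_norm] at hy ⊢
          have := norm_sub_le (y - x) t
          rw [show y - t - x = y - x - t by ring]
          linarith
        · simp [hy]
    _ = _ := by
      rw [lintegral_mul_const'' _ hcm.measurable.enorm.aemeasurable, hρ1, one_mul]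

end GR

end PartA3

section PartA4
open MeasureTheory Metric Set Filter Topology
open scoped ENNReal NNReal Convolution

namespace GR

lemma moll_continuous {g : ℂ → ℂ} (hg : LocallyIntegrable g) (n : ℕ) : Continuous (moll g n) :=
  Differentiable.continuous (𝕜 := ℝ) fun x => (moll_deriv hg n x).1

lemma moll_cauchy {U : Set ℂ} {g : ℂ → ℂ} (hg : LocallyIntegrable g)
    (hw : WeakEq U g 0) {x : ℂ} {r : ℝ} (hr : 0 < r) (hx : closedBall x (4 * r) ⊆ U) :
    UniformCauchySeqOn (moll g) atTop (ball x r) ∧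
    ∀ᶠ n in atTop, DifferentiableOn ℂ (moll g n) (ball x r) := by
  have hev : ∀ᶠ n : ℕ in atTop, (1:ℝ) / (n + 1) < r :=
    tendsto_one_div_add_atTop_nhds_zero_nat.eventually_lt_const hr
  have hd : ∀ᶠ n : ℕ in atTop, DifferentiableOn ℂ (moll g n) (ball x (3 * r)) := by
    filter_upwards [hev] with n hn y hy
    apply (moll_holo hg hw _).differentiableWithinAt
    refine Subset.trans (closedBall_subset_closedBall' ?_) hx
    rw [mem_ball] at hy
    linarith
  refine ⟨?_, hd.mono fun n hn => hn.mono (ball_subset_ball (by linarith))⟩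
  set A := ∫⁻ y in ball x (4 * r), ‖g y‖ₑ with hA
  have hAfin : A < ⊤ :=
    ((hg.integrableOn_isCompact (isCompact_closedBall x (4 * r))).mono_set ball_subset_closedBall).2
  set c := ENNReal.ofReal (Real.pi * r ^ 2) with hc
  have hc0 : c ≠ 0 := by
    have : 0 < Real.pi * r ^ 2 := by positivity
    simpa [hc] using this
  have hct : c ≠ ⊤ := ENNReal.ofReal_ne_top
  have hbd : ∀ᶠ n : ℕ in atTop, ∀ y ∈ ball x (2 * r), ‖moll g n y‖ₑ ≤ A / c := by
    filter_upwards [hev, hd] with n hn hdn y hy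
    rw [ENNReal.le_div_iff_mul_le (Or.inl hc0) (Or.inl hct), mul_comm]
    have hs : ball y r ⊆ ball x (3 * r) := by
      apply ball_subset_ball'
      rw [mem_ball] at hy; linarith
    refine (submean hr (hdn.mono hs)).trans ?_
    refine (lintegral_mono_set hs).trans ?_
    exact moll_L1 hg (by linarith)
  have hlim : Tendsto (fun n => ∫⁻ y in ball x (2 * r), ‖moll g n y - g y‖ₑ) atTop (𝓝 0) := by
    have := tendsto_lintegral_filter_of_dominated_convergence' (l := (atTop : Filter ℕ))
      (μ := volume.restrict (ball x (2 * r)))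
      (F := fun n y => ‖moll g n y - g y‖ₑ) (f := fun _ => 0) (fun y => A / c + ‖g y‖ₑ) ?_ ?_ ?_ ?_
    · simpa using this
    · filter_upwards with n
      exact ((moll_continuous hg n).aestronglyMeasurable.sub
        hg.aestronglyMeasurable.restrict).enorm
    · filter_upwards [hbd] with n hn
      filter_upwards [ae_restrict_mem isOpen_ball.measurableSet] with y hy
      exact (enorm_sub_le).trans (add_le_add_left (hn y hy) _)
    · rw [lintegral_add_left measurable_const, setLIntegral_const]
      refine ENNReal.add_ne_top.2 ⟨ENNReal.mul_ne_top (ENNReal.div_ne_top hAfin.ne hc0)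
        measure_ball_lt_top.ne, ?_⟩
      exact ((lintegral_mono_set (ball_subset_ball (by linarith))).trans_lt hAfin).ne
    · refine ae_restrict_of_ae ?_
      filter_upwards [moll_ae hg] with y hy
      have := (hy.sub_const (g y)).enorm
      simpa using this
  rw [Metric.uniformCauchySeqOn_iff]
  intro ε hε
  have hε' : (0 : ℝ≥0∞) < c * ENNReal.ofReal ε / 4 := by
    simp [ENNReal.div_pos_iff, hc0, hε]
  have h1 := (hlim.eventually_lt_const hε').and hd
  obtain ⟨N, hN⟩ := eventually_atTop.1 h1
  refine ⟨N, fun m hm n hn y hy => ?_⟩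
  obtain ⟨m1, m2⟩ := hN m hm
  obtain ⟨n1, n2⟩ := hN n hn
  have hs : ball y r ⊆ ball x (2 * r) := by
    apply ball_subset_ball'
    rw [mem_ball] at hy; linarith
  have hs3 : ball y r ⊆ ball x (3 * r) := hs.trans (ball_subset_ball (by linarith))
  have h2 := submean hr ((m2.mono hs3).sub (n2.mono hs3))
  have h3 : c * ‖(moll g m - moll g n) y‖ₑ ≤ c * ENNReal.ofReal ε / 4 + c * ENNReal.ofReal ε / 4 := by
    refine h2.trans ((lintegral_mono_set hs).trans ?_)
    refine le_trans ?_ (add_le_add m1.le n1.le)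
    rw [← lintegral_add_left']
    · gcongr with z
      have : (moll g m - moll g n) z = (moll g m z - g z) - (moll g n z - g z) := by simp
      rw [this]
      exact enorm_sub_le
    · exact ((moll_continuous hg m).aestronglyMeasurable.sub
        hg.aestronglyMeasurable.restrict).enorm
  have h4 : c * ENNReal.ofReal ε / 4 + c * ENNReal.ofReal ε / 4 = c * ENNReal.ofReal (ε / 2) := by
    have h40 : (4 : ℝ≥0∞) = ENNReal.ofReal 4 := by simp
    rw [hc, ← ENNReal.ofReal_mul (by positivity), ← ENNReal.ofReal_mul (by positivity), h40,
      ← ENNReal.ofReal_div_of_pos (by norm_num), ← ENNReal.ofReal_add (by positivity) (by positivity)]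
    congr 1; ring
  rw [h4, ENNReal.mul_le_mul_iff_right hc0 hct, ← ofReal_norm,
    ENNReal.ofReal_le_ofReal_iff (by positivity)] at h3
  rw [dist_eq_norm]
  have : ‖moll g m y - moll g n y‖ ≤ ε / 2 := h3
  linarith

theorem weyl {U : Set ℂ} (hU : IsOpen U) {g : ℂ → ℂ} (hg : LocallyIntegrable g)
    (hw : WeakEq U g 0) :
    ∃ G : ℂ → ℂ, DifferentiableOn ℂ G U ∧ ∀ᵐ x ∂(volume.restrict U), g x = G x := by
  have key : ∀ x ∈ U, ∃ r > 0, UniformCauchySeqOn (moll g) atTop (ball x r) ∧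
      ∀ᶠ n in atTop, DifferentiableOn ℂ (moll g n) (ball x r) := by
    intro x hx
    obtain ⟨ε, hε, hb⟩ := Metric.nhds_basis_closedBall.mem_iff.1 (hU.mem_nhds hx)
    exact ⟨ε / 4, by positivity, moll_cauchy hg hw (by positivity) (by
      convert hb using 2; ring)⟩
  set G : ℂ → ℂ := fun x => limUnder atTop (fun n => moll g n x) with hG
  have ptw : ∀ x ∈ U, Tendsto (fun n => moll g n x) atTop (𝓝 (G x)) := by
    intro x hx
    obtain ⟨r, hr, h1, -⟩ := key x hx
    have : CauchySeq (fun n => moll g n x) := h1.cauchy_map (mem_ball_self hr)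
    exact this.tendsto_limUnder
  have hsub : ∀ x ∈ U, ∃ r > 0, ball x r ⊆ U := fun x hx => Metric.isOpen_iff.1 hU x hx
  refine ⟨G, ?_, ?_⟩
  · intro x hx
    obtain ⟨r, hr, h1, h2⟩ := key x hx
    obtain ⟨r', hr', hb⟩ := hsub x hx
    have hmr : 0 < min r r' := lt_min hr hr'
    have h3 : TendstoUniformlyOn (moll g) G atTop (ball x (min r r')) :=
      (h1.mono (ball_subset_ball (min_le_left _ _))).tendstoUniformlyOn_of_tendsto
        fun y hy => ptw y (hb (ball_subset_ball (min_le_right _ _) hy))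
    have h4 : DifferentiableOn ℂ G (ball x (min r r')) :=
      h3.tendstoLocallyUniformlyOn.differentiableOn
        (h2.mono fun n hn => hn.mono (ball_subset_ball (min_le_left _ _))) isOpen_ball
    exact (h4.differentiableAt (ball_mem_nhds x hmr)).differentiableWithinAt
  · filter_upwards [ae_restrict_mem hU.measurableSet, ae_restrict_of_ae (moll_ae hg)] with x hx h
    exact tendsto_nhds_unique h (ptw x hx)

end GR

end PartA4

section PartB0
open MeasureTheory Metric Set Filter Topology
open scoped ENNReal NNReal InnerProductSpace

namespace GR

lemma factor_riesz {T H : Type*} [AddCommGroup T] [Module ℂ T] [NormedAddCommGroup H]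
    [InnerProductSpace ℂ H] [CompleteSpace H] (D : T →ₗ[ℂ] H) (ℓ : T →ₗ[ℂ] ℂ) (C : ℝ) (hC : 0 ≤ C)
    (h : ∀ x, ‖ℓ x‖ ≤ C * ‖D x‖) : ∃ s : H, ‖s‖ ≤ C ∧ ∀ x, ⟪s, D x⟫_ℂ = ℓ x := by
  have hker : LinearMap.ker D ≤ LinearMap.ker ℓ := by
    intro x hx
    rw [LinearMap.mem_ker] at hx ⊢
    have := h x
    rw [hx, norm_zero, mul_zero] at this
    exact norm_le_zero_iff.1 this
  let ℓ' : LinearMap.range D →ₗ[ℂ] ℂ :=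
    ((LinearMap.ker D).liftQ ℓ hker).comp D.quotKerEquivRange.symm.toLinearMap
  have hℓ' : ∀ x, ℓ' ⟨D x, LinearMap.mem_range_self D x⟩ = ℓ x := by
    intro x
    have : D.quotKerEquivRange.symm ⟨D x, LinearMap.mem_range_self D x⟩ = (LinearMap.ker D).mkQ x := by
      exact D.quotKerEquivRange_symm_apply_image x _
    simp [ℓ', this]
  have hb : ∀ y, ‖ℓ' y‖ ≤ C * ‖y‖ := by
    rintro ⟨_, x, rfl⟩
    rw [hℓ']
    exact h x
  obtain ⟨g, hg1, hg2⟩ := exists_extension_norm_eq (LinearMap.range D) (ℓ'.mkContinuous C hb)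
  refine ⟨(InnerProductSpace.toDual ℂ H).symm g, ?_, fun x => ?_⟩
  · rw [LinearIsometryEquiv.norm_map, hg2]
    exact LinearMap.mkContinuous_norm_le _ hC _
  · rw [InnerProductSpace.toDual_symm_apply]
    have := hg1 ⟨D x, LinearMap.mem_range_self D x⟩
    rw [this]
    exact hℓ' x
end GR

end PartB0

section PartB1
open MeasureTheory Metric Set Filter Topology
open scoped ENNReal NNReal InnerProductSpace

namespace GR

/-- complex test functions -/
def TestC : Submodule ℂ (ℂ → ℂ) where
  carrier := {Φ | ContDiff ℝ (⊤ : ℕ∞) Φ ∧ HasCompactSupport Φ}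
  add_mem' := fun h1 h2 => ⟨h1.1.add h2.1, h1.2.add h2.2⟩
  zero_mem' := ⟨contDiff_const, HasCompactSupport.zero⟩
  smul_mem' := fun c _ h => ⟨contDiff_const.smul h.1, h.2.smul_left (f := fun _ => c)⟩

noncomputable def Bform : ℂ →L[ℝ] ℂ →L[ℝ] ℝ :=
  (ContinuousLinearMap.compL ℝ ℂ ℂ ℝ Complex.imCLM).comp
    (((ContinuousLinearMap.compL ℝ ℂ ℂ ℂ).flip (Complex.conjCLE : ℂ →L[ℝ] ℂ)).comp
      (ContinuousLinearMap.mul ℝ ℂ))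

lemma Bform_apply (p q : ℂ) : Bform p q = (p * (starRingEnd ℂ) q).im := by
  simp [Bform]

lemma test_pd {Φ : ℂ → ℂ} (h : ContDiff ℝ (⊤ : ℕ∞) Φ ∧ HasCompactSupport Φ) (v : ℂ) :
    ContDiff ℝ (⊤ : ℕ∞) (fun z => fderiv ℝ Φ z v) ∧ HasCompactSupport (fun z => fderiv ℝ Φ z v) :=
  ⟨(h.1.fderiv_right (m := (⊤ : ℕ∞)) (by simp)).clm_apply contDiff_const, h.2.fderiv_apply ℝ v⟩

lemma B_int {Φ Ψ : ℂ → ℂ} (h : ContDiff ℝ (⊤ : ℕ∞) Φ ∧ HasCompactSupport Φ)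
    (h' : ContDiff ℝ (⊤ : ℕ∞) Ψ ∧ HasCompactSupport Ψ) :
    Integrable (fun z => Bform (Φ z) (Ψ z)) := by
  apply Continuous.integrable_of_hasCompactSupport
  · have := h.1.continuous
    have := h'.1.continuous
    fun_prop
  · apply h.2.mono
    intro z hz
    contrapose! hz
    simp only [Function.mem_support, not_not] at hz ⊢
    simp [hz]

lemma jac_zero {Φ : ℂ → ℂ} (h : ContDiff ℝ (⊤ : ℕ∞) Φ ∧ HasCompactSupport Φ) :
    ∫ z, Bform (fderiv ℝ Φ z 1) (fderiv ℝ Φ z Complex.I) = 0 := by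
  have hx := test_pd h 1
  have hy := test_pd h Complex.I
  have ibp : ∀ v w : ℂ, ∫ z, Bform (Φ z) (fderiv ℝ (fun z => fderiv ℝ Φ z w) z v) =
      - ∫ z, Bform (fderiv ℝ Φ z v) (fderiv ℝ Φ z w) := by
    intro v w
    have hw := test_pd h w
    apply integral_bilinear_hasFDerivAt_right_eq_neg_left_of_integrable (B := Bform)
      (f := Φ) (f' := fderiv ℝ Φ) (g := fun z => fderiv ℝ Φ z w)
      (g' := fderiv ℝ (fun z => fderiv ℝ Φ z w))
    · exact B_int (test_pd h v) hw
    · exact B_int h (test_pd hw v)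
    · exact B_int h hw
    · intro x _; exact (h.1.differentiable (by simp) x).hasFDerivAt
    · intro x _; exact (hw.1.differentiable (by simp) x).hasFDerivAt
  have h1 := ibp 1 Complex.I
  have h2 := ibp Complex.I 1
  have hsym : ∀ z, fderiv ℝ (fun z => fderiv ℝ Φ z Complex.I) z 1 =
      fderiv ℝ (fun z => fderiv ℝ Φ z 1) z Complex.I := by
    intro z
    have hd : DifferentiableAt ℝ (fderiv ℝ Φ) z :=
      (h.1.fderiv_right (m := (⊤ : ℕ∞)) (by simp)).differentiable (by simp) z
    have e : ∀ v w : ℂ, fderiv ℝ (fun z => fderiv ℝ Φ z w) z v = fderiv ℝ (fderiv ℝ Φ) z v w := by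
      intro v w
      rw [fderiv_clm_apply hd (differentiableAt_const w)]
      simp
    rw [e, e]
    have := (h.1.contDiffAt (x := z)).isSymmSndFDerivAt (by
      simp only [minSmoothness_of_isRCLikeNormedField]; exact WithTop.coe_le_coe.2 (le_top : (2:ℕ∞) ≤ ⊤))
    exact this 1 Complex.I
  simp only [hsym] at h1
  have hanti : ∀ z, Bform (fderiv ℝ Φ z Complex.I) (fderiv ℝ Φ z 1) =
      - Bform (fderiv ℝ Φ z 1) (fderiv ℝ Φ z Complex.I) := by
    intro z; simp only [Bform_apply, Complex.mul_im, Complex.conj_re, Complex.conj_im]; ring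
  simp only [hanti, integral_neg] at h2
  linarith

/-- dbar with a sign: `c = I` or `c = -I`. -/
noncomputable def Dop (c : ℂ) (Φ : ℂ → ℂ) (z : ℂ) : ℂ := fderiv ℝ Φ z 1 + c * fderiv ℝ Φ z Complex.I

lemma Dop_test (c : ℂ) {Φ : ℂ → ℂ} (h : ContDiff ℝ (⊤ : ℕ∞) Φ ∧ HasCompactSupport Φ) :
    ContDiff ℝ (⊤ : ℕ∞) (Dop c Φ) ∧ HasCompactSupport (Dop c Φ) := by
  have hx := test_pd h 1
  have hy := test_pd h Complex.I
  exact ⟨hx.1.add (contDiff_const.mul hy.1), hx.2.add (hy.2.mul_left (f := fun _ => c))⟩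

lemma test_memLp {Φ : ℂ → ℂ} (h : ContDiff ℝ (⊤ : ℕ∞) Φ ∧ HasCompactSupport Φ) (p : ℝ≥0∞) :
    MemLp Φ p volume := h.1.continuous.memLp_of_hasCompactSupport h.2

noncomputable def DL (c : ℂ) : TestC →ₗ[ℂ] Lp ℂ 2 (volume : Measure ℂ) where
  toFun Φ := (test_memLp (Dop_test c Φ.2) 2).toLp
  map_add' Φ Ψ := by
    rw [← MemLp.toLp_add]
    congr 1
    ext z
    simp only [Dop, Submodule.coe_add, Pi.add_apply]
    rw [fderiv_add (Φ.2.1.differentiable (by simp) z) (Ψ.2.1.differentiable (by simp) z)]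
    simp; ring
  map_smul' a Φ := by
    rw [RingHom.id_apply, ← MemLp.toLp_const_smul]
    congr 1
    ext z
    simp only [Dop, Submodule.coe_smul, Pi.smul_apply]
    rw [fderiv_const_smul (Φ.2.1.differentiable (by simp) z)]
    simp; ring

lemma DL_norm (Φ : TestC) : ‖DL (-Complex.I) Φ‖ = ‖DL Complex.I Φ‖ := by
  have hn : ∀ c : ℂ, ‖DL c Φ‖ ^ 2 = ∫ z, ‖Dop c Φ z‖ ^ 2 := by
    intro c
    rw [← inner_self_eq_norm_sq (𝕜 := ℂ), L2.inner_def]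
    rw [← integral_re (L2.integrable_inner _ _)]
    apply integral_congr_ae
    filter_upwards [(test_memLp (Dop_test c Φ.2) 2).coeFn_toLp] with z hz
    have : (DL c Φ : ℂ → ℂ) z = Dop c Φ z := hz
    rw [this, inner_self_eq_norm_sq]
  have hI : ∀ c : ℂ, Integrable (fun z => ‖Dop c Φ z‖ ^ 2) := fun c =>
    (test_memLp (Dop_test c Φ.2) 2).integrable_norm_pow (by norm_num)
  have : ‖DL (-Complex.I) Φ‖ ^ 2 = ‖DL Complex.I Φ‖ ^ 2 := by
    rw [hn, hn, ← sub_eq_zero, ← integral_sub (hI _) (hI _)]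
    have e : ∀ z, ‖Dop (-Complex.I) Φ z‖ ^ 2 - ‖Dop Complex.I Φ z‖ ^ 2 =
        (-4) * Bform (fderiv ℝ (Φ : ℂ → ℂ) z 1) (fderiv ℝ (Φ : ℂ → ℂ) z Complex.I) := by
      intro z
      rw [Bform_apply, Dop, Dop, ← Complex.normSq_eq_norm_sq, ← Complex.normSq_eq_norm_sq]
      simp [Complex.normSq_apply]
      ring
    simp only [e]
    rw [integral_const_mul, jac_zero Φ.2, mul_zero]
  exact (pow_left_inj₀ (norm_nonneg _) (norm_nonneg _) (by norm_num)).1 this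

theorem exists_beurling {f : ℂ → ℂ} (hf : MemLp f 2 volume) :
    ∃ s : ℂ → ℂ, MemLp s 2 volume ∧ eLpNorm s 2 volume ≤ eLpNorm f 2 volume ∧ WeakEq univ s f := by
  have hfc : MemLp (fun z => (starRingEnd ℂ) (f z)) 2 volume := hf.star
  set F := hfc.toLp with hF
  have hFn : ‖F‖ = (eLpNorm f 2 volume).toReal := by
    rw [hF, Lp.norm_toLp]
    congr 1
    apply eLpNorm_congr_norm_ae
    filter_upwards with z; simp
  let ℓ : TestC →ₗ[ℂ] ℂ := (innerSL ℂ F).toLinearMap.comp (DL (-Complex.I))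
  obtain ⟨s0, hs0, hs⟩ := factor_riesz (DL Complex.I) ℓ ‖F‖ (norm_nonneg _) (by
    intro Φ
    rw [← DL_norm]
    exact norm_inner_le_norm (𝕜 := ℂ) F (DL (-Complex.I) Φ))
  refine ⟨fun z => (starRingEnd ℂ) (s0 z), (Lp.memLp s0).star, ?_, ?_⟩
  · have : eLpNorm (fun z => (starRingEnd ℂ) (s0 z)) 2 volume = eLpNorm s0 2 volume := by
      apply eLpNorm_congr_norm_ae
      filter_upwards with z; simp
    rw [this, ← ENNReal.toReal_le_toReal (Lp.eLpNorm_ne_top s0) hf.2.ne, ← hFn]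
    exact hs0
  · intro φ hφ
    have hΦ : ContDiff ℝ (⊤ : ℕ∞) (fun z => (φ z : ℂ)) ∧ HasCompactSupport (fun z => (φ z : ℂ)) :=
      ⟨Complex.ofRealCLM.contDiff.comp hφ.smooth, hφ.cpt.comp_left (g := fun x : ℝ => (x : ℂ)) (by simp)⟩
    have hfd : ∀ z v, fderiv ℝ (fun z => (φ z : ℂ)) z v = (fderiv ℝ φ z v : ℂ) := by
      intro z v
      have := (Complex.ofRealCLM.hasFDerivAt (x := φ z)).comp z
        (hφ.smooth.differentiable (by simp) z).hasFDerivAt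
      have e := this.fderiv
      rw [Function.comp_def] at e
      simp only [Complex.ofRealCLM_apply] at e
      rw [e]; simp
    have e1 : ∀ z, Dop Complex.I (fun z => (φ z : ℂ)) z = db φ z := by
      intro z; simp [Dop, db, hfd]
    have e2 : ∀ z, Dop (-Complex.I) (fun z => (φ z : ℂ)) z = dd φ z := by
      intro z; simp [Dop, dd, hfd]; ring
    have h := hs ⟨fun z => (φ z : ℂ), hΦ⟩
    have h1 : ℓ ⟨fun z => (φ z : ℂ), hΦ⟩ = ⟪F, DL (-Complex.I) ⟨fun z => (φ z : ℂ), hΦ⟩⟫_ℂ := rfl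
    rw [h1, L2.inner_def, L2.inner_def] at h
    convert h using 1
    · apply integral_congr_ae
      filter_upwards [(test_memLp (Dop_test Complex.I hΦ) 2).coeFn_toLp] with z hz
      have : (DL Complex.I ⟨fun z => (φ z : ℂ), hΦ⟩ : ℂ → ℂ) z = db φ z := hz.trans (e1 z)
      rw [this, RCLike.inner_apply, mul_comm]
    · apply integral_congr_ae
      filter_upwards [(test_memLp (Dop_test (-Complex.I) hΦ) 2).coeFn_toLp, hfc.coeFn_toLp] with z hz hz2
      have : (DL (-Complex.I) ⟨fun z => (φ z : ℂ), hΦ⟩ : ℂ → ℂ) z = dd φ z := hz.trans (e2 z)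
      rw [this, hF, hz2, RCLike.inner_apply, mul_comm]
      simp

end GR

end PartB1

section PartC1
open MeasureTheory Metric Set Filter Topology
open scoped ENNReal NNReal

namespace GR

lemma L2_lint {f : ℂ → ℂ} : eLpNorm f 2 volume = (∫⁻ z, ‖f z‖ₑ ^ 2) ^ (1/2 : ℝ) := by
  rw [eLpNorm_eq_lintegral_rpow_enorm_toReal (by norm_num) (by norm_num)]
  simp

lemma L2_lint_le {f g : ℂ → ℂ} (h : eLpNorm f 2 volume ≤ eLpNorm g 2 volume) :
    ∫⁻ z, ‖f z‖ₑ ^ 2 ≤ ∫⁻ z, ‖g z‖ₑ ^ 2 := by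
  rw [L2_lint, L2_lint] at h
  exact (ENNReal.rpow_le_rpow_iff (by norm_num)).1 h

lemma test_mul_int {s : ℂ → ℂ} (hs : LocallyIntegrable s) {u : ℂ → ℂ} (hu : Continuous u)
    (hc : HasCompactSupport u) : Integrable (fun z => s z * u z) := by
  have := hs.integrable_smul_right_of_hasCompactSupport hu hc
  simpa [smul_eq_mul] using this

lemma db_cont {φ : ℂ → ℝ} {U} (h : IsTest U φ) : Continuous (db φ) ∧ HasCompactSupport (db φ) ∧
    Continuous (dd φ) ∧ HasCompactSupport (dd φ) ∧ (∀ z ∉ U, db φ z = 0 ∧ dd φ z = 0) := by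
  have hc : Continuous (fderiv ℝ φ) := h.smooth.continuous_fderiv (by simp)
  have hs : ∀ z ∉ tsupport φ, fderiv ℝ φ z = 0 := by
    intro z hz
    exact image_eq_zero_of_notMem_tsupport (fun hz' => hz (tsupport_fderiv_subset ℝ hz'))
  refine ⟨?_, ?_, ?_, ?_, ?_⟩
  · unfold db; fun_prop
  · apply HasCompactSupport.intro h.cpt
    intro z hz; simp [db, hs z hz]
  · unfold dd; fun_prop
  · apply HasCompactSupport.intro h.cpt
    intro z hz; simp [dd, hs z hz]
  · intro z hz
    have := hs z (fun hz' => hz (h.supp hz'))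
    simp [db, dd, this]

lemma local_decomp {s f : ℂ → ℂ} (hs : MemLp s 2 volume) (hf : MemLp f 2 volume)
    (hw : WeakEq univ s f) (B : Set ℂ) (hB : IsOpen B) :
    ∃ s₁ h : ℂ → ℂ, AEStronglyMeasurable s₁ volume ∧ ∫⁻ z, ‖s₁ z‖ₑ ^ 2 ≤ ∫⁻ z in B, ‖f z‖ₑ ^ 2 ∧
      DifferentiableOn ℂ h B ∧ ∀ᵐ z ∂(volume.restrict B), s z = s₁ z + h z := by
  have hfB : MemLp (B.indicator f) 2 volume := hf.indicator hB.measurableSet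
  obtain ⟨s₁, h1, h2, h3⟩ := exists_beurling hfB
  have hl : LocallyIntegrable (fun z => s z - s₁ z) := (hs.sub h1).locallyIntegrable (by norm_num)
  have hw' : WeakEq B (fun z => s z - s₁ z) 0 := by
    intro φ hφ
    have hφ' : IsTest univ φ := ⟨hφ.smooth, hφ.cpt, subset_univ _⟩
    obtain ⟨c1, c2, c3, c4, c5⟩ := db_cont hφ
    have e1 := hw φ hφ'
    have e2 := h3 φ hφ'
    have i1 := test_mul_int (hs.locallyIntegrable (by norm_num)) c1 c2
    have i2 := test_mul_int (h1.locallyIntegrable (by norm_num)) c1 c2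
    simp only [sub_mul]
    rw [integral_sub i1 i2, e1, e2]
    have : ∫ z, B.indicator f z * dd φ z = ∫ z, f z * dd φ z := by
      congr 1
      ext z
      by_cases hz : z ∈ B
      · simp [hz]
      · simp [hz, (c5 z hz).2]
    rw [this]; simp
  obtain ⟨h, hh, hae⟩ := weyl hB hl hw'
  refine ⟨s₁, h, h1.1, ?_, hh, ?_⟩
  · refine (L2_lint_le h2).trans (le_of_eq ?_)
    rw [← lintegral_indicator hB.measurableSet]
    congr 1; ext z
    by_cases hz : z ∈ B <;> simp [hz]
  · filter_upwards [hae] with z hz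
    rw [← hz]; ring

lemma enorm_add_sq (a b : ℂ) : ‖a + b‖ₑ ^ 2 ≤ 2 * ‖a‖ₑ ^ 2 + 2 * ‖b‖ₑ ^ 2 := by
  have h : ∀ a : ℂ, ‖a‖ₑ ^ 2 = ENNReal.ofReal (‖a‖ ^ 2) := fun a => by
    rw [ENNReal.ofReal_pow (norm_nonneg _), ofReal_norm]
  rw [h, h, h, show (2:ℝ≥0∞) = ENNReal.ofReal 2 by simp, ← ENNReal.ofReal_mul (by norm_num),
    ← ENNReal.ofReal_mul (by norm_num), ← ENNReal.ofReal_add (by positivity) (by positivity)]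
  apply ENNReal.ofReal_le_ofReal
  have := norm_add_le a b
  nlinarith [norm_nonneg a, norm_nonneg b, norm_nonneg (a+b), sq_nonneg (‖a‖-‖b‖)]

lemma local_est {s f : ℂ → ℂ} (hsm : Measurable s) (hfm : Measurable f)
    (hs : MemLp s 2 volume) (hf : MemLp f 2 volume)
    (hw : WeakEq univ s f) {K l R : ℝ} (hK : 1 ≤ K) (hl : 0 < l) (hR : 0 < R) (x : ℂ)
    (hH : ∫⁻ z in ball x R, (ENNReal.ofReal (‖s z‖ ^ 2) + ENNReal.ofReal K * ENNReal.ofReal (‖f z‖ ^ 2))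
      ≤ ENNReal.ofReal (l * (Real.pi * R ^ 2))) :
    ENNReal.ofReal K * ∫⁻ z in closedBall x (R / 2) ∩ {z | 64 * l < ‖s z‖ ^ 2}, ENNReal.ofReal (‖s z‖ ^ 2)
      ≤ 4 * ENNReal.ofReal (l * (Real.pi * R ^ 2)) := by
  obtain ⟨s₁, h, hm1, hb, hh, hae⟩ := local_decomp hs hf hw (ball x R) isOpen_ball
  have hpow : ∀ a : ℂ, ENNReal.ofReal (‖a‖ ^ 2) = ‖a‖ₑ ^ 2 := fun a => by
    rw [ENNReal.ofReal_pow (norm_nonneg _), ofReal_norm]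
  simp only [hpow] at hH ⊢
  rw [lintegral_add_left (by fun_prop), lintegral_const_mul _ (by fun_prop)] at hH
  have hH1 := le_trans le_self_add hH
  have hH2 : ENNReal.ofReal K * ∫⁻ z in ball x R, ‖f z‖ₑ ^ 2 ≤ ENNReal.ofReal (l * (Real.pi * R ^ 2)) :=
    le_trans le_add_self hH
  have hH3 : ∫⁻ z in ball x R, ‖f z‖ₑ ^ 2 ≤ ENNReal.ofReal (l * (Real.pi * R ^ 2)) := by
    refine le_trans ?_ hH2
    apply le_mul_of_one_le_left zero_le
    simpa using ENNReal.ofReal_le_ofReal hK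
  have hhI : ∫⁻ z in ball x R, ‖h z‖ₑ ^ 2 ≤ 4 * ENNReal.ofReal (l * (Real.pi * R ^ 2)) := by
    calc ∫⁻ z in ball x R, ‖h z‖ₑ ^ 2 ≤ ∫⁻ z in ball x R, (2 * ‖s z‖ₑ ^ 2 + 2 * ‖s₁ z‖ₑ ^ 2) := by
          apply lintegral_mono_ae
          filter_upwards [hae] with z hz
          have : h z = s z + (- s₁ z) := by rw [hz]; ring
          rw [this]
          refine (enorm_add_sq _ _).trans ?_
          rw [enorm_neg]
      _ = 2 * (∫⁻ z in ball x R, ‖s z‖ₑ ^ 2) + 2 * (∫⁻ z in ball x R, ‖s₁ z‖ₑ ^ 2) := by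
          rw [lintegral_add_left (by fun_prop), lintegral_const_mul _ (by fun_prop),
            lintegral_const_mul' _ _ (by simp)]
      _ ≤ 2 * ENNReal.ofReal (l * (Real.pi * R ^ 2)) + 2 * ENNReal.ofReal (l * (Real.pi * R ^ 2)) := by
          gcongr
          exact (setLIntegral_le_lintegral _ _).trans (hb.trans hH3)
      _ = _ := by rw [← add_mul]; norm_num
  have hpt : ∀ y ∈ closedBall x (R/2), ‖h y‖ ^ 2 ≤ 16 * l := by
    intro y hy
    have hsub : ball y (R/2) ⊆ ball x R := by
      apply ball_subset_ball'
      rw [mem_closedBall] at hy; linarith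
    have := submean (h := fun z => h z ^ 2) (x := y) (r := R/2) (by positivity)
      ((hh.mono hsub).pow 2)
    have h2 : ENNReal.ofReal (Real.pi * (R/2)^2) * ENNReal.ofReal (‖h y‖ ^ 2) ≤
        4 * ENNReal.ofReal (l * (Real.pi * R ^ 2)) := by
      rw [hpow]
      simp only [enorm_pow] at this
      exact this.trans ((lintegral_mono_set hsub).trans hhI)
    rw [show (4:ℝ≥0∞) = ENNReal.ofReal 4 by simp, ← ENNReal.ofReal_mul (by positivity),
      ← ENNReal.ofReal_mul (by positivity), ENNReal.ofReal_le_ofReal_iff (by positivity)] at h2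
    have hpi : 0 < Real.pi * R^2 := by positivity
    have h3 : (Real.pi * R^2) * ‖h y‖^2 ≤ (Real.pi * R^2) * (16 * l) := by nlinarith
    exact le_of_mul_le_mul_left h3 hpi
  have hms : MeasurableSet (closedBall x (R / 2) ∩ {z | 64 * l < ‖s z‖ ^ 2}) :=
    measurableSet_closedBall.inter (measurableSet_lt measurable_const (by fun_prop))
  have hfin : ∫⁻ z in closedBall x (R / 2) ∩ {z | 64 * l < ‖s z‖ ^ 2}, ‖s z‖ₑ ^ 2 ≤
      4 * ∫⁻ z in ball x R, ‖f z‖ₑ ^ 2 := by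
    calc _ ≤ ∫⁻ z in closedBall x (R / 2) ∩ {z | 64 * l < ‖s z‖ ^ 2}, 4 * ‖s₁ z‖ₑ ^ 2 := by
          apply setLIntegral_mono_ae' hms
          have := (ae_restrict_iff' measurableSet_ball).1 hae
          filter_upwards [this] with z hz hz2
          have hzb : z ∈ ball x R := by
            have := hz2.1
            rw [mem_closedBall] at this; rw [mem_ball]; linarith
          have e := hz hzb
          have a1 := hpt z hz2.1
          have a2 : 64 * l < ‖s z‖ ^ 2 := hz2.2
          have a3 : ‖s z‖ ≤ ‖s₁ z‖ + ‖h z‖ := by rw [e]; exact norm_add_le _ _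
          have a4 : ‖s z‖ ^ 2 ≤ 4 * ‖s₁ z‖ ^ 2 := by
            have : 2 * ‖h z‖ ≤ ‖s z‖ := by
              apply abs_le_of_sq_le_sq' _ (norm_nonneg _) |>.2
              nlinarith
            nlinarith [norm_nonneg (s z), norm_nonneg (s₁ z), norm_nonneg (h z)]
          rw [← hpow, ← hpow, show (4:ℝ≥0∞) = ENNReal.ofReal 4 by simp, ← ENNReal.ofReal_mul (by norm_num)]
          exact ENNReal.ofReal_le_ofReal a4
      _ ≤ ∫⁻ z, 4 * ‖s₁ z‖ₑ ^ 2 := setLIntegral_le_lintegral _ _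
      _ = 4 * ∫⁻ z, ‖s₁ z‖ₑ ^ 2 := lintegral_const_mul' _ _ (by simp)
      _ ≤ _ := by gcongr
  calc _ ≤ ENNReal.ofReal K * (4 * ∫⁻ z in ball x R, ‖f z‖ₑ ^ 2) := by gcongr
    _ = 4 * (ENNReal.ofReal K * ∫⁻ z in ball x R, ‖f z‖ₑ ^ 2) := by ring
    _ ≤ _ := by gcongr

end GR

end PartC1

section PartC2
open MeasureTheory Metric Set Filter Topology
open scoped ENNReal NNReal

namespace GR

lemma exists_radius {H : ℂ → ℝ≥0∞} (hHfin : ∫⁻ z, H z ≠ ∞) {l : ℝ} (hl : 0 < l) {x : ℂ}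
    (hx : Tendsto (fun r => (∫⁻ y in closedBall x r, H y) / volume (closedBall x r)) (𝓝[>] 0) (𝓝 (H x)))
    (hHx : ENNReal.ofReal l < H x) :
    ∃ r : ℝ, 0 < r ∧ r ≤ Real.sqrt ((∫⁻ z, H z).toReal / (Real.pi * l)) ∧
      ENNReal.ofReal (l * (Real.pi * r ^ 2)) < ∫⁻ y in closedBall x r, H y ∧
      ∀ r' ≥ 2 * r, ∫⁻ y in closedBall x r', H y ≤ ENNReal.ofReal (l * (Real.pi * r' ^ 2)) := by
  set S : Set ℝ := {r | 0 < r ∧ ENNReal.ofReal (l * (Real.pi * r ^ 2)) < ∫⁻ y in closedBall x r, H y} with hS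
  set M := Real.sqrt ((∫⁻ z, H z).toReal / (Real.pi * l)) with hM
  have hbd : ∀ r ∈ S, r ≤ M := by
    rintro r ⟨hr, h⟩
    apply Real.le_sqrt_of_sq_le
    rw [le_div_iff₀ (by positivity)]
    have h2 := h.trans_le (setLIntegral_le_lintegral _ _)
    have h3 := (ENNReal.ofReal_lt_iff_lt_toReal (by positivity) hHfin).1 h2
    nlinarith
  have hne : S.Nonempty := by
    have h1 := (hx.eventually (lt_mem_nhds hHx)).and self_mem_nhdsWithin
    obtain ⟨r, hr, hr0⟩ := h1.exists
    have hr0 : 0 < r := hr0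
    refine ⟨r, hr0, ?_⟩
    rw [vol_cball _ hr0.le] at hr
    rw [ENNReal.ofReal_mul hl.le]
    exact ENNReal.lt_div_iff_mul_lt (Or.inl (by simp; positivity)) (Or.inl ENNReal.ofReal_ne_top) |>.1 hr
  have hba : BddAbove S := ⟨M, hbd⟩
  obtain ⟨r0, hr0⟩ := hne
  have hpos : 0 < sSup S := hr0.1.trans_le (le_csSup hba hr0)
  obtain ⟨r, hrS, hr⟩ := exists_lt_of_lt_csSup ⟨r0, hr0⟩ (half_lt_self hpos)
  refine ⟨r, hrS.1, hbd r hrS, hrS.2, fun r' hr' => ?_⟩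
  by_contra! hc
  have : r' ∈ S := ⟨by linarith [hrS.1], hc⟩
  have := le_csSup hba this
  linarith

lemma covering {H F : ℂ → ℝ≥0∞} (hH : Measurable H) (hHfin : ∫⁻ z, H z ≠ ∞) (hFH : ∀ z, F z ≤ H z)
    {l : ℝ} (hl : 0 < l) :
    ∃ (u : Set ℂ) (r : ℂ → ℝ), u.Countable ∧ (∀ x ∈ u, 0 < r x) ∧
      u.PairwiseDisjoint (fun x => closedBall x (r x)) ∧
      (∀ x ∈ u, ENNReal.ofReal (l * (Real.pi * r x ^ 2)) ≤ ∫⁻ y in closedBall x (r x), H y) ∧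
      (∀ x ∈ u, ∫⁻ y in ball x (10 * r x), H y ≤ ENNReal.ofReal (l * (Real.pi * (10 * r x) ^ 2))) ∧
      ∀ᵐ z, ENNReal.ofReal l < F z → z ∈ ⋃ x ∈ u, closedBall x (5 * r x) := by
  have hL := (Besicovitch.vitaliFamily (volume : Measure ℂ)).ae_tendsto_lintegral_div hH.aemeasurable hHfin
  have hex : ∀ x : ℂ, ∃ r : ℝ, (Tendsto (fun a => (∫⁻ y in a, H y) / volume a)
      ((Besicovitch.vitaliFamily (volume : Measure ℂ)).filterAt x) (𝓝 (H x)) ∧ ENNReal.ofReal l < F x) → 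
      0 < r ∧ r ≤ Real.sqrt ((∫⁻ z, H z).toReal / (Real.pi * l)) ∧
      ENNReal.ofReal (l * (Real.pi * r ^ 2)) < ∫⁻ y in closedBall x r, H y ∧
      ∀ r' ≥ 2 * r, ∫⁻ y in closedBall x r', H y ≤ ENNReal.ofReal (l * (Real.pi * r' ^ 2)) := by
    intro x
    by_cases h : (Tendsto (fun a => (∫⁻ y in a, H y) / volume a)
      ((Besicovitch.vitaliFamily (volume : Measure ℂ)).filterAt x) (𝓝 (H x)) ∧ ENNReal.ofReal l < F x)
    · obtain ⟨r, hr⟩ := exists_radius hHfin hl (h.1.comp (Besicovitch.tendsto_filterAt volume x))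
        (h.2.trans_le (hFH x))
      exact ⟨r, fun _ => hr⟩
    · exact ⟨0, fun h' => absurd h' h⟩
  choose r hr using hex
  set t : Set ℂ := {x | (Tendsto (fun a => (∫⁻ y in a, H y) / volume a)
      ((Besicovitch.vitaliFamily (volume : Measure ℂ)).filterAt x) (𝓝 (H x)) ∧ ENNReal.ofReal l < F x)} with ht
  obtain ⟨u, hut, hdisj, hcov⟩ := Vitali.exists_disjoint_subfamily_covering_enlargement_closedBall t
    (fun x => x) r (Real.sqrt ((∫⁻ z, H z).toReal / (Real.pi * l))) (fun x hx => (hr x hx).2.1) 5 (by norm_num)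
  refine ⟨u, r, ?_, fun x hx => (hr x (hut hx)).1, hdisj, fun x hx => (hr x (hut hx)).2.2.1.le, ?_, ?_⟩
  · apply hdisj.countable_of_nonempty_interior
    intro x hx
    exact ⟨x, ball_subset_interior_closedBall (mem_ball_self (hr x (hut hx)).1)⟩
  · intro x hx
    have := hr x (hut hx)
    exact (lintegral_mono_set ball_subset_closedBall).trans (this.2.2.2 _ (by linarith [this.1]))
  · filter_upwards [hL] with z hz hFz
    obtain ⟨b, hb, hsub⟩ := hcov z ⟨hz, hFz⟩
    exact mem_biUnion hb (hsub (mem_closedBall_self (hr z ⟨hz, hFz⟩).1.le))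

end GR

end PartC2

section PartC3
open MeasureTheory Metric Set Filter Topology
open scoped ENNReal NNReal

namespace GR

/-- truncated tail integral -/
noncomputable def tail (F : ℂ → ℝ) (l : ℝ) : ℝ≥0∞ := ∫⁻ z in {z | l < F z}, ENNReal.ofReal (F z)

lemma split_tail {F : ℂ → ℝ} (hF : Measurable F) (B : Set ℂ) (t : ℝ) :
    ∫⁻ z in B, ENNReal.ofReal (F z) ≤ ENNReal.ofReal t * volume B +
      ∫⁻ z in B, {z | t < F z}.indicator (fun z => ENNReal.ofReal (F z)) z := by
  have hm : MeasurableSet {z | t < F z} := measurableSet_lt measurable_const hF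
  rw [← setLIntegral_const, ← lintegral_add_left measurable_const]
  apply lintegral_mono
  intro z
  by_cases h : t < F z
  · simp [h]
  · simp [h]; exact ENNReal.ofReal_le_ofReal (not_lt.1 h)

lemma good_lambda {s f : ℂ → ℂ} (hsm : Measurable s) (hfm : Measurable f)
    (hs : MemLp s 2 volume) (hf : MemLp f 2 volume)
    (hw : WeakEq univ s f) {K l : ℝ} (hK : 1 ≤ K) (hl : 0 < l) :
    ENNReal.ofReal K * tail (fun z => ‖s z‖ ^ 2) (64 * l) ≤
      800 * tail (fun z => ‖s z‖ ^ 2) (l / 4) +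
      800 * (ENNReal.ofReal K * tail (fun z => ‖f z‖ ^ 2) (l / (4 * K))) := by
  set F : ℂ → ℝ := fun z => ‖s z‖ ^ 2 with hF
  set G : ℂ → ℝ := fun z => ‖f z‖ ^ 2 with hG
  have hFm : Measurable F := by fun_prop
  have hGm : Measurable G := by fun_prop
  have hpow : ∀ a : ℂ, ENNReal.ofReal (‖a‖ ^ 2) = ‖a‖ₑ ^ 2 := fun a => by
    rw [ENNReal.ofReal_pow (norm_nonneg _), ofReal_norm]
  have hfin : ∀ {g : ℂ → ℂ}, MemLp g 2 volume → ∫⁻ z, ENNReal.ofReal (‖g z‖ ^ 2) ≠ ∞ := by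
    intro g hg
    simp only [hpow]
    have := hg.2
    rw [L2_lint] at this
    intro h
    rw [h] at this
    simp at this
  set H : ℂ → ℝ≥0∞ := fun z => ENNReal.ofReal (F z) + ENNReal.ofReal K * ENNReal.ofReal (G z) with hH
  have hHm : Measurable H := by fun_prop
  have hHfin : ∫⁻ z, H z ≠ ∞ := by
    simp only [hH]
    rw [lintegral_add_left (by fun_prop), lintegral_const_mul _ (by fun_prop)]
    exact ENNReal.add_ne_top.2 ⟨hfin hs, ENNReal.mul_ne_top ENNReal.ofReal_ne_top (hfin hf)⟩
  obtain ⟨u, r, huc, hrp, hdisj, hlow, hup, hcov⟩ := covering (F := fun z => ENNReal.ofReal (F z)) hHm hHfin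
    (fun z => le_self_add) hl
  have hm64 : MeasurableSet {z | 64 * l < F z} := measurableSet_lt measurable_const hFm
  have : Countable u := huc
  -- step 1
  have h1 : ENNReal.ofReal K * tail F (64 * l) ≤ ∑' x : u, 400 * ENNReal.ofReal (l * (Real.pi * r x ^ 2)) := by
    have a1 : tail F (64 * l) ≤ ∫⁻ z in ⋃ x : u, (closedBall (x:ℂ) (5 * r x) ∩ {z | 64 * l < F z}),
        ENNReal.ofReal (F z) := by
      unfold tail
      apply lintegral_mono'
      · apply Measure.restrict_mono_ae
        filter_upwards [hcov] with z hz hz2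
        have hz2 : 64 * l < F z := hz2
        have := hz ((ENNReal.ofReal_lt_ofReal_iff (by linarith)).2 (by linarith))
        simp only [mem_iUnion, exists_prop] at this
        obtain ⟨x, hx, hzx⟩ := this
        exact mem_iUnion.2 ⟨⟨x, hx⟩, hzx, hz2⟩
      · exact le_rfl
    calc _ ≤ ENNReal.ofReal K * ∑' x : u, ∫⁻ z in (closedBall (x:ℂ) (5 * r x) ∩ {z | 64 * l < F z}),
        ENNReal.ofReal (F z) := by
          gcongr
          exact a1.trans (lintegral_iUnion_le _ _)
      _ = ∑' x : u, ENNReal.ofReal K * ∫⁻ z in (closedBall (x:ℂ) (5 * r x) ∩ {z | 64 * l < F z}),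
        ENNReal.ofReal (F z) := ENNReal.tsum_mul_left.symm
      _ ≤ _ := by
          apply ENNReal.tsum_le_tsum
          intro x
          have hrx := hrp x x.2
          have := local_est hsm hfm hs hf hw hK hl (R := 10 * r x) (by positivity) x (hup x x.2)
          rw [show 10 * r x / 2 = 5 * r x by ring] at this
          refine this.trans (le_of_eq ?_)
          rw [show (4:ℝ≥0∞) = ENNReal.ofReal 4 by simp, show (400:ℝ≥0∞) = ENNReal.ofReal 400 by simp,
            ← ENNReal.ofReal_mul (by norm_num), ← ENNReal.ofReal_mul (by norm_num)]
          congr 1; ring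
  -- step 2
  set F' := {z | l / 4 < F z}.indicator (fun z => ENNReal.ofReal (F z)) with hF'
  set G' := {z | l / (4 * K) < G z}.indicator (fun z => ENNReal.ofReal (G z)) with hG'
  have hF'm : Measurable F' := by
    apply Measurable.indicator (by fun_prop) (measurableSet_lt measurable_const hFm)
  have hG'm : Measurable G' := by
    apply Measurable.indicator (by fun_prop) (measurableSet_lt measurable_const hGm)
  have h2 : ∀ x ∈ u, ENNReal.ofReal (l * (Real.pi * r x ^ 2)) ≤
      2 * ∫⁻ z in closedBall x (r x), (F' z + ENNReal.ofReal K * G' z) := by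
    intro x hx
    have hrx := hrp x hx
    set V := ENNReal.ofReal (l * (Real.pi * r x ^ 2)) with hV
    have b1 := hlow x hx
    simp only [hH] at b1
    rw [lintegral_add_left (by fun_prop), lintegral_const_mul _ (by fun_prop)] at b1
    have b2 := split_tail hFm (closedBall x (r x)) (l/4)
    have b3 := split_tail hGm (closedBall x (r x)) (l/(4*K))
    rw [vol_cball _ hrx.le] at b2 b3
    rw [lintegral_add_left hF'm, lintegral_const_mul _ hG'm]
    set A := ∫⁻ z in closedBall x (r x), F' z
    set Bq := ∫⁻ z in closedBall x (r x), G' z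
    have hVF : ENNReal.ofReal (l/4) * ENNReal.ofReal (Real.pi * r x ^2) = ENNReal.ofReal (1/4) * V := by
      rw [hV, ← ENNReal.ofReal_mul (by positivity), ← ENNReal.ofReal_mul (by positivity)]
      congr 1; ring
    have hVG : ENNReal.ofReal K * (ENNReal.ofReal (l/(4*K)) * ENNReal.ofReal (Real.pi * r x ^2))
        = ENNReal.ofReal (1/4) * V := by
      rw [hV, ← ENNReal.ofReal_mul (by positivity), ← ENNReal.ofReal_mul (by positivity),
        ← ENNReal.ofReal_mul (by positivity)]
      congr 1; field_simp
    have b4 : V ≤ ENNReal.ofReal (1/2) * V + (A + ENNReal.ofReal K * Bq) := by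
      calc V ≤ _ := b1
        _ ≤ (ENNReal.ofReal (l/4) * ENNReal.ofReal (Real.pi * r x ^2) + A) +
            ENNReal.ofReal K * (ENNReal.ofReal (l/(4*K)) * ENNReal.ofReal (Real.pi * r x ^2) + Bq) := by
              exact add_le_add b2 (mul_le_mul_right b3 _)
        _ = (ENNReal.ofReal (1/4) + ENNReal.ofReal (1/4)) * V + (A + ENNReal.ofReal K * Bq) := by
              rw [mul_add, hVF, hVG]; ring
        _ = _ := by rw [← ENNReal.ofReal_add (by norm_num) (by norm_num)]; norm_num
    have hVt : V ≠ ∞ := ENNReal.ofReal_ne_top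
    have b5 : ENNReal.ofReal (1/2) * V + ENNReal.ofReal (1/2) * V = V := by
      rw [← add_mul, ← ENNReal.ofReal_add (by norm_num) (by norm_num)]; norm_num
    have b6 : ENNReal.ofReal (1/2) * V ≤ A + ENNReal.ofReal K * Bq := by
      have : ENNReal.ofReal (1/2) * V + ENNReal.ofReal (1/2) * V ≤
          ENNReal.ofReal (1/2) * V + (A + ENNReal.ofReal K * Bq) := by rw [b5]; exact b4
      exact (ENNReal.add_le_add_iff_left (ENNReal.mul_ne_top ENNReal.ofReal_ne_top hVt)).1 this
    calc V = 2 * (ENNReal.ofReal (1/2) * V) := by rw [two_mul, b5]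
      _ ≤ _ := by gcongr
  have h3 : ∑' x : u, 400 * ENNReal.ofReal (l * (Real.pi * r x ^ 2)) ≤
      800 * (∫⁻ z, (F' z + ENNReal.ofReal K * G' z)) := by
    calc _ ≤ ∑' x : u, 800 * ∫⁻ z in closedBall (x:ℂ) (r x), (F' z + ENNReal.ofReal K * G' z) := by
          apply ENNReal.tsum_le_tsum
          intro x
          calc _ ≤ 400 * (2 * ∫⁻ z in closedBall (x:ℂ) (r x), (F' z + ENNReal.ofReal K * G' z)) :=
                mul_le_mul_right (h2 x x.2) _
            _ = _ := by rw [← mul_assoc]; norm_num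
      _ = 800 * ∑' x : u, ∫⁻ z in closedBall (x:ℂ) (r x), (F' z + ENNReal.ofReal K * G' z) :=
          ENNReal.tsum_mul_left
      _ = 800 * ∫⁻ z in ⋃ x : u, closedBall (x:ℂ) (r x), (F' z + ENNReal.ofReal K * G' z) := by
          rw [lintegral_iUnion (fun _ => measurableSet_closedBall)]
          intro x y hxy
          exact hdisj x.2 y.2 (fun h => hxy (Subtype.ext h))
      _ ≤ _ := mul_le_mul_right (setLIntegral_le_lintegral _ _) _
  refine (h1.trans h3).trans (le_of_eq ?_)
  rw [lintegral_add_left hF'm, lintegral_const_mul _ hG'm, hF', hG',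
    lintegral_indicator (measurableSet_lt measurable_const hFm),
    lintegral_indicator (measurableSet_lt measurable_const hGm), mul_add]
  rfl

end GR

end PartC3

section PartC4
open MeasureTheory Metric Set Filter Topology
open scoped ENNReal NNReal

namespace GR

lemma int_pow {t r : ℝ} (hr : 1 < r) (ht : 0 ≤ t) :
    ∫⁻ x in Ioo 0 t, ENNReal.ofReal (x ^ (r - 2)) = ENNReal.ofReal (t ^ (r - 1) / (r - 1)) := by
  have hi : IntervalIntegrable (fun x : ℝ => x ^ (r - 2)) volume 0 t :=
    intervalIntegral.intervalIntegrable_rpow' (by linarith)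
  have hi2 : IntegrableOn (fun x : ℝ => x ^ (r - 2)) (Ioo 0 t) := by
    rw [intervalIntegrable_iff_integrableOn_Ioc_of_le ht] at hi
    exact hi.mono_set Ioo_subset_Ioc_self
  rw [← ofReal_integral_eq_lintegral_ofReal hi2, ← integral_Ioc_eq_integral_Ioo,
    ← intervalIntegral.integral_of_le ht, integral_rpow (Or.inl (by linarith))]
  · rw [show r - 2 + 1 = r - 1 by ring, Real.zero_rpow (by linarith), sub_zero]
  · filter_upwards [ae_restrict_mem measurableSet_Ioo] with x hx
    exact Real.rpow_nonneg hx.1.le _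

lemma tail_int {F : ℂ → ℝ} (hF : Measurable F) (hF0 : ∀ z, 0 ≤ F z) {c T r : ℝ} (hc : 0 < c) (hT : 0 < T)
    (hr : 1 < r) :
    ∫⁻ m in Ioo 0 T, ENNReal.ofReal (m ^ (r - 2)) * tail F (c * m) =
      ∫⁻ z, ENNReal.ofReal (F z) * ENNReal.ofReal ((min T (F z / c)) ^ (r - 1) / (r - 1)) := by
  have e1 : ∀ m, tail F (c * m) = ∫⁻ z, Set.indicator {q : ℝ × ℂ | c * q.1 < F q.2}
          (fun q => ENNReal.ofReal (F q.2)) (m, z) := by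
    intro m
    rw [tail, ← lintegral_indicator (measurableSet_lt measurable_const hF)]
    rfl
  have hms : MeasurableSet {q : ℝ × ℂ | c * q.1 < F q.2} := measurableSet_lt (by fun_prop) (by fun_prop)
  have hmi : Measurable (Set.indicator {q : ℝ × ℂ | c * q.1 < F q.2}
      (fun q => ENNReal.ofReal (F q.2))) := Measurable.indicator (by fun_prop) hms
  calc _ = ∫⁻ m in Ioo 0 T, ∫⁻ z, ENNReal.ofReal (m ^ (r - 2)) * Set.indicator {q : ℝ × ℂ | c * q.1 < F q.2}
          (fun q => ENNReal.ofReal (F q.2)) (m, z) := by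
        apply lintegral_congr
        intro m
        rw [e1, lintegral_const_mul' _ _ ENNReal.ofReal_ne_top]
    _ = ∫⁻ z, ∫⁻ m in Ioo 0 T, ENNReal.ofReal (m ^ (r - 2)) * Set.indicator {q : ℝ × ℂ | c * q.1 < F q.2}
          (fun q => ENNReal.ofReal (F q.2)) (m, z) := by
        apply lintegral_lintegral_swap
        apply Measurable.aemeasurable
        apply Measurable.mul
        · fun_prop
        · exact hmi
    _ = _ := by
        apply lintegral_congr
        intro z
        have : ∀ m, ENNReal.ofReal (m ^ (r - 2)) * Set.indicator {q : ℝ × ℂ | c * q.1 < F q.2}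
            (fun q => ENNReal.ofReal (F q.2)) (m, z) = (Iio (F z / c)).indicator
              (fun m => ENNReal.ofReal (F z) * ENNReal.ofReal (m ^ (r - 2))) m := by
          intro m
          by_cases h : c * m < F z
          · have h' : m < F z / c := by rw [lt_div_iff₀ hc]; linarith
            simp [h, h', mul_comm]
          · have h' : ¬ m < F z / c := by rw [lt_div_iff₀ hc]; linarith
            simp [h, h']
        simp only [this]
        rw [setLIntegral_indicator measurableSet_Iio, lintegral_const_mul' _ _ ENNReal.ofReal_ne_top]
        congr 1
        rw [← int_pow hr (le_min hT.le (div_nonneg (hF0 z) hc.le))]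
        congr 2
        rw [inter_comm, Ioo_inter_Iio]

lemma good_int {F G : ℂ → ℝ} (hF : Measurable F) (hF0 : ∀ z, 0 ≤ F z) (hG : Measurable G) (hG0 : ∀ z, 0 ≤ G z)
    (hFi : ∫⁻ z, ENNReal.ofReal (F z) ≠ ∞) {r K : ℝ} (hr : 1 < r) (hK : K = 1600 * 256 ^ (r - 1))
    (h : ∀ m > 0, ENNReal.ofReal K * tail F (256 * m) ≤ 800 * tail F m + 800 * (ENNReal.ofReal K * tail G (K⁻¹ * m))) :
    ∫⁻ z, ENNReal.ofReal (F z ^ r) ≤ ENNReal.ofReal (K ^ r) * ∫⁻ z, ENNReal.ofReal (G z ^ r) := by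
  have hK0 : 0 < K := by rw [hK]; positivity
  set X : ℝ → ℝ≥0∞ := fun T => ∫⁻ z, ENNReal.ofReal (F z * (min T (F z)) ^ (r - 1)) with hX
  set Q := ∫⁻ z, ENNReal.ofReal (G z ^ r) with hQ
  have hr1 : 0 < r - 1 := by linarith
  have key : ∀ T > 0, X T ≤ ENNReal.ofReal (K ^ r) * Q := by
    intro T hT
    have hXfin : X T ≠ ∞ := by
      have : X T ≤ ∫⁻ z, ENNReal.ofReal (T ^ (r - 1)) * ENNReal.ofReal (F z) := by
        apply lintegral_mono
        intro z
        simp only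
        rw [← ENNReal.ofReal_mul (by positivity), mul_comm]
        apply ENNReal.ofReal_le_ofReal
        exact mul_le_mul_of_nonneg_right (Real.rpow_le_rpow (le_min hT.le (hF0 z)) (min_le_left _ _) hr1.le) (hF0 z)
      refine ne_top_of_le_ne_top ?_ this
      rw [lintegral_const_mul' _ _ ENNReal.ofReal_ne_top]
      exact ENNReal.mul_ne_top ENNReal.ofReal_ne_top hFi
    have h1 : ∫⁻ m in Ioo 0 T, ENNReal.ofReal (m ^ (r - 2)) * (ENNReal.ofReal K * tail F (256 * m)) ≤
        ∫⁻ m in Ioo 0 T, ENNReal.ofReal (m ^ (r - 2)) *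
          (800 * tail F (1 * m) + 800 * (ENNReal.ofReal K * tail G (K⁻¹ * m))) := by
      apply setLIntegral_mono' measurableSet_Ioo
      intro m hm
      rw [one_mul]
      exact mul_le_mul_right (h m hm.1) _
    have tm : ∀ {F : ℂ → ℝ}, Measurable F → ∀ c, Measurable (fun m => tail F (c * m)) := by
      intro F hF c
      unfold tail
      have hms : MeasurableSet {q : ℝ × ℂ | c * q.1 < F q.2} := measurableSet_lt (by fun_prop) (by fun_prop)
      have hmi : Measurable (Set.indicator {q : ℝ × ℂ | c * q.1 < F q.2}
          (fun q => ENNReal.ofReal (F q.2))) := Measurable.indicator (by fun_prop) hms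
      have := hmi.lintegral_prod_right' (ν := (volume : Measure ℂ))
      convert this using 2 with m
      rw [← lintegral_indicator (measurableSet_lt measurable_const hF)]
      rfl
    have h2 : ENNReal.ofReal K * (∫⁻ m in Ioo 0 T, ENNReal.ofReal (m ^ (r - 2)) * tail F (256 * m)) ≤
        800 * (∫⁻ m in Ioo 0 T, ENNReal.ofReal (m ^ (r - 2)) * tail F (1 * m)) +
        800 * (ENNReal.ofReal K * ∫⁻ m in Ioo 0 T, ENNReal.ofReal (m ^ (r - 2)) * tail G (K⁻¹ * m)) := by
      have t1 := tm hF 256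
      have t2 := tm hF 1
      have t3 := tm hG K⁻¹
      rw [← lintegral_const_mul _ (by fun_prop), ← lintegral_const_mul _ (by fun_prop),
        ← lintegral_const_mul _ (by fun_prop), ← lintegral_const_mul _ (by fun_prop),
        ← lintegral_add_left (by fun_prop)]
      convert h1 using 3
      · ring
      · ring
    rw [tail_int hF hF0 (by norm_num) hT hr, tail_int hF hF0 (by norm_num) hT hr,
      tail_int hG hG0 (by positivity) hT hr] at h2
    have e1 : ENNReal.ofReal ((256 ^ (r - 1))⁻¹ / (r - 1)) * X T ≤
        ∫⁻ z, ENNReal.ofReal (F z) * ENNReal.ofReal ((min T (F z / 256)) ^ (r - 1) / (r - 1)) := by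
      rw [← lintegral_const_mul' _ _ ENNReal.ofReal_ne_top]
      apply lintegral_mono
      intro z
      simp only
      rw [← ENNReal.ofReal_mul (by positivity), ← ENNReal.ofReal_mul (hF0 z)]
      apply ENNReal.ofReal_le_ofReal
      have hmin : 0 ≤ min T (F z) := le_min hT.le (hF0 z)
      have : (min T (F z)) ^ (r-1) * (256 ^ (r - 1))⁻¹ ≤ (min T (F z / 256)) ^ (r - 1) := by
        rw [← div_eq_mul_inv, ← Real.div_rpow hmin (by norm_num)]
        apply Real.rpow_le_rpow (by positivity) _ hr1.le
        apply le_min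
        · have := min_le_left T (F z)
          rw [div_le_iff₀ (by norm_num)]; linarith
        · gcongr; exact min_le_right _ _
      calc _ = F z * (((min T (F z)) ^ (r-1) * (256 ^ (r - 1))⁻¹) / (r - 1)) := by ring
        _ ≤ _ := by gcongr; exact hF0 z
    have e2 : ∫⁻ z, ENNReal.ofReal (F z) * ENNReal.ofReal ((min T (F z / 1)) ^ (r - 1) / (r - 1)) =
        ENNReal.ofReal ((r-1)⁻¹) * X T := by
      rw [← lintegral_const_mul' _ _ ENNReal.ofReal_ne_top]
      apply lintegral_congr
      intro z
      rw [← ENNReal.ofReal_mul (hF0 z), ← ENNReal.ofReal_mul (by positivity), div_one]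
      congr 1; ring
    have e3 : ∫⁻ z, ENNReal.ofReal (G z) * ENNReal.ofReal ((min T (G z / K⁻¹)) ^ (r - 1) / (r - 1)) ≤
        ENNReal.ofReal (K ^ (r - 1) / (r-1)) * Q := by
      rw [← lintegral_const_mul' _ _ ENNReal.ofReal_ne_top]
      apply lintegral_mono
      intro z
      simp only
      rw [← ENNReal.ofReal_mul (hG0 z), ← ENNReal.ofReal_mul (by positivity)]
      apply ENNReal.ofReal_le_ofReal
      have : (min T (G z / K⁻¹)) ^ (r - 1) ≤ (K * G z) ^ (r - 1) := by
        apply Real.rpow_le_rpow (le_min hT.le (by have := hG0 z; positivity)) _ hr1.le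
        refine (min_le_right _ _).trans (le_of_eq ?_)
        rw [div_inv_eq_mul, mul_comm]
      have hg : G z * G z ^ (r - 1) = G z ^ r := by
        conv_lhs => rw [← Real.rpow_one (G z)]
        rw [← Real.rpow_mul (hG0 z), ← Real.rpow_add_of_nonneg (hG0 z) (by norm_num) (by linarith)]
        congr 1; ring
      calc _ ≤ G z * ((K * G z) ^ (r - 1) / (r - 1)) := by gcongr; exact hG0 z
        _ = _ := by rw [Real.mul_rpow hK0.le (hG0 z), ← hg]; ring
    rw [e2] at h2
    have h3 := (mul_le_mul_right e1 (ENNReal.ofReal K)).trans (h2.trans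
      (add_le_add_right (mul_le_mul_right (mul_le_mul_right e3 (ENNReal.ofReal K)) 800) _))
    rw [← mul_assoc, ← mul_assoc, ← mul_assoc, ← mul_assoc, ← ENNReal.ofReal_mul hK0.le,
      show (800:ℝ≥0∞) = ENNReal.ofReal 800 by simp,
      ← ENNReal.ofReal_mul (by positivity), ← ENNReal.ofReal_mul (by positivity),
      ← ENNReal.ofReal_mul (by positivity)] at h3
    have c1 : K * ((256 ^ (r - 1))⁻¹ / (r - 1)) = 800 * (r-1)⁻¹ + 800 * (r-1)⁻¹ := by
      rw [hK]; field_simp; norm_num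
    have c2 : 800 * K * (K ^ (r - 1) / (r - 1)) = 800 * (r-1)⁻¹ * K ^ r := by
      have : K * K ^ (r - 1) = K ^ r := by
        rw [Real.rpow_sub_one hK0.ne']; field_simp
      rw [← this]; field_simp
    rw [c1, c2, ENNReal.ofReal_add (by positivity) (by positivity), add_mul,
      ENNReal.add_le_add_iff_left (ENNReal.mul_ne_top ENNReal.ofReal_ne_top hXfin),
      ENNReal.ofReal_mul (p := 800 * (r-1)⁻¹) (q := K ^ r) (by positivity), mul_assoc] at h3
    exact (ENNReal.mul_le_mul_iff_right (ENNReal.ofReal_pos.2 (by positivity)).ne' ENNReal.ofReal_ne_top).1 h3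
  have hlim : Tendsto (fun n : ℕ => X n) atTop (𝓝 (∫⁻ z, ENNReal.ofReal (F z ^ r))) := by
    apply lintegral_tendsto_of_tendsto_of_monotone
    · intro n; exact Measurable.aemeasurable (by fun_prop)
    · refine Eventually.of_forall fun z n m hnm => ?_
      simp only
      apply ENNReal.ofReal_le_ofReal
      have : (n:ℝ) ≤ m := by exact_mod_cast hnm
      exact mul_le_mul_of_nonneg_left (Real.rpow_le_rpow (le_min (by positivity) (hF0 z))
        (min_le_min_right _ this) hr1.le) (hF0 z)
    · refine Eventually.of_forall fun z => ?_
      apply tendsto_const_nhds.congr'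
      filter_upwards [eventually_ge_atTop (Nat.ceil (F z))] with n hn
      have : F z ≤ n := (Nat.le_ceil _).trans (by exact_mod_cast hn)
      rw [min_eq_right this]
      congr 1
      conv_rhs => enter [1]; rw [← Real.rpow_one (F z)]
      rw [← Real.rpow_add_of_nonneg (hF0 z) (by norm_num) (by linarith)]
      congr 1; ring
  apply le_of_tendsto hlim
  filter_upwards [eventually_gt_atTop 0] with n hn
  exact key n (by exact_mod_cast hn)

/-- `L^p` bound for the Beurling transform. -/
theorem beurling_Lp {p : ℝ} (hp : 2 ≤ p) : ∃ C : ℝ≥0∞, C ≠ ∞ ∧ ∀ f : ℂ → ℂ, MemLp f 2 volume →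
    ∃ s : ℂ → ℂ, MemLp s 2 volume ∧ WeakEq univ s f ∧
      eLpNorm s (ENNReal.ofReal p) volume ≤ C * eLpNorm f (ENNReal.ofReal p) volume := by
  rcases hp.eq_or_lt with rfl | hp
  · refine ⟨1, by simp, fun f hf => ?_⟩
    obtain ⟨s, h1, h2, h3⟩ := exists_beurling hf
    refine ⟨s, h1, h3, ?_⟩
    simpa using h2
  set r := p / 2 with hr
  have hr1 : 1 < r := by rw [hr]; linarith
  set K : ℝ := 1600 * 256 ^ (r - 1) with hK
  have hK1 : 1 ≤ K := by
    have : (1:ℝ) ≤ 256 ^ (r - 1) := Real.one_le_rpow (by norm_num) (by linarith)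
    linarith
  refine ⟨ENNReal.ofReal (K ^ r) ^ (1/p), by simp [ENNReal.rpow_eq_top_iff]; intro; linarith, fun f0 hf0 => ?_⟩
  obtain ⟨s0, h1, h2, h3⟩ := exists_beurling hf0
  refine ⟨s0, h1, h3, ?_⟩
  set s := h1.1.mk s0
  set f := hf0.1.mk f0
  have es : s0 =ᵐ[volume] s := h1.1.ae_eq_mk
  have ef : f0 =ᵐ[volume] f := hf0.1.ae_eq_mk
  have hs : MemLp s 2 volume := (memLp_congr_ae es).1 h1
  have hf : MemLp f 2 volume := (memLp_congr_ae ef).1 hf0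
  have hsm : Measurable s := h1.1.measurable_mk
  have hfm : Measurable f := hf0.1.measurable_mk
  have hw : WeakEq univ s f := by
    intro φ hφ
    have q1 : ∫ z, s z * db φ z = ∫ z, s0 z * db φ z :=
      integral_congr_ae (es.mono fun z hz => by simp only [hz])
    have q2 : ∫ z, f z * dd φ z = ∫ z, f0 z * dd φ z :=
      integral_congr_ae (ef.mono fun z hz => by simp only [hz])
    rw [q1, q2]; exact h3 φ hφ
  rw [eLpNorm_congr_ae es, eLpNorm_congr_ae ef]
  have hsi : ∫⁻ z, ENNReal.ofReal (‖s z‖ ^ 2) ≠ ∞ := by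
    have hpow : ∀ a : ℂ, ENNReal.ofReal (‖a‖ ^ 2) = ‖a‖ₑ ^ 2 := fun a => by
      rw [ENNReal.ofReal_pow (norm_nonneg _), ofReal_norm]
    simp only [hpow]
    have := hs.2
    rw [L2_lint] at this
    intro h
    rw [h] at this
    simp at this
  have := good_int (F := fun z => ‖s z‖ ^ 2) (G := fun z => ‖f z‖ ^ 2) (by fun_prop) (fun _ => by positivity)
    (by fun_prop) (fun _ => by positivity) hsi hr1 hK (by
      intro m hm
      have := good_lambda hsm hfm hs hf hw hK1 (l := 4 * m) (by positivity)
      rw [show 64 * (4 * m) = 256 * m by ring, show 4 * m / 4 = m by ring,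
        show 4 * m / (4 * K) = K⁻¹ * m by field_simp] at this
      exact this)
  have hn : ∀ a : ℂ, ENNReal.ofReal ((‖a‖ ^ 2) ^ r) = ‖a‖ₑ ^ p := by
    intro a
    rw [← Real.rpow_natCast, ← Real.rpow_mul (norm_nonneg _), ← ofReal_norm,
      ENNReal.ofReal_rpow_of_nonneg (norm_nonneg _) (by linarith)]
    congr 2; rw [hr]; push_cast; ring
  simp only [hn] at this
  have hp0 : 0 < p := by linarith
  have hp1 : ENNReal.ofReal p ≠ 0 := by simp [hp0]
  rw [eLpNorm_eq_lintegral_rpow_enorm_toReal hp1 ENNReal.ofReal_ne_top,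
    eLpNorm_eq_lintegral_rpow_enorm_toReal hp1 ENNReal.ofReal_ne_top, ENNReal.toReal_ofReal hp0.le,
    ← ENNReal.mul_rpow_of_nonneg _ _ (by positivity)]
  exact ENNReal.rpow_le_rpow this (by positivity)

end GR

end PartC4

section PartD1
open MeasureTheory Metric Set Filter Topology
open scoped ENNReal NNReal

namespace GR

/-- the energy: distance of `|g|` to `1` -/
noncomputable def En (p : ℝ) (Ω : Set ℂ) (g : ℂ → ℂ) : ℝ≥0∞ :=
  eLpNorm (fun y => ‖g y‖ - 1) (ENNReal.ofReal p) (volume.restrict Ω)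

lemma En_eq {p : ℝ} (hp : 2 ≤ p) (Ω : Set ℂ) (g : ℂ → ℂ) :
    En p Ω g = (∫⁻ y in Ω, ‖‖g y‖ - 1‖ₑ ^ p) ^ (1 / p) := by
  have hp0 : 0 < p := by linarith
  rw [En, eLpNorm_eq_lintegral_rpow_enorm_toReal (by simp [hp0]) ENNReal.ofReal_ne_top,
    ENNReal.toReal_ofReal hp0.le]

lemma osc_p {p : ℝ} (hp : 2 ≤ p) {d : ℝ} (hd : 0 < d) {g : ℂ → ℂ} {x z : ℂ}
    (hg : DifferentiableOn ℂ g (ball x d)) (hz : z ∈ ball x (d / 8)) :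
    ‖g z - g x‖ₑ ^ p ≤ 544 ^ p * ((ENNReal.ofReal (Real.pi * d ^ 2))⁻¹ *
      ∫⁻ y in ball x d, ‖‖g y‖ - 1‖ₑ ^ p) := by
  have hp0 : 0 < p := by linarith
  set V := ENNReal.ofReal (Real.pi * d ^ 2) with hV
  have hV0 : V ≠ 0 := (ENNReal.ofReal_pos.2 (by positivity)).ne'
  have hVt : V ≠ ∞ := ENNReal.ofReal_ne_top
  have hm : AEStronglyMeasurable (fun y => ‖g y‖ - 1) (volume.restrict (ball x d)) :=
    ((hg.continuousOn.norm.sub continuousOn_const).aestronglyMeasurable measurableSet_ball)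
  have h1 := eLpNorm'_le_eLpNorm'_mul_rpow_measure_univ (p := 1) (q := p) one_pos (by linarith) hm
  simp only [eLpNorm', Measure.restrict_apply_univ, vol_ball x hd.le, ENNReal.rpow_one, one_div_one, ← hV] at h1
  have h2 := osc hd hg hz
  rw [← hV] at h2
  set I := ∫⁻ y in ball x d, ‖‖g y‖ - 1‖ₑ ^ p
  calc ‖g z - g x‖ₑ ^ p ≤ (544 * (V⁻¹ * (I ^ (1 / p) * V ^ (1 - 1 / p)))) ^ p := by
        apply ENNReal.rpow_le_rpow _ hp0.le
        exact h2.trans (mul_le_mul_right (mul_le_mul_right h1 _) _)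
    _ = 544 ^ p * (V⁻¹ * I) := by
        rw [ENNReal.mul_rpow_of_nonneg _ _ hp0.le, ENNReal.mul_rpow_of_nonneg _ _ hp0.le,
          ENNReal.mul_rpow_of_nonneg _ _ hp0.le, ← ENNReal.rpow_mul, ← ENNReal.rpow_mul,
          one_div_mul_cancel hp0.ne', ENNReal.rpow_one]
        congr 1
        rw [mul_comm I, ← mul_assoc]
        congr 1
        rw [ENNReal.inv_rpow, ← ENNReal.rpow_neg, ← ENNReal.rpow_add _ _ hV0 hVt, ← ENNReal.rpow_neg_one]
        congr 1; field_simp; ring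

lemma osc_En {p : ℝ} (hp : 2 ≤ p) {Ω : Set ℂ} {d : ℝ} (hd : 0 < d) {x : ℂ} (hx : ball x d ⊆ Ω) :
    ∃ C : ℝ≥0∞, C ≠ ∞ ∧ ∀ g : ℂ → ℂ, DifferentiableOn ℂ g Ω → ∀ z ∈ ball x (d / 8),
      ‖g z - g x‖ₑ ≤ C * En p Ω g := by
  have hp0 : 0 < p := by linarith
  refine ⟨(544 ^ p * (ENNReal.ofReal (Real.pi * d ^ 2))⁻¹) ^ (1 / p), ?_, ?_⟩
  · apply ENNReal.rpow_ne_top_of_nonneg (by positivity)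
    apply ENNReal.mul_ne_top (ENNReal.rpow_ne_top_of_nonneg hp0.le (by simp))
    apply ENNReal.inv_ne_top.2 (ENNReal.ofReal_pos.2 (by positivity)).ne'
  · intro g hg z hz
    have h := osc_p hp hd (hg.mono hx) hz
    rw [En_eq hp, ← ENNReal.mul_rpow_of_nonneg _ _ (by positivity), one_div,
      ENNReal.le_rpow_inv_iff hp0]
    refine h.trans ?_
    rw [mul_assoc]
    exact mul_le_mul_right (mul_le_mul_right (lintegral_mono_set hx) _) _

lemma enorm_tri (a b c : ℂ) : ‖a - c‖ₑ ≤ ‖a - b‖ₑ + ‖b - c‖ₑ := by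
  rw [show a - c = (a - b) + (b - c) by ring]; exact enorm_add_le _ _

lemma chain {p : ℝ} (hp : 2 ≤ p) {Ω : Set ℂ} (ho : IsOpen Ω) (hc : IsPreconnected Ω) {x y : ℂ} (hx : x ∈ Ω)
    (hy : y ∈ Ω) : ∃ C : ℝ≥0∞, C ≠ ∞ ∧ ∀ g : ℂ → ℂ, DifferentiableOn ℂ g Ω → ‖g x - g y‖ₑ ≤ C * En p Ω g := by
  apply hc.induction₂ (fun x y => ∃ C : ℝ≥0∞, C ≠ ∞ ∧ ∀ g : ℂ → ℂ, DifferentiableOn ℂ g Ω →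
    ‖g x - g y‖ₑ ≤ C * En p Ω g) _ _ _ hx hy
  · intro x hx
    obtain ⟨d, hd, hb⟩ := Metric.isOpen_iff.1 ho x hx
    obtain ⟨C, hC, h⟩ := osc_En hp hd hb
    filter_upwards [mem_nhdsWithin_of_mem_nhds (ball_mem_nhds x (by positivity : 0 < d / 8))] with y hy
    refine ⟨C, hC, fun g hg => ?_⟩
    rw [← enorm_neg, neg_sub]
    exact h g hg y hy
  · rintro x y z - - - ⟨C, hC, h⟩ ⟨C', hC', h'⟩
    refine ⟨C + C', ENNReal.add_ne_top.2 ⟨hC, hC'⟩, fun g hg => ?_⟩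
    rw [add_mul]
    exact (enorm_tri _ (g y) _).trans (add_le_add (h g hg) (h' g hg))
  · rintro x y - - ⟨C, hC, h⟩
    refine ⟨C, hC, fun g hg => ?_⟩
    rw [← enorm_neg, neg_sub]
    exact h g hg

lemma interior_est {p : ℝ} (hp : 2 ≤ p) {Ω : Set ℂ} (ho : IsOpen Ω) (hc : IsPreconnected Ω) {x₀ : ℂ} (hx : x₀ ∈ Ω)
    {K : Set ℂ} (hK : IsCompact K) (hKΩ : K ⊆ Ω) :
    ∃ C : ℝ≥0∞, C ≠ ∞ ∧ ∀ g : ℂ → ℂ, DifferentiableOn ℂ g Ω → ∀ z ∈ K, ‖g z - g x₀‖ₑ ≤ C * En p Ω g := by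
  apply hK.induction_on (p := fun K => ∃ C : ℝ≥0∞, C ≠ ∞ ∧ ∀ g : ℂ → ℂ, DifferentiableOn ℂ g Ω →
    ∀ z ∈ K, ‖g z - g x₀‖ₑ ≤ C * En p Ω g)
  · exact ⟨0, by simp, by simp⟩
  · rintro s t hst ⟨C, hC, h⟩
    exact ⟨C, hC, fun g hg z hz => h g hg z (hst hz)⟩
  · rintro s t ⟨C, hC, h⟩ ⟨C', hC', h'⟩
    refine ⟨C + C', ENNReal.add_ne_top.2 ⟨hC, hC'⟩, fun g hg z hz => ?_⟩
    rw [add_mul]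
    rcases hz with hz | hz
    · exact (h g hg z hz).trans le_self_add
    · exact (h' g hg z hz).trans le_add_self
  · intro x hxK
    obtain ⟨d, hd, hb⟩ := Metric.isOpen_iff.1 ho x (hKΩ hxK)
    obtain ⟨C, hC, h⟩ := osc_En hp hd hb
    obtain ⟨C', hC', h'⟩ := chain hp ho hc (hKΩ hxK) hx
    refine ⟨ball x (d/8), mem_nhdsWithin_of_mem_nhds (ball_mem_nhds x (by positivity : 0 < d / 8)), 
      C + C', ENNReal.add_ne_top.2 ⟨hC, hC'⟩, fun g hg z hz => ?_⟩
    rw [add_mul]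
    exact (enorm_tri _ (g x) _).trans (add_le_add (h g hg z hz) (h' g hg))

end GR

end PartD1

section PartE1
open MeasureTheory Metric Set Filter Topology
open scoped ENNReal NNReal

namespace GR

lemma lint_affine {h : ℝ → ℝ≥0∞} (hh : Measurable h) {a b : ℝ} (ha : 0 < a) :
    ∫⁻ s, h (a * s - b) = ENNReal.ofReal a⁻¹ * ∫⁻ s, h s := by
  have e1 : ∫⁻ s, h (a * s - b) = ∫⁻ s, h (s - b) ∂(Measure.map (a * ·) volume) := by
    rw [lintegral_map (by fun_prop) (by fun_prop)]
  rw [e1, Real.map_volume_mul_left ha.ne', lintegral_smul_measure, lintegral_sub_right_eq_self (fun s => h s) b,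
    abs_of_pos (inv_pos.2 ha), smul_eq_mul]

lemma lint_prod {f : ℂ → ℝ≥0∞} (hf : Measurable f) : ∫⁻ y, f y = ∫⁻ t : ℝ, ∫⁻ s : ℝ, f ⟨t, s⟩ := by
  rw [← (Complex.volume_preserving_equiv_real_prod.symm).lintegral_comp hf]
  have hm : Measurable (fun q : ℝ × ℝ => f (Complex.measurableEquivRealProd.symm q)) :=
    hf.comp (MeasurableEquiv.measurable _)
  rw [Measure.volume_eq_prod, lintegral_prod _ hm.aemeasurable]
  rfl

lemma lint_rot {f : ℂ → ℝ≥0∞} (hf : Measurable f) {ρ : ℂ} (hρ : ‖ρ‖ = 1) : ∫⁻ y, f (ρ * y) = ∫⁻ y, f y := by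
  have hc : ρ ∈ Submonoid.unitSphere ℂ := by simp [Submonoid.unitSphere, hρ]
  have := (rotation ⟨ρ, hc⟩).measurePreserving
  exact this.lintegral_comp hf

/-- depth below the graph -/
noncomputable def tau (ρ : ℂ) (φ : ℝ → ℝ) (y : ℂ) : ℝ := φ (ρ * y).re - (ρ * y).im

/-- push down -/
noncomputable def Tm (ρ : ℂ) (φ : ℝ → ℝ) (ε : ℝ) (y : ℂ) : ℂ :=
  y - (starRingEnd ℂ) ρ * (Complex.I * ((ε * tau ρ φ y : ℝ) : ℂ))

lemma rho_mul {ρ : ℂ} (hρ : ‖ρ‖ = 1) (w : ℂ) : ρ * ((starRingEnd ℂ) ρ * w) = w := by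
  rw [← mul_assoc, Complex.mul_conj, Complex.normSq_eq_norm_sq, hρ]; simp

lemma rho_mul' {ρ : ℂ} (hρ : ‖ρ‖ = 1) (w : ℂ) : (starRingEnd ℂ) ρ * (ρ * w) = w := by
  rw [mul_left_comm]; exact rho_mul hρ w

lemma rho_Tm {ρ : ℂ} (hρ : ‖ρ‖ = 1) (φ : ℝ → ℝ) (ε : ℝ) (y : ℂ) :
    ρ * Tm ρ φ ε y = ρ * y - Complex.I * ((ε * tau ρ φ y : ℝ) : ℂ) := by
  rw [Tm, mul_sub, rho_mul hρ]

lemma re_Tm {ρ : ℂ} (hρ : ‖ρ‖ = 1) (φ : ℝ → ℝ) (ε : ℝ) (y : ℂ) :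
    (ρ * Tm ρ φ ε y).re = (ρ * y).re := by
  rw [rho_Tm hρ]; simp

lemma tau_Tm {ρ : ℂ} (hρ : ‖ρ‖ = 1) (φ : ℝ → ℝ) (ε : ℝ) (y : ℂ) :
    tau ρ φ (Tm ρ φ ε y) = (1 + ε) * tau ρ φ y := by
  have h : (ρ * Tm ρ φ ε y).im = (ρ * y).im - ε * tau ρ φ y := by rw [rho_Tm hρ]; simp
  rw [tau, re_Tm hρ, h]
  conv_rhs => rw [add_mul, one_mul]
  conv_rhs => enter [1]; rw [tau]
  ring

lemma dist_Tm {ρ : ℂ} (hρ : ‖ρ‖ = 1) (φ : ℝ → ℝ) (ε : ℝ) (y : ℂ) :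
    dist (Tm ρ φ ε y) y = |ε * tau ρ φ y| := by
  rw [dist_eq_norm, Tm, sub_sub_cancel_left, norm_neg, norm_mul, norm_mul, Complex.norm_real]
  simp [hρ]

lemma tau_lip {ρ : ℂ} (hρ : ‖ρ‖ = 1) {φ : ℝ → ℝ} {K : ℝ≥0} (hφ : LipschitzWith K φ) (y z : ℂ) :
    |tau ρ φ y - tau ρ φ z| ≤ (K + 1) * dist y z := by
  have h0 : ‖ρ * y - ρ * z‖ = dist y z := by rw [← mul_sub, norm_mul, hρ, one_mul, dist_eq_norm]
  have h1 := hφ.dist_le_mul (ρ * y).re (ρ * z).re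
  rw [Real.dist_eq, Real.dist_eq, ← Complex.sub_re] at h1
  have h2 := Complex.abs_re_le_norm (ρ * y - ρ * z)
  have h3 := Complex.abs_im_le_norm (ρ * y - ρ * z)
  rw [h0] at h2 h3
  rw [Complex.sub_im] at h3
  have h4 : |φ (ρ * y).re - φ (ρ * z).re| ≤ K * dist y z := h1.trans (by gcongr)
  unfold tau
  rw [abs_le] at *
  constructor <;> linarith [h3.1, h3.2, h4.1, h4.2]

lemma tau_cont (ρ : ℂ) {φ : ℝ → ℝ} (hφ : Continuous φ) : Continuous (tau ρ φ) := by
  unfold tau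
  have h1 : Continuous fun y : ℂ => (ρ * y).re := Complex.continuous_re.comp (by fun_prop)
  have h2 : Continuous fun y : ℂ => (ρ * y).im := Complex.continuous_im.comp (by fun_prop)
  exact (hφ.comp h1).sub h2

lemma Tm_cont (ρ : ℂ) {φ : ℝ → ℝ} (hφ : Continuous φ) (ε : ℝ) : Continuous (Tm ρ φ ε) := by
  have := tau_cont ρ hφ
  unfold Tm
  fun_prop

lemma lint_Tm {f : ℂ → ℝ≥0∞} (hf : Measurable f) {ρ : ℂ} (hρ : ‖ρ‖ = 1) {φ : ℝ → ℝ} (hφ : Continuous φ)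
    {ε : ℝ} (hε : 0 < ε) :
    ∫⁻ y, f (Tm ρ φ ε y) = ENNReal.ofReal (1 + ε)⁻¹ * ∫⁻ y, f y := by
  have hρ' : ‖(starRingEnd ℂ) ρ‖ = 1 := by simpa using hρ
  have hTm : Measurable (Tm 1 φ ε) := (Tm_cont 1 hφ ε).measurable
  have e1 : ∀ y, Tm ρ φ ε y = (starRingEnd ℂ) ρ * Tm 1 φ ε (ρ * y) := by
    intro y
    rw [Tm, Tm, mul_sub, rho_mul' hρ]
    simp [tau]
  have e2 : ∫⁻ y, f (Tm ρ φ ε y) = ∫⁻ y, f ((starRingEnd ℂ) ρ * Tm 1 φ ε y) := by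
    simp only [e1]
    exact lint_rot (f := fun y => f ((starRingEnd ℂ) ρ * Tm 1 φ ε y)) (by fun_prop) hρ
  have e3 : ∫⁻ y, f y = ∫⁻ y, f ((starRingEnd ℂ) ρ * y) := (lint_rot hf hρ').symm
  rw [e2, e3]
  set h : ℂ → ℝ≥0∞ := fun y => f ((starRingEnd ℂ) ρ * y) with hh
  have hhm : Measurable h := by fun_prop
  change ∫⁻ y, h (Tm 1 φ ε y) = _ * ∫⁻ y, h y
  rw [lint_prod (f := fun y => h (Tm 1 φ ε y)) (hhm.comp hTm), lint_prod hhm]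
  rw [← lintegral_const_mul' _ _ ENNReal.ofReal_ne_top]
  apply lintegral_congr
  intro t
  have hmk : Measurable (fun s : ℝ => (⟨t, s⟩ : ℂ)) :=
    Complex.measurableEquivRealProd.symm.measurable.comp (measurable_const.prodMk measurable_id)
  have := lint_affine (h := fun s => h ⟨t, s⟩) (hhm.comp hmk) (a := 1 + ε) (b := ε * φ t) (by linarith)
  rw [← this]
  apply lintegral_congr
  intro s
  congr 1
  apply Complex.ext
  · simp [Tm, tau]
  · simp [Tm, tau]; ring

end GR

end PartE1

section PartE2
open MeasureTheory Metric Set Filter Topology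
open scoped ENNReal NNReal

namespace GR

lemma meas_ind {Ω : Set ℂ} (ho : IsOpen Ω) {h : ℂ → ℝ≥0∞} (hh : ContinuousOn h Ω) :
    Measurable (Ω.indicator h) := by
  classical
  rw [← piecewise_eq_indicator]
  exact hh.measurable_piecewise (g := 0) continuousOn_const ho.measurableSet

lemma diff_est {p : ℝ} (hp : 2 ≤ p) {Ω : Set ℂ} (ho : IsOpen Ω) {ρ : ℂ} (hρ : ‖ρ‖ = 1) {φ : ℝ → ℝ} {K : ℝ≥0}
    (hφ : LipschitzWith K φ) {L : ℝ} (hL : L = K + 1) {Q : Set ℂ} (hQm : MeasurableSet Q)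
    (hQ : ∀ y ∈ Q, 0 < tau ρ φ y ∧ ball y (tau ρ φ y / (2 * L)) ⊆ Ω) {ε : ℝ} (hε : ε = 1 / (32 * L))
    {g : ℂ → ℂ} (hg : DifferentiableOn ℂ g Ω) :
    ∫⁻ y in Q, ‖g y - g (Tm ρ φ ε y)‖ₑ ^ p ≤ 544 ^ p * (9 * ∫⁻ y in Ω, ‖‖g y‖ - 1‖ₑ ^ p) := by
  have hp0 : 0 < p := by linarith
  have hL0 : 0 < L := by rw [hL]; positivity
  have hε0 : 0 < ε := by rw [hε]; positivity
  set q : ℂ → ℝ≥0∞ := fun y => ‖‖g y‖ - 1‖ₑ ^ p with hq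
  have hqc : ContinuousOn q Ω := by
    have : ContinuousOn (fun y => ‖‖g y‖ - 1‖ₑ) Ω := (hg.continuousOn.norm.sub continuousOn_const).enorm
    exact ENNReal.continuous_rpow_const.comp_continuousOn this
  set w := Ω.indicator q with hw
  have hwm : Measurable w := meas_ind ho hqc
  have hwI : ∫⁻ y in Ω, q y = ∫⁻ y, w y := (lintegral_indicator ho.measurableSet _).symm
  set t := tau ρ φ with ht
  have htc : Continuous t := tau_cont ρ hφ.continuous
  have htl : ∀ y z, |t y - t z| ≤ L * dist y z := fun y z => by rw [hL]; exact tau_lip hρ hφ y z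
  set A : Set (ℂ × ℂ) := {z | z.1 ∈ Q ∧ dist z.2 z.1 < t z.1 / (2 * L)} with hA
  have hAm : MeasurableSet A := by
    apply MeasurableSet.inter
    · exact measurable_fst hQm
    · have := htc.measurable
      exact measurableSet_lt (f := fun z : ℂ × ℂ => dist z.2 z.1) (g := fun z : ℂ × ℂ => t z.1 / (2 * L))
        (by fun_prop) (by fun_prop)
  set k : ℂ × ℂ → ℝ≥0∞ := A.indicator
    (fun z => (ENNReal.ofReal (Real.pi * (t z.1 / (2 * L)) ^ 2))⁻¹ * w z.2) with hk
  have hkm : Measurable k := by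
    apply Measurable.indicator _ hAm
    have := htc.measurable
    fun_prop
  have h1 : ∫⁻ y in Q, ‖g y - g (Tm ρ φ ε y)‖ₑ ^ p ≤ 544 ^ p * ∫⁻ y, ∫⁻ y', k (y, y') := by
    rw [← lintegral_const_mul' _ _ (ENNReal.rpow_ne_top_of_nonneg hp0.le (by simp)),
      ← lintegral_indicator hQm]
    apply lintegral_mono
    intro y
    by_cases hy : y ∈ Q
    · simp only [hy, indicator_of_mem]
      obtain ⟨hty, hb⟩ := hQ y hy
      have hd : 0 < t y / (2 * L) := by positivity
      have hmem : Tm ρ φ ε y ∈ ball y (t y / (2 * L) / 8) := by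
        rw [mem_ball, dist_Tm hρ, abs_of_pos (by positivity), hε]
        rw [← ht]
        have : t y / (2 * L) / 8 = 2 * (1 / (32 * L) * t y) := by field_simp; norm_num
        rw [this]
        have : 0 < 1 / (32 * L) * t y := by positivity
        linarith
      have := osc_p hp hd (hg.mono hb) hmem
      rw [← enorm_neg, neg_sub] at this
      refine this.trans (mul_le_mul_right ?_ _)
      rw [← lintegral_const_mul' _ _ (ENNReal.inv_ne_top.2 (ENNReal.ofReal_pos.2 (by positivity)).ne'),
        ← lintegral_indicator measurableSet_ball]
      apply lintegral_mono
      intro y'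
      by_cases hy' : y' ∈ ball y (t y / (2 * L))
      · have hin : (y, y') ∈ A := ⟨hy, hy'⟩
        have hΩ : y' ∈ Ω := hb hy'
        simp only [hk, indicator_of_mem hy', indicator_of_mem hin, hw, indicator_of_mem hΩ]
        exact le_rfl
      · simp [hy']
    · simp [hy]
  have h2 : ∫⁻ y, ∫⁻ y', k (y, y') ≤ 9 * ∫⁻ y, w y := by
    rw [lintegral_lintegral_swap (f := fun y y' => k (y, y')) hkm.aemeasurable, ← lintegral_const_mul _ hwm]
    apply lintegral_mono
    intro y'
    simp only
    by_cases hty' : 0 < t y'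
    · have hle : ∀ y, k (y, y') ≤ (ball y' (t y' / L)).indicator
          (fun _ => (ENNReal.ofReal (Real.pi * (t y' / (3 * L)) ^ 2))⁻¹ * w y') y := by
        intro y
        by_cases hin : (y, y') ∈ A
        · have hd : dist y' y < t y / (2 * L) := hin.2
          have hl := htl y y'
          have h3 : L * dist y y' < t y / 2 := by
            rw [dist_comm, ← lt_div_iff₀' hL0]
            rwa [div_div]
          rw [abs_le] at hl
          have h4 : t y < 2 * t y' := by linarith
          have h5 : 2 / 3 * t y' < t y := by linarith
          have hmem : y ∈ ball y' (t y' / L) := by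
            rw [mem_ball, dist_comm]
            refine hd.trans_le ?_
            rw [div_le_div_iff₀ (by positivity) hL0]
            nlinarith
          rw [hk, indicator_of_mem hin, indicator_of_mem hmem]
          apply mul_le_mul_left
          apply ENNReal.inv_le_inv.2
          apply ENNReal.ofReal_le_ofReal
          have : t y' / (3 * L) ≤ t y / (2 * L) := by
            rw [div_le_div_iff₀ (by positivity) (by positivity)]; nlinarith
          gcongr
        · simp [hk, hin]
      refine (lintegral_mono hle).trans ?_
      rw [lintegral_indicator measurableSet_ball, setLIntegral_const, vol_ball _ (by positivity)]
      have e : Real.pi * (t y' / L) ^ 2 = 9 * (Real.pi * (t y' / (3 * L)) ^ 2) := by field_simp; norm_num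
      have hpos : 0 < Real.pi * (t y' / (3 * L)) ^ 2 := by positivity
      rw [e, ENNReal.ofReal_mul (p := 9) (by norm_num)]
      set V := ENNReal.ofReal (Real.pi * (t y' / (3 * L)) ^ 2)
      have hV : V⁻¹ * V = 1 := ENNReal.inv_mul_cancel (ENNReal.ofReal_pos.2 hpos).ne' ENNReal.ofReal_ne_top
      apply le_of_eq
      calc V⁻¹ * w y' * (ENNReal.ofReal 9 * V) = (V⁻¹ * V) * (ENNReal.ofReal 9 * w y') := by ring
        _ = 9 * w y' := by rw [hV, one_mul]; simp
    · have : ∀ y, k (y, y') = 0 := by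
        intro y
        apply indicator_of_notMem
        rintro ⟨hyQ, hd⟩
        simp only at hyQ hd
        have hl := htl y y'
        have h3 : L * dist y y' < t y / 2 := by
          rw [dist_comm, ← lt_div_iff₀' hL0]
          rwa [div_div]
        rw [abs_le] at hl
        have := (hQ y hyQ).1
        have : 0 < t y := this
        linarith
      simp [this]
  calc _ ≤ _ := h1
    _ ≤ _ := by rw [hwI]; exact mul_le_mul_right h2 _

lemma eLp_eq {p : ℝ} (hp : 2 ≤ p) {E : Type*} [NormedAddCommGroup E] (f : ℂ → E) (μ : Measure ℂ) :
    eLpNorm f (ENNReal.ofReal p) μ = (∫⁻ y, ‖f y‖ₑ ^ p ∂μ) ^ (1 / p) := by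
  have hp0 : 0 < p := by linarith
  rw [eLpNorm_eq_lintegral_rpow_enorm_toReal (by simp [hp0]) ENNReal.ofReal_ne_top,
    ENNReal.toReal_ofReal hp0.le]

lemma eLp_union {p : ℝ} (hp : 2 ≤ p) {E : Type*} [NormedAddCommGroup E] (f : ℂ → E) (A B : Set ℂ) :
    eLpNorm f (ENNReal.ofReal p) (volume.restrict (A ∪ B)) ≤
      eLpNorm f (ENNReal.ofReal p) (volume.restrict A) + eLpNorm f (ENNReal.ofReal p) (volume.restrict B) := by
  have hp0 : 0 < p := by linarith
  rw [eLp_eq hp, eLp_eq hp, eLp_eq hp]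
  refine le_trans ?_ (ENNReal.rpow_add_le_add_rpow _ _ (by positivity) ?_)
  · exact ENNReal.rpow_le_rpow (lintegral_union_le _ _ _) (by positivity)
  · rw [div_le_one hp0]; linarith

lemma eLp_bound {p : ℝ} (hp : 2 ≤ p) (f : ℂ → ℂ) {A : Set ℂ} (hA : MeasurableSet A) {M : ℝ≥0∞}
    (h : ∀ y ∈ A, ‖f y‖ₑ ≤ M) :
    eLpNorm f (ENNReal.ofReal p) (volume.restrict A) ≤ M * volume A ^ (1 / p) := by
  have hp0 : 0 < p := by linarith
  rw [eLp_eq hp]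
  have : ∫⁻ y in A, ‖f y‖ₑ ^ p ≤ M ^ p * volume A := by
    rw [← setLIntegral_const]
    apply setLIntegral_mono' hA
    intro y hy
    exact ENNReal.rpow_le_rpow (h y hy) hp0.le
  refine (ENNReal.rpow_le_rpow this (by positivity)).trans (le_of_eq ?_)
  rw [ENNReal.mul_rpow_of_nonneg _ _ (by positivity), ← ENNReal.rpow_mul, mul_one_div_cancel hp0.ne',
    ENNReal.rpow_one]

lemma absorb {X A θ : ℝ≥0∞} (hX : X ≠ ∞) (hθ : θ < 1) (h : X ≤ A + θ * X) : X ≤ (1 - θ)⁻¹ * A := by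
  have h1 : (1 - θ) * X + θ * X = X := by
    rw [← add_mul, tsub_add_cancel_of_le hθ.le, one_mul]
  have h2 : (1 - θ) * X ≤ A := by
    have : (1 - θ) * X + θ * X ≤ A + θ * X := by rw [h1]; exact h
    exact (ENNReal.add_le_add_iff_right (ENNReal.mul_ne_top (hθ.trans_le le_top).ne hX)).1 this
  have h0 : 1 - θ ≠ 0 := (tsub_pos_of_lt hθ).ne'
  have ht : 1 - θ ≠ ∞ := ne_top_of_le_ne_top ENNReal.one_ne_top tsub_le_self
  calc X = (1 - θ)⁻¹ * ((1 - θ) * X) := by rw [← mul_assoc, ENNReal.inv_mul_cancel h0 ht, one_mul]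
    _ ≤ _ := mul_le_mul_right h2 _

end GR

end PartE2

section PartE3
open MeasureTheory Metric Set Filter Topology
open scoped ENNReal NNReal

namespace GR

lemma chart_dist {ρ : ℂ} (hρ : ‖ρ‖ = 1) {φ : ℝ → ℝ} {K : ℝ≥0} (hφ : LipschitzWith K φ) {x y : ℂ}
    (hx : tau ρ φ x = 0) {β : ℝ} (h1 : |(ρ * y).re - (ρ * x).re| ≤ β) (h2 : |tau ρ φ y| ≤ 2 * β) :
    dist y x ≤ 3 * (K + 1) * β := by
  have h0 : ‖ρ * y - ρ * x‖ = dist y x := by rw [← mul_sub, norm_mul, hρ, one_mul, dist_eq_norm]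
  have h3 := hφ.dist_le_mul (ρ * y).re (ρ * x).re
  rw [Real.dist_eq, Real.dist_eq] at h3
  have h4 := Complex.norm_le_abs_re_add_abs_im (ρ * y - ρ * x)
  rw [Complex.sub_re, Complex.sub_im] at h4
  have hK : (0:ℝ) ≤ K := K.2
  have h5 : |φ (ρ * y).re - φ (ρ * x).re| ≤ K * β := h3.trans (mul_le_mul_of_nonneg_left h1 hK)
  have h6 : |(ρ * y).im - (ρ * x).im| ≤ K * β + 2 * β := by
    have e : (ρ * y).im - (ρ * x).im = (φ (ρ * y).re - φ (ρ * x).re) - tau ρ φ y := by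
      have : (ρ * x).im = φ (ρ * x).re := by unfold tau at hx; linarith
      rw [tau, this]; ring
    rw [e]
    exact (abs_sub _ _).trans (add_le_add h5 h2)
  have hβ : 0 ≤ β := (abs_nonneg _).trans h1
  have : 0 ≤ (K:ℝ) * β := mul_nonneg hK hβ
  rw [← h0]; nlinarith

lemma boundary_est {p : ℝ} (hp : 2 ≤ p) {Ω : Set ℂ} (ho : IsOpen Ω) (hc : IsPreconnected Ω) {x₀ : ℂ} (hx₀ : x₀ ∈ Ω)
    {x : ℂ} (hx : x ∈ frontier Ω) {ρ : ℂ} (hρ : ‖ρ‖ = 1) {φ : ℝ → ℝ} {K : ℝ≥0} (hφ : LipschitzWith K φ)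
    {U : Set ℂ} (hU : IsOpen U) (hxU : x ∈ U) (hch : ∀ y ∈ U, (y ∈ Ω ↔ (ρ * y).im < φ (ρ * y).re)) :
    ∃ N ∈ 𝓝 x, ∃ C : ℝ≥0∞, C ≠ ∞ ∧ ∀ g : ℂ → ℂ, DifferentiableOn ℂ g Ω →
      eLpNorm (fun y => g y - g x₀) (ENNReal.ofReal p) (volume.restrict Ω) ≠ ∞ →
      eLpNorm (fun y => g y - g x₀) (ENNReal.ofReal p) (volume.restrict (N ∩ Ω)) ≤ C * En p Ω g := by
  have hp0 : 0 < p := by linarith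
  set t := tau ρ φ with ht
  have htc : Continuous t := tau_cont ρ hφ.continuous
  have hch' : ∀ y ∈ U, (y ∈ Ω ↔ 0 < t y) := by
    intro y hy; rw [hch y hy, ht, tau, sub_pos]
  have hre : Continuous fun y : ℂ => (ρ * y).re := Complex.continuous_re.comp (by fun_prop)
  have htx : t x = 0 := by
    have hxΩ : x ∉ Ω := by
      have := hx.2; rwa [ho.interior_eq] at this
    have h1 : t x ≤ 0 := by
      by_contra h; exact hxΩ ((hch' x hxU).2 (not_le.1 h))
    refine le_antisymm h1 ?_
    by_contra h
    have hV : U ∩ {y | t y < 0} ∈ 𝓝 x :=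
      (hU.inter (isOpen_lt htc continuous_const)).mem_nhds ⟨hxU, not_le.1 h⟩
    obtain ⟨y, ⟨hyU, hy0⟩, hyΩ⟩ := mem_closure_iff_nhds.1 hx.1 _ hV
    have := (hch' y hyU).1 hyΩ
    simp only [mem_setOf_eq] at hy0
    linarith
  obtain ⟨R, hR, hRU⟩ := Metric.isOpen_iff.1 hU x hxU
  set L : ℝ := K + 1 with hL
  have hL1 : 1 ≤ L := by rw [hL]; have : (0:ℝ) ≤ K := K.2; linarith
  set β : ℝ := R / (8 * L) with hβ
  have hβ0 : 0 < β := by positivity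
  have hLβ : L * β = R / 8 := by rw [hβ]; field_simp
  set ε : ℝ := 1 / (32 * L) with hε
  have hε0 : 0 < ε := by positivity
  have hε1 : ε ≤ 1 := by rw [hε, div_le_one (by positivity)]; linarith
  have hbox : ∀ y, |(ρ * y).re - (ρ * x).re| ≤ β → 0 < t y → t y ≤ 2 * β → 
      y ∈ U ∧ ball y (t y / (2 * L)) ⊆ Ω := by
    intro y h1 h2 h3
    have hd : dist y x ≤ 3 * L * β := chart_dist hρ hφ htx h1 (by rw [abs_of_pos h2]; exact h3)
    have hb : ball y (t y / (2 * L)) ⊆ U := by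
      refine Subset.trans (ball_subset_ball' ?_) hRU
      have : t y / (2 * L) ≤ β := by
        rw [div_le_iff₀ (by positivity)]; nlinarith
      nlinarith
    refine ⟨hb (mem_ball_self (by positivity)), fun z hz => (hch' z (hb hz)).2 ?_⟩
    have hl := tau_lip hρ hφ y z
    rw [mem_ball, dist_comm, lt_div_iff₀ (by positivity)] at hz
    rw [← hL, ← ht, abs_le] at hl
    linarith
  set N : Set ℂ := {y | |(ρ * y).re - (ρ * x).re| < β ∧ |t y| < β} with hN
  have hNo : IsOpen N := by
    apply IsOpen.inter
    · exact isOpen_lt (f := fun y : ℂ => |(ρ * y).re - (ρ * x).re|) (by fun_prop) continuous_const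
    · exact isOpen_lt (f := fun y : ℂ => |t y|) (by fun_prop) continuous_const
  have hNU : N ⊆ U := by
    intro y hy
    have hd : dist y x ≤ 3 * L * β := chart_dist hρ hφ htx hy.1.le (hy.2.le.trans (by linarith))
    apply hRU
    rw [mem_ball]
    nlinarith
  set Kc : Set ℂ := {y | |(ρ * y).re - (ρ * x).re| ≤ β ∧ (β ≤ t y ∧ t y ≤ 2 * β)} with hKc
  have hKcc : IsCompact Kc := by
    apply Metric.isCompact_of_isClosed_isBounded
    · apply IsClosed.inter
      · exact isClosed_le (f := fun y : ℂ => |(ρ * y).re - (ρ * x).re|) (by fun_prop) continuous_const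
      · exact (isClosed_le continuous_const htc).inter (isClosed_le htc continuous_const)
    · refine (isBounded_closedBall (x := x) (r := 3 * L * β)).subset ?_
      intro y hy
      have h0 : 0 < t y := hβ0.trans_le hy.2.1
      exact chart_dist hρ hφ htx hy.1 (by rw [← ht, abs_of_pos h0]; exact hy.2.2)
  have hKcΩ : Kc ⊆ Ω := by
    intro y hy
    have h0 : 0 < t y := hβ0.trans_le hy.2.1
    exact (hbox y hy.1 h0 hy.2.2).2 (mem_ball_self (by positivity))
  set Q := N ∩ Ω with hQd
  have hQo : IsOpen Q := hNo.inter ho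
  have hQt : ∀ y ∈ Q, 0 < t y := fun y hy => (hch' y (hNU hy.1)).1 hy.2
  have hQΩ : Q ⊆ Ω := inter_subset_right
  have hQ : ∀ y ∈ Q, 0 < tau ρ φ y ∧ ball y (tau ρ φ y / (2 * L)) ⊆ Ω := by
    intro y hy
    have h0 := hQt y hy
    have h1 := hy.1.2
    rw [abs_of_pos h0] at h1
    exact ⟨h0, (hbox y hy.1.1.le h0 (by linarith)).2⟩
  have hT : ∀ y ∈ Q, Tm ρ φ ε y ∈ Q ∪ Kc := by
    intro y hy
    have h0 := hQt y hy
    have h1 := hy.1.2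
    rw [abs_of_pos h0] at h1
    have h2 : t (Tm ρ φ ε y) = (1 + ε) * t y := tau_Tm hρ φ ε y
    have h3 := re_Tm hρ φ ε y
    have h4 : 0 < t (Tm ρ φ ε y) := by rw [h2]; positivity
    have h5 : t (Tm ρ φ ε y) ≤ 2 * β := by rw [h2]; nlinarith
    have h6 : |(ρ * Tm ρ φ ε y).re - (ρ * x).re| < β := by rw [h3]; exact hy.1.1
    rcases lt_or_ge (t (Tm ρ φ ε y)) β with h | h
    · left
      exact ⟨⟨h6, by rw [abs_of_pos h4]; exact h⟩, (hbox _ h6.le h4 h5).2 (mem_ball_self (by positivity))⟩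
    · right
      exact ⟨h6.le, h, h5⟩
  obtain ⟨M, hM, hMb⟩ := interior_est hp ho hc hx₀ hKcc hKcΩ
  set θ : ℝ≥0∞ := (ENNReal.ofReal (1 + ε)⁻¹) ^ (1 / p) with hθ
  have hθ1 : θ < 1 := by
    apply ENNReal.rpow_lt_one
    · rw [ENNReal.ofReal_lt_one]
      exact inv_lt_one_of_one_lt₀ (by linarith)
    · positivity
  have h544 : ((544 : ℝ≥0∞) ^ p * 9) ^ (1 / p) ≠ ∞ :=
    ENNReal.rpow_ne_top_of_nonneg (by positivity)
      (ENNReal.mul_ne_top (ENNReal.rpow_ne_top_of_nonneg hp0.le (by simp)) (by simp))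
  set D : ℝ≥0∞ := ((544 : ℝ≥0∞) ^ p * 9) ^ (1 / p) with hD
  have hKv : volume Kc ^ (1 / p) ≠ ∞ := ENNReal.rpow_ne_top_of_nonneg (by positivity) hKcc.measure_lt_top.ne
  refine ⟨N, hNo.mem_nhds ⟨by simpa using hβ0, by rw [htx]; simpa using hβ0⟩,
    (1 - θ)⁻¹ * (D + M * volume Kc ^ (1 / p)), ?_, ?_⟩
  · exact ENNReal.mul_ne_top (ENNReal.inv_ne_top.2 (tsub_pos_of_lt hθ1).ne')
      (ENNReal.add_ne_top.2 ⟨h544, ENNReal.mul_ne_top hM hKv⟩)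
  intro g hg hfin
  rw [mul_assoc]
  have hX : eLpNorm (fun y => g y - g x₀) (ENNReal.ofReal p) (volume.restrict Q) ≠ ∞ :=
    ne_top_of_le_ne_top hfin (eLpNorm_mono_measure _ (Measure.restrict_mono_set _ hQΩ))
  refine absorb hX hθ1 ?_
  set P := ENNReal.ofReal p with hP
  have hP1 : 1 ≤ P := by rw [hP, ENNReal.one_le_ofReal]; linarith
  have hTQ : ∀ y ∈ Q, Tm ρ φ ε y ∈ Ω := fun y hy => (hT y hy).elim (fun h => hQΩ h) (fun h => hKcΩ h)
  have hgQ : ContinuousOn g Q := hg.continuousOn.mono hQΩ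
  have hgT : ContinuousOn (fun y => g (Tm ρ φ ε y)) Q :=
    hg.continuousOn.comp (Tm_cont ρ hφ.continuous ε).continuousOn hTQ
  have hs1 : AEStronglyMeasurable (fun y => g y - g (Tm ρ φ ε y)) (volume.restrict Q) :=
    (hgQ.sub hgT).aestronglyMeasurable hQo.measurableSet
  have hs2 : AEStronglyMeasurable (fun y => g (Tm ρ φ ε y) - g x₀) (volume.restrict Q) :=
    (hgT.sub continuousOn_const).aestronglyMeasurable hQo.measurableSet
  have hadd := eLpNorm_add_le hs1 hs2 hP1
  have he : (fun y => g y - g (Tm ρ φ ε y)) + (fun y => g (Tm ρ φ ε y) - g x₀) = fun y => g y - g x₀ := by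
    ext y; simp
  rw [he] at hadd
  have hA : eLpNorm (fun y => g y - g (Tm ρ φ ε y)) P (volume.restrict Q) ≤ D * En p Ω g := by
    rw [eLp_eq hp, En_eq hp, hD, ← ENNReal.mul_rpow_of_nonneg _ _ (by positivity), mul_assoc]
    exact ENNReal.rpow_le_rpow (diff_est hp ho hρ hφ hL hQo.measurableSet hQ hε hg) (by positivity)
  have hB : eLpNorm (fun y => g (Tm ρ φ ε y) - g x₀) P (volume.restrict Q) ≤
      θ * eLpNorm (fun y => g y - g x₀) P (volume.restrict (Q ∪ Kc)) := by
    rw [eLp_eq hp, eLp_eq hp, hθ, ← ENNReal.mul_rpow_of_nonneg _ _ (by positivity)]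
    apply ENNReal.rpow_le_rpow _ (by positivity)
    have hSm : MeasurableSet (Q ∪ Kc) := hQo.measurableSet.union hKcc.measurableSet
    set F : ℂ → ℝ≥0∞ := Ω.indicator (fun y => ‖g y - g x₀‖ₑ ^ p) with hF
    have hFm : Measurable F := meas_ind ho
      (ENNReal.continuous_rpow_const.comp_continuousOn (hg.continuousOn.sub continuousOn_const).enorm)
    have hSF : Measurable ((Q ∪ Kc).indicator F) := hFm.indicator hSm
    have h1 := lint_Tm hSF hρ hφ.continuous hε0
    have h2 : ∫⁻ y, (Q ∪ Kc).indicator F y = ∫⁻ y in Q ∪ Kc, ‖g y - g x₀‖ₑ ^ p := by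
      rw [lintegral_indicator hSm]
      apply setLIntegral_congr_fun hSm
      intro y hy
      have : y ∈ Ω := hy.elim (fun h => hQΩ h) (fun h => hKcΩ h)
      simp [hF, this]
    rw [← h2, ← h1, ← lintegral_indicator hQo.measurableSet]
    apply lintegral_mono
    intro y
    by_cases hy : y ∈ Q
    · simp only [indicator_of_mem hy, indicator_of_mem (hT y hy), hF, indicator_of_mem (hTQ y hy)]
      exact le_rfl
    · simp [hy]
  have hC : eLpNorm (fun y => g y - g x₀) P (volume.restrict Kc) ≤ M * En p Ω g * volume Kc ^ (1 / p) :=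
    eLp_bound hp _ hKcc.measurableSet (hMb g hg)
  have hU := eLp_union hp (fun y => g y - g x₀) Q Kc
  set X := eLpNorm (fun y => g y - g x₀) P (volume.restrict Q)
  calc X ≤ _ := hadd
    _ ≤ D * En p Ω g + θ * (X + M * En p Ω g * volume Kc ^ (1 / p)) := by
        refine add_le_add hA (hB.trans (mul_le_mul_right (hU.trans ?_) _))
        exact add_le_add le_rfl hC
    _ = D * En p Ω g + θ * (M * En p Ω g * volume Kc ^ (1 / p)) + θ * X := by ring
    _ ≤ D * En p Ω g + 1 * (M * En p Ω g * volume Kc ^ (1 / p)) + θ * X := by gcongr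
    _ = _ := by ring

end GR

end PartE3

section PartE4
open MeasureTheory Metric Set Filter Topology
open scoped ENNReal NNReal

namespace GR

/-- Lipschitz boundary, complex coordinates -/
def LipC (Ω : Set ℂ) : Prop := ∀ x ∈ frontier Ω, ∃ ρ : ℂ, ‖ρ‖ = 1 ∧ ∃ (φ : ℝ → ℝ) (K : ℝ≥0) (U : Set ℂ),
  LipschitzWith K φ ∧ IsOpen U ∧ x ∈ U ∧ ∀ y ∈ U, (y ∈ Ω ↔ (ρ * y).im < φ (ρ * y).re)

lemma global_est {p : ℝ} (hp : 2 ≤ p) {Ω : Set ℂ} (ho : IsOpen Ω) (hb : Bornology.IsBounded Ω)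
    (hc : IsPreconnected Ω) {x₀ : ℂ} (hx₀ : x₀ ∈ Ω) (hl : LipC Ω) :
    ∃ C : ℝ≥0∞, C ≠ ∞ ∧ ∀ g : ℂ → ℂ, DifferentiableOn ℂ g Ω →
      eLpNorm (fun y => g y - g x₀) (ENNReal.ofReal p) (volume.restrict Ω) ≠ ∞ →
      eLpNorm (fun y => g y - g x₀) (ENNReal.ofReal p) (volume.restrict Ω) ≤ C * En p Ω g := by
  have hp0 : 0 < p := by linarith
  have hcl : IsCompact (closure Ω) := hb.isCompact_closure
  have key : ∃ C : ℝ≥0∞, C ≠ ∞ ∧ ∀ g : ℂ → ℂ, DifferentiableOn ℂ g Ω →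
      eLpNorm (fun y => g y - g x₀) (ENNReal.ofReal p) (volume.restrict Ω) ≠ ∞ →
      eLpNorm (fun y => g y - g x₀) (ENNReal.ofReal p) (volume.restrict (closure Ω ∩ Ω)) ≤ C * En p Ω g := by
    apply hcl.induction_on (p := fun S => ∃ C : ℝ≥0∞, C ≠ ∞ ∧ ∀ g : ℂ → ℂ, DifferentiableOn ℂ g Ω →
      eLpNorm (fun y => g y - g x₀) (ENNReal.ofReal p) (volume.restrict Ω) ≠ ∞ →
      eLpNorm (fun y => g y - g x₀) (ENNReal.ofReal p) (volume.restrict (S ∩ Ω)) ≤ C * En p Ω g)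
    · exact ⟨0, by simp, by simp⟩
    · rintro s t hst ⟨C, hC, h⟩
      exact ⟨C, hC, fun g hg hf => (eLpNorm_mono_measure _
        (Measure.restrict_mono_set _ (inter_subset_inter_left _ hst))).trans (h g hg hf)⟩
    · rintro s t ⟨C, hC, h⟩ ⟨C', hC', h'⟩
      refine ⟨C + C', ENNReal.add_ne_top.2 ⟨hC, hC'⟩, fun g hg hf => ?_⟩
      rw [union_inter_distrib_right, add_mul]
      exact (eLp_union hp _ _ _).trans (add_le_add (h g hg hf) (h' g hg hf))
    · intro x hx
      by_cases hxΩ : x ∈ Ω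
      · obtain ⟨r, hr, hrΩ⟩ := Metric.isOpen_iff.1 ho x hxΩ
        have hsub : closedBall x (r / 2) ⊆ Ω := (closedBall_subset_ball (by linarith)).trans hrΩ
        obtain ⟨C, hC, h⟩ := interior_est hp ho hc hx₀ (isCompact_closedBall x (r / 2)) hsub
        refine ⟨closedBall x (r / 2), mem_nhdsWithin_of_mem_nhds (closedBall_mem_nhds x (by positivity)),
          C * volume (closedBall x (r / 2)) ^ (1 / p), ?_, ?_⟩
        · exact ENNReal.mul_ne_top hC (ENNReal.rpow_ne_top_of_nonneg (by positivity)
            (isCompact_closedBall x (r / 2)).measure_lt_top.ne)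
        · intro g hg hf
          rw [inter_eq_left.2 hsub]
          refine (eLp_bound hp _ measurableSet_closedBall (h g hg)).trans (le_of_eq ?_)
          ring
      · have hxf : x ∈ frontier Ω := ⟨hx, by rwa [ho.interior_eq]⟩
        obtain ⟨ρ, hρ, φ, K, U, hφ, hU, hxU, hch⟩ := hl x hxf
        obtain ⟨N, hN, C, hC, h⟩ := boundary_est hp ho hc hx₀ hxf hρ hφ hU hxU hch
        exact ⟨N, mem_nhdsWithin_of_mem_nhds hN, C, hC, h⟩
  rwa [inter_eq_right.2 subset_closure] at key

end GR

end PartE4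

section PartF1
open MeasureTheory Metric Set Filter Topology
open scoped ENNReal NNReal

namespace GR

lemma exists_unit (c : ℂ) : ∃ e : ℂ, ‖e‖ = 1 ∧ ‖c - e‖ = ‖‖c‖ - 1‖ := by
  by_cases hc : c = 0
  · exact ⟨1, by simp, by simp [hc]⟩
  · have h0 : ‖c‖ ≠ 0 := norm_ne_zero_iff.2 hc
    have h0' : (‖c‖ : ℂ) ≠ 0 := by exact_mod_cast h0
    refine ⟨c / ‖c‖, by simp [h0], ?_⟩
    have : c - c / ‖c‖ = (c / ‖c‖) * ((‖c‖ - 1 : ℝ) : ℂ) := by push_cast; field_simp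
    rw [this, norm_mul, Complex.norm_real]
    simp [h0]

theorem complex_rigidity {p : ℝ} (hp : 2 ≤ p) {Ω : Set ℂ} (ho : IsOpen Ω) (hb : Bornology.IsBounded Ω)
    (hc : IsConnected Ω) (hl : LipC Ω) :
    ∃ C : ℝ≥0∞, C ≠ ∞ ∧ ∀ a b : ℂ → ℂ, MemLp a (ENNReal.ofReal p) (volume.restrict Ω) →
      MemLp b (ENNReal.ofReal p) (volume.restrict Ω) →
      (∀ φ, IsTest Ω φ → ∫ z in Ω, a z * db φ z = ∫ z in Ω, b z * dd φ z) →
      ∃ e : ℂ, ‖e‖ = 1 ∧ eLpNorm (fun z => a z - e) (ENNReal.ofReal p) (volume.restrict Ω) ≤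
        C * (eLpNorm (fun z => ‖a z‖ - 1) (ENNReal.ofReal p) (volume.restrict Ω) +
          eLpNorm b (ENNReal.ofReal p) (volume.restrict Ω)) := by
  obtain ⟨⟨x₀, hx₀⟩, hpc⟩ := hc
  obtain ⟨C₁, hC₁, H₁⟩ := global_est hp ho hb hpc hx₀ hl
  obtain ⟨C₂, hC₂, H₂⟩ := beurling_Lp hp
  set P := ENNReal.ofReal p with hP
  have hP1 : 1 ≤ P := by rw [hP, ENNReal.one_le_ofReal]; linarith
  have hP2 : 2 ≤ P := by
    rw [hP]; have := ENNReal.ofReal_le_ofReal hp; simpa using this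
  set μ := volume.restrict Ω with hμ
  have hfin : IsFiniteMeasure μ := ⟨by rw [hμ, Measure.restrict_apply_univ]; exact hb.measure_lt_top⟩
  have hm := ho.measurableSet
  refine ⟨C₂ + (C₁ + C₁ + 1) * (1 + C₂), by finiteness, ?_⟩
  intro a b ha hbL hw
  set α := Ω.indicator a with hα
  set β := Ω.indicator b with hβ
  have hαL : MemLp α P volume := (memLp_indicator_iff_restrict hm).2 ha
  have hβL : MemLp β 2 volume := (memLp_indicator_iff_restrict hm).2 (hbL.mono_exponent hP2)
  obtain ⟨s, hs2, hsw, hsb⟩ := H₂ β hβL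
  have hnb : eLpNorm β P volume = eLpNorm b P μ := eLpNorm_indicator_eq_eLpNorm_restrict hm
  rw [hnb] at hsb
  have hαl : LocallyIntegrable α volume := hαL.locallyIntegrable hP1
  have hsl : LocallyIntegrable s volume := hs2.locallyIntegrable (by norm_num)
  have hweq : WeakEq Ω (α - s) 0 := by
    intro φ hφ
    obtain ⟨h1, h2, h3, h4, h5⟩ := db_cont hφ
    have hφ' : IsTest univ φ := ⟨hφ.smooth, hφ.cpt, subset_univ _⟩
    have e1 : ∫ z, α z * db φ z = ∫ z in Ω, a z * db φ z := by
      rw [← integral_indicator hm]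
      congr 1; ext z
      by_cases hz : z ∈ Ω <;> simp [hα, hz]
    have e2 : ∫ z, β z * dd φ z = ∫ z in Ω, b z * dd φ z := by
      rw [← integral_indicator hm]
      congr 1; ext z
      by_cases hz : z ∈ Ω <;> simp [hβ, hz]
    have e3 := hsw φ hφ'
    have i1 : Integrable (fun z => α z * db φ z) := test_mul_int hαl h1 h2
    have i2 : Integrable (fun z => s z * db φ z) := test_mul_int hsl h1 h2
    simp only [Pi.sub_apply, sub_mul, Pi.zero_apply, zero_mul, integral_zero]
    rw [integral_sub i1 i2, e1, e3, e2, hw φ hφ, sub_self]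
  obtain ⟨g, hg, hge⟩ := weyl ho (hαl.sub hsl) hweq
  have hge' : ∀ᵐ z ∂μ, g z = a z - s z := by
    filter_upwards [hge, ae_restrict_mem hm] with z h1 h2
    rw [← h1]; simp [hα, h2]
  have hsm : AEStronglyMeasurable s μ := hs2.1.restrict
  have hgm : AEStronglyMeasurable g μ := (ha.1.sub hsm).congr (hge'.mono fun z hz => hz.symm)
  have hsP : eLpNorm s P μ ≤ C₂ * eLpNorm b P μ := (eLpNorm_restrict_le _ _ _ _).trans hsb
  have hsL : MemLp s P μ := ⟨hsm, hsP.trans_lt (ENNReal.mul_lt_top hC₂.lt_top hbL.2)⟩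
  set A := eLpNorm (fun z => ‖a z‖ - 1) P μ with hA
  set B := eLpNorm b P μ with hB
  have hE : En p Ω g ≤ (1 + C₂) * (A + B) := by
    have h1 : En p Ω g ≤ eLpNorm ((fun z => ‖‖a z‖ - 1‖) + fun z => ‖s z‖) P μ := by
      apply eLpNorm_mono_ae
      filter_upwards [hge'] with z hz
      rw [hz, Pi.add_apply, Real.norm_of_nonneg (by positivity : 0 ≤ ‖‖a z‖ - 1‖ + ‖s z‖)]
      rw [Real.norm_eq_abs, Real.norm_eq_abs]
      have h3 := abs_norm_sub_norm_le (a z - s z) (a z)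
      have h4 : ‖a z - s z - a z‖ = ‖s z‖ := by rw [sub_sub_cancel_left, norm_neg]
      rw [h4] at h3
      have h5 := abs_add_le (‖a z - s z‖ - ‖a z‖) (‖a z‖ - 1)
      rw [sub_add_sub_cancel] at h5
      linarith
    have h2 := eLpNorm_add_le (p := P) (μ := μ) (f := fun z => ‖‖a z‖ - 1‖) (g := fun z => ‖s z‖)
      (ha.1.norm.sub aestronglyMeasurable_const).norm hsm.norm hP1
    rw [eLpNorm_norm, eLpNorm_norm] at h2
    calc En p Ω g ≤ A + C₂ * B := h1.trans (h2.trans (add_le_add le_rfl hsP))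
      _ ≤ A + C₂ * B + (B + C₂ * A) := le_self_add
      _ = _ := by ring
  set c := g x₀ with hcd
  have hgc : MemLp (fun y => g y - c) P μ := by
    have : MemLp g P μ := (ha.sub hsL).ae_eq (hge'.mono fun z hz => hz.symm)
    exact this.sub (memLp_const c)
  have hgc' := H₁ g hg hgc.2.ne
  rw [← hcd] at hgc'
  obtain ⟨e, he1, he2⟩ := exists_unit c
  refine ⟨e, he1, ?_⟩
  have hce : eLpNorm (fun _ : ℂ => c - e) P μ ≤ C₁ * En p Ω g + En p Ω g := by
    have h1 : eLpNorm (fun _ : ℂ => c - e) P μ ≤ eLpNorm ((fun z => ‖g z - c‖) + fun z => ‖‖g z‖ - 1‖) P μ := by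
      apply eLpNorm_mono
      intro z
      rw [he2, Pi.add_apply, Real.norm_of_nonneg (by positivity : 0 ≤ ‖g z - c‖ + ‖‖g z‖ - 1‖)]
      rw [Real.norm_eq_abs, Real.norm_eq_abs]
      have h3 := abs_norm_sub_norm_le c (g z)
      rw [norm_sub_rev] at h3
      have h5 := abs_add_le (‖c‖ - ‖g z‖) (‖g z‖ - 1)
      rw [sub_add_sub_cancel] at h5
      linarith
    have h2 := eLpNorm_add_le (p := P) (μ := μ) (f := fun z => ‖g z - c‖) (g := fun z => ‖‖g z‖ - 1‖)
      hgc.1.norm (hgm.norm.sub aestronglyMeasurable_const).norm hP1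
    rw [eLpNorm_norm, eLpNorm_norm] at h2
    exact h1.trans (h2.trans (add_le_add hgc' le_rfl))
  have hfinal : eLpNorm (fun z => a z - e) P μ ≤ eLpNorm s P μ + (eLpNorm (fun z => g z - c) P μ +
      eLpNorm (fun _ : ℂ => c - e) P μ) := by
    have h0 : eLpNorm (fun z => a z - e) P μ = eLpNorm (s + ((fun z => g z - c) + fun _ => c - e)) P μ := by
      apply eLpNorm_congr_ae
      filter_upwards [hge'] with z hz
      simp only [Pi.add_apply, hz]; ring
    rw [h0]
    refine (eLpNorm_add_le hsm (hgc.1.add aestronglyMeasurable_const) hP1).trans ?_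
    exact add_le_add le_rfl (eLpNorm_add_le hgc.1 aestronglyMeasurable_const hP1)
  calc _ ≤ _ := hfinal
    _ ≤ C₂ * B + (C₁ * En p Ω g + (C₁ * En p Ω g + En p Ω g)) :=
        add_le_add hsP (add_le_add hgc' hce)
    _ = C₂ * B + (C₁ + C₁ + 1) * En p Ω g := by ring
    _ ≤ C₂ * (A + B) + (C₁ + C₁ + 1) * ((1 + C₂) * (A + B)) := by
        refine add_le_add (mul_le_mul_right le_add_self _) (mul_le_mul_right hE _)
    _ = _ := by ring

end GR

end PartF1

section PartG1
open MeasureTheory Metric Set Filter Topology Matrix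
open scoped ENNReal NNReal

namespace GR

/-- conformal part -/
noncomputable def cA (F : Mat2) : ℂ := ⟨(F 0 0 + F 1 1) / 2, (F 1 0 - F 0 1) / 2⟩
/-- anticonformal part -/
noncomputable def cB (F : Mat2) : ℂ := ⟨(F 0 0 - F 1 1) / 2, (F 1 0 + F 0 1) / 2⟩
/-- rotation matrix -/
def rotM (e : ℂ) : Mat2 := !![e.re, -e.im; e.im, e.re]

lemma nsq (z : ℂ) : ‖z‖ ^ 2 = z.re ^ 2 + z.im ^ 2 := by
  rw [← Complex.normSq_eq_norm_sq, Complex.normSq_apply]; ring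

lemma rotM_mem {e : ℂ} (he : ‖e‖ = 1) : rotM e ∈ SO2 := by
  have h := nsq e
  rw [he] at h
  constructor
  · ext i j
    fin_cases i <;> fin_cases j <;> simp [rotM, Matrix.mul_apply, Fin.sum_univ_two] <;> nlinarith
  · rw [rotM, Matrix.det_fin_two_of]; nlinarith

lemma mem_SO2 {R : Mat2} (h : R ∈ SO2) : ∃ e : ℂ, ‖e‖ = 1 ∧ R = rotM e := by
  obtain ⟨h1, h2⟩ := h
  have a := congrFun (congrFun h1 0) 0
  have b := congrFun (congrFun h1 0) 1
  have c := congrFun (congrFun h1 1) 1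
  simp [Matrix.mul_apply, Fin.sum_univ_two] at a b c
  rw [Matrix.det_fin_two] at h2
  have e1 : R 0 0 = R 1 1 := by
    have : (R 0 0 - R 1 1) ^ 2 + (R 0 1 + R 1 0) ^ 2 = 0 := by nlinarith
    nlinarith [sq_nonneg (R 0 0 - R 1 1), sq_nonneg (R 0 1 + R 1 0)]
  have e2 : R 0 1 = - R 1 0 := by
    have : (R 0 0 - R 1 1) ^ 2 + (R 0 1 + R 1 0) ^ 2 = 0 := by nlinarith
    nlinarith [sq_nonneg (R 0 0 - R 1 1), sq_nonneg (R 0 1 + R 1 0)]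
  refine ⟨⟨R 0 0, R 1 0⟩, ?_, ?_⟩
  · have := nsq ⟨R 0 0, R 1 0⟩
    simp only at this
    have h3 : ‖(⟨R 0 0, R 1 0⟩ : ℂ)‖ ^ 2 = 1 := by rw [this]; nlinarith
    exact (pow_eq_one_iff_of_nonneg (norm_nonneg _) (by norm_num)).1 h3
  · ext i j
    fin_cases i <;> fin_cases j <;> simp [rotM, e1, e2]

lemma frob_sub (F : Mat2) (e : ℂ) : frob (F - rotM e) = √(2 * (‖cA F - e‖ ^ 2 + ‖cB F‖ ^ 2)) := by
  rw [frob, nsq, nsq]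
  congr 1
  simp [Fin.sum_univ_two, rotM, cA, cB]
  ring

lemma distSO2_eq (F : Mat2) : distSO2 F = √(2 * ((‖cA F‖ - 1) ^ 2 + ‖cB F‖ ^ 2)) := by
  obtain ⟨e, he, he2⟩ := exists_unit (cA F)
  apply le_antisymm
  · apply csInf_le
    · exact ⟨0, by rintro d ⟨R, hR, rfl⟩; exact Real.sqrt_nonneg _⟩
    · refine ⟨rotM e, rotM_mem he, ?_⟩
      rw [frob_sub, he2, Real.norm_eq_abs, sq_abs]
  · apply le_csInf
    · exact ⟨_, rotM e, rotM_mem he, rfl⟩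
    · rintro d ⟨R, hR, rfl⟩
      obtain ⟨e', he', rfl⟩ := mem_SO2 hR
      rw [frob_sub]
      apply Real.sqrt_le_sqrt
      have := abs_norm_sub_norm_le (cA F) e'
      rw [he'] at this
      have h2 : (‖cA F‖ - 1) ^ 2 ≤ ‖cA F - e'‖ ^ 2 := by
        rw [← sq_abs]; gcongr
      linarith

lemma sqrt_le_aux {x y : ℝ} (hx : 0 ≤ x) (hy : 0 ≤ y) : √(2 * (x ^ 2 + y ^ 2)) ≤ 2 * (x + y) := by
  apply Real.sqrt_le_iff.2 ⟨by positivity, by nlinarith⟩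

lemma le_sqrt_aux (x y : ℝ) : |x| ≤ √(2 * (x ^ 2 + y ^ 2)) := by
  apply Real.abs_le_sqrt; nlinarith [sq_nonneg x, sq_nonneg y]

lemma le_sqrt_aux' (x y : ℝ) : |y| ≤ √(2 * (x ^ 2 + y ^ 2)) := by
  apply Real.abs_le_sqrt; nlinarith [sq_nonneg x, sq_nonneg y]

/-- the identification -/
noncomputable def ee : ℂ ≃L[ℝ] V2 := Complex.basisOneI.equivFun.toContinuousLinearEquiv

lemma ee_apply (z : ℂ) : ee z = ![z.re, z.im] := rfl

lemma ee_mp : MeasurePreserving (ee : ℂ → V2) := Complex.volume_preserving_equiv_pi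

lemma ee_emb : MeasurableEmbedding (ee : ℂ → V2) := ee.toHomeomorph.measurableEmbedding

lemma ee_rest (Ω : Set V2) : MeasurePreserving (ee : ℂ → V2) (volume.restrict (ee ⁻¹' Ω)) (volume.restrict Ω) :=
  ee_mp.restrict_preimage_emb ee_emb Ω

lemma ee_lip {Ω : Set V2} (h : HasLipschitzBoundary Ω) : LipC (ee ⁻¹' Ω) := by
  intro x hx
  have hx' : ee x ∈ frontier Ω := by
    have := ee.toHomeomorph.preimage_frontier Ω
    have h2 : x ∈ ee.toHomeomorph ⁻¹' frontier Ω := by rw [this]; exact hx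
    exact h2
  obtain ⟨R, hR, φ, K, U, hφ, hU, hxU, hch⟩ := h _ hx'
  obtain ⟨ρ, hρ, rfl⟩ := mem_SO2 hR
  refine ⟨ρ, hρ, φ, K, ee ⁻¹' U, hφ, hU.preimage ee.continuous, hxU, ?_⟩
  intro y hy
  have := hch _ hy
  have e0 : (rotM ρ).mulVec (ee y) 0 = (ρ * y).re := by
    simp [rotM, ee_apply, Matrix.mulVec, dotProduct, Fin.sum_univ_two]; ring
  have e1 : (rotM ρ).mulVec (ee y) 1 = (ρ * y).im := by
    simp [rotM, ee_apply, Matrix.mulVec, dotProduct, Fin.sum_univ_two]; ring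
  rw [e0, e1] at this
  exact this

lemma ee_fderiv {φ : ℂ → ℝ} (z v : ℂ) (hφ : DifferentiableAt ℝ φ z) :
    fderiv ℝ φ z v = fderiv ℝ (φ ∘ ee.symm) (ee z) (ee v) := by
  rw [ee.symm.comp_right_fderiv]
  simp

lemma ee_one : ee 1 = Pi.single 0 1 := by
  rw [ee_apply]; ext i; fin_cases i <;> simp

lemma ee_I : ee Complex.I = Pi.single 1 1 := by
  rw [ee_apply]; ext i; fin_cases i <;> simp

end GR

end PartG1

section PartG2
open MeasureTheory Metric Set Filter Topology Matrix
open scoped ENNReal NNReal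

namespace GR

lemma pd_test {φ : V2 → ℝ} (h : ContDiff ℝ (⊤ : ℕ∞) φ) (hc : HasCompactSupport φ) (k : Fin 2) :
    ContDiff ℝ (⊤ : ℕ∞) (pd k φ) ∧ HasCompactSupport (pd k φ) ∧ tsupport (pd k φ) ⊆ tsupport φ := by
  refine ⟨?_, hc.fderiv_apply ℝ _, tsupport_fderiv_apply_subset ℝ _⟩
  exact (h.fderiv_right (m := (⊤ : ℕ∞)) (by simp)).clm_apply contDiff_const

lemma pd_symm {φ : V2 → ℝ} (h : ContDiff ℝ (⊤ : ℕ∞) φ) (j k : Fin 2) (x : V2) :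
    pd j (pd k φ) x = pd k (pd j φ) x := by
  have hd : DifferentiableAt ℝ (fderiv ℝ φ) x :=
    (h.fderiv_right (m := (⊤ : ℕ∞)) (by simp)).differentiable (by simp) x
  have e : ∀ v w : V2, fderiv ℝ (fun z => fderiv ℝ φ z w) x v = fderiv ℝ (fderiv ℝ φ) x v w := by
    intro v w
    rw [fderiv_clm_apply hd (differentiableAt_const w)]
    simp
  have := (h.contDiffAt (x := x)).isSymmSndFDerivAt (by
      simp only [minSmoothness_of_isRCLikeNormedField]; exact WithTop.coe_le_coe.2 (le_top : (2:ℕ∞) ≤ ⊤))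
  unfold pd
  rw [e, e]
  exact this _ _

lemma curl_zero {Ω : Set V2} {u : V2 → V2} {G : V2 → Mat2} (h : IsWeakGradient Ω u G) {φ : V2 → ℝ}
    (hφ : ContDiff ℝ (⊤ : ℕ∞) φ) (hc : HasCompactSupport φ) (hs : tsupport φ ⊆ Ω) (i j k : Fin 2) :
    ∫ x in Ω, G x i j * pd k φ x = ∫ x in Ω, G x i k * pd j φ x := by
  obtain ⟨a1, a2, a3⟩ := pd_test hφ hc k
  obtain ⟨b1, b2, b3⟩ := pd_test hφ hc j
  have h1 := h _ a1 a2 (a3.trans hs) i j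
  have h2 := h _ b1 b2 (b3.trans hs) i k
  simp only [pd_symm hφ j k] at h1
  linarith

theorem V2_rigidity {p : ℝ} (hp : 2 ≤ p) {Ω : Set V2} (ho : IsOpen Ω) (hb : Bornology.IsBounded Ω)
    (hc : IsConnected Ω) (hl : HasLipschitzBoundary Ω) :
    ∃ C : ℝ≥0∞, C ≠ ∞ ∧ ∀ (u : V2 → V2) (G : V2 → Mat2),
      (∀ i j, MemLp (fun x => G x i j) (ENNReal.ofReal p) (volume.restrict Ω)) → IsWeakGradient Ω u G →
      MemLp (fun x => cA (G x)) (ENNReal.ofReal p) (volume.restrict Ω) →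
      MemLp (fun x => cB (G x)) (ENNReal.ofReal p) (volume.restrict Ω) →
      ∃ e : ℂ, ‖e‖ = 1 ∧ eLpNorm (fun x => cA (G x) - e) (ENNReal.ofReal p) (volume.restrict Ω) ≤
        C * (eLpNorm (fun x => ‖cA (G x)‖ - 1) (ENNReal.ofReal p) (volume.restrict Ω) +
          eLpNorm (fun x => cB (G x)) (ENNReal.ofReal p) (volume.restrict Ω)) := by
  have ho' : IsOpen (ee ⁻¹' Ω) := ho.preimage ee.continuous
  have hb' : Bornology.IsBounded (ee ⁻¹' Ω) := by
    rw [← ee.image_symm_eq_preimage]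
    exact ee.symm.lipschitz.isBounded_image hb
  have hc' : IsConnected (ee ⁻¹' Ω) := by
    rw [← ee.image_symm_eq_preimage]
    exact hc.image _ ee.symm.continuous.continuousOn
  obtain ⟨C, hC, H⟩ := complex_rigidity hp ho' hb' hc' (ee_lip hl)
  refine ⟨C, hC, fun u G hG hW hA hB => ?_⟩
  set P := ENNReal.ofReal p with hP
  have hP1 : 1 ≤ P := by rw [hP, ENNReal.one_le_ofReal]; linarith
  have hmp := ee_rest Ω
  have hfin : IsFiniteMeasure (volume.restrict Ω) :=
    ⟨by rw [Measure.restrict_apply_univ]; exact hb.measure_lt_top⟩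
  obtain ⟨e, he, hle⟩ := H (fun z => cA (G (ee z))) (fun z => cB (G (ee z)))
    (hA.comp_measurePreserving hmp) (hB.comp_measurePreserving hmp) (by
      intro φ hφ
      set ψ : V2 → ℝ := φ ∘ ee.symm with hψ
      have s1 : ContDiff ℝ (⊤ : ℕ∞) ψ := hφ.smooth.comp ee.symm.contDiff
      have s2 : HasCompactSupport ψ := hφ.cpt.comp_homeomorph ee.symm.toHomeomorph
      have s3 : tsupport ψ ⊆ Ω := by
        have := tsupport_comp_eq_preimage φ ee.symm.toHomeomorph
        have h2 : tsupport ψ = ee.symm.toHomeomorph ⁻¹' tsupport φ := this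
        rw [h2]
        intro x hx
        have h3 := hφ.supp hx
        have h4 : ee (ee.symm x) ∈ Ω := h3
        simpa using h4
      have hd : ∀ z, DifferentiableAt ℝ φ z := fun z => hφ.smooth.differentiable (by simp) z
      have d1 : ∀ z, db φ z = (pd 0 ψ (ee z) : ℂ) + Complex.I * (pd 1 ψ (ee z) : ℂ) := by
        intro z; rw [db, ee_fderiv z _ (hd z), ee_fderiv z _ (hd z), ee_one, ee_I]; rfl
      have d2 : ∀ z, dd φ z = (pd 0 ψ (ee z) : ℂ) - Complex.I * (pd 1 ψ (ee z) : ℂ) := by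
        intro z; rw [dd, ee_fderiv z _ (hd z), ee_fderiv z _ (hd z), ee_one, ee_I]; rfl
      simp only [d1, d2]
      rw [ee_mp.setIntegral_preimage_emb ee_emb
        (fun x => cA (G x) * ((pd 0 ψ x : ℂ) + Complex.I * (pd 1 ψ x : ℂ))) Ω,
        ee_mp.setIntegral_preimage_emb ee_emb
        (fun x => cB (G x) * ((pd 0 ψ x : ℂ) - Complex.I * (pd 1 ψ x : ℂ))) Ω]
      have hbd : ∀ k, ∃ M, ∀ x, ‖pd k ψ x‖ ≤ M := fun k =>
        (pd_test s1 s2 k).2.1.exists_bound_of_continuous (pd_test s1 s2 k).1.continuous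
      have hct : ∀ k, Continuous (pd k ψ) := fun k => (pd_test s1 s2 k).1.continuous
      have hi : ∀ i j k, Integrable (fun x => G x i j * pd k ψ x) (volume.restrict Ω) := by
        intro i j k
        obtain ⟨M, hM⟩ := hbd k
        exact ((hG i j).integrable hP1).mul_bdd (hct k).aestronglyMeasurable (Eventually.of_forall hM)
      obtain ⟨M0, hM0⟩ := hbd 0
      obtain ⟨M1, hM1⟩ := hbd 1
      have hc0 := hct 0
      have hc1 := hct 1
      have iA : Integrable (fun x => cA (G x) * ((pd 0 ψ x : ℂ) + Complex.I * (pd 1 ψ x : ℂ)))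
          (volume.restrict Ω) := by
        refine (hA.integrable hP1).mul_bdd (c := M0 + M1)
          (Continuous.aestronglyMeasurable (by fun_prop)) (Eventually.of_forall fun x => ?_)
        refine (norm_add_le _ _).trans ?_
        rw [norm_mul, Complex.norm_I, one_mul, Complex.norm_real, Complex.norm_real]
        exact add_le_add (hM0 x) (hM1 x)
      have iB : Integrable (fun x => cB (G x) * ((pd 0 ψ x : ℂ) - Complex.I * (pd 1 ψ x : ℂ)))
          (volume.restrict Ω) := by
        refine (hB.integrable hP1).mul_bdd (c := M0 + M1)
          (Continuous.aestronglyMeasurable (by fun_prop)) (Eventually.of_forall fun x => ?_)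
        refine (norm_sub_le _ _).trans ?_
        rw [norm_mul, Complex.norm_I, one_mul, Complex.norm_real, Complex.norm_real]
        exact add_le_add (hM0 x) (hM1 x)
      rw [← sub_eq_zero, ← integral_sub iA iB]
      have hpt : ∀ x, cA (G x) * ((pd 0 ψ x : ℂ) + Complex.I * (pd 1 ψ x : ℂ)) -
          cB (G x) * ((pd 0 ψ x : ℂ) - Complex.I * (pd 1 ψ x : ℂ)) =
          ((G x 1 1 * pd 0 ψ x - G x 1 0 * pd 1 ψ x : ℝ) : ℂ) +
          Complex.I * ((G x 0 0 * pd 1 ψ x - G x 0 1 * pd 0 ψ x : ℝ) : ℂ) := by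
        intro x
        apply Complex.ext
        · simp [cA, cB]; ring
        · simp [cA, cB]; ring
      simp only [hpt]
      have j1 : Integrable (fun x => G x 1 1 * pd 0 ψ x - G x 1 0 * pd 1 ψ x) (volume.restrict Ω) :=
        (hi 1 1 0).sub (hi 1 0 1)
      have j2 : Integrable (fun x => G x 0 0 * pd 1 ψ x - G x 0 1 * pd 0 ψ x) (volume.restrict Ω) :=
        (hi 0 0 1).sub (hi 0 1 0)
      rw [integral_add j1.ofReal (j2.ofReal.const_mul _), integral_const_mul, integral_complex_ofReal, integral_complex_ofReal,
        integral_sub (hi 1 1 0) (hi 1 0 1), integral_sub (hi 0 0 1) (hi 0 1 0),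
        curl_zero hW s1 s2 s3 1 1 0, curl_zero hW s1 s2 s3 0 0 1]
      simp)
  refine ⟨e, he, ?_⟩
  have t1 := eLpNorm_comp_measurePreserving (p := P) (g := fun x => cA (G x) - e)
    (hA.1.sub aestronglyMeasurable_const) hmp
  have t2 := eLpNorm_comp_measurePreserving (p := P) (g := fun x => ‖cA (G x)‖ - 1)
    (hA.1.norm.sub aestronglyMeasurable_const) hmp
  have t3 := eLpNorm_comp_measurePreserving (p := P) (g := fun x => cB (G x)) hB.1 hmp
  rw [← t1, ← t2, ← t3]
  exact hle

lemma frob_nonneg (M : Mat2) : 0 ≤ frob M := Real.sqrt_nonneg _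

lemma entry_le (M : Mat2) (i j : Fin 2) : |M i j| ≤ frob M := by
  apply Real.abs_le_sqrt
  fin_cases i <;> fin_cases j <;> simp [Fin.sum_univ_two] <;>
    nlinarith [sq_nonneg (M 0 0), sq_nonneg (M 0 1), sq_nonneg (M 1 0), sq_nonneg (M 1 1)]

end GR

end PartG2

open MeasureTheory Metric Set Filter Topology Matrix GR
open scoped ENNReal NNReal

/-- Geometric rigidity (Friesecke–James–Müller), `L^p` version in two dimensions. -/
theorem geometric_rigidity_Lp
    (Ω : Set V2) (hΩo : IsOpen Ω) (hΩb : Bornology.IsBounded Ω)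
    (hΩc : IsConnected Ω) (hΩl : HasLipschitzBoundary Ω)
    (p : ℝ) (hp : 2 ≤ p) :
    ∃ C > 0, ∀ (u : V2 → V2) (G : V2 → Mat2),
      (∀ i, AEMeasurable (fun x => u x i) (volume.restrict Ω)) →
      IntegrableOn (fun x => norm2 (u x) ^ p) Ω →
      (∀ i j, AEMeasurable (fun x => G x i j) (volume.restrict Ω)) →
      IntegrableOn (fun x => frob (G x) ^ p) Ω →
      IsWeakGradient Ω u G →
      ∃ R ∈ SO2, lpM p Ω (fun x => G x - R)
        ≤ C * (∫ x in Ω, distSO2 (G x) ^ p) ^ (1/p) := by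
  obtain ⟨C, hC, H⟩ := V2_rigidity hp hΩo hΩb hΩc hΩl
  have hp0 : 0 < p := by linarith
  set P := ENNReal.ofReal p with hP
  have hP1 : 1 ≤ P := by rw [hP, ENNReal.one_le_ofReal]; linarith
  have hP0 : P ≠ 0 := (zero_lt_one.trans_le hP1).ne'
  have hPt : P ≠ ∞ := ENNReal.ofReal_ne_top
  have hPr : P.toReal = p := ENNReal.toReal_ofReal hp0.le
  have hfin : IsFiniteMeasure (volume.restrict Ω) :=
    ⟨by rw [Measure.restrict_apply_univ]; exact hΩb.measure_lt_top⟩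
  set Cr : ℝ := (2 * (C * 2 + 1)).toReal with hCr
  have hCne : 2 * (C * 2 + 1) ≠ ∞ := by finiteness
  refine ⟨Cr, ENNReal.toReal_pos (by simp) hCne, ?_⟩
  intro u G hu hui hGm hGi hW
  set μ := volume.restrict Ω with hμ
  have hfrobm : AEMeasurable (fun x => frob (G x)) μ := by
    unfold frob
    simp only [Fin.sum_univ_two]
    have h00 := hGm 0 0
    have h01 := hGm 0 1
    have h10 := hGm 1 0
    have h11 := hGm 1 1
    fun_prop
  have hfrobL : MemLp (fun x => frob (G x)) P μ := by
    rw [← integrable_norm_rpow_iff hfrobm.aestronglyMeasurable hP0 hPt, hPr]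
    simp only [Real.norm_of_nonneg (frob_nonneg _)]
    exact hGi
  have hG : ∀ i j, MemLp (fun x => G x i j) P μ := fun i j =>
    hfrobL.mono (hGm i j).aestronglyMeasurable (Eventually.of_forall fun x => by
      rw [Real.norm_of_nonneg (frob_nonneg _)]; exact entry_le _ _ _)
  have hA : MemLp (fun x => cA (G x)) P μ := by
    have h1 : MemLp (fun x => (((G x 0 0 + G x 1 1) / 2 : ℝ) : ℂ)) P μ :=
      (((hG 0 0).add (hG 1 1)).mul_const 2⁻¹).ofReal
    have h2 : MemLp (fun x => Complex.I * (((G x 1 0 - G x 0 1) / 2 : ℝ) : ℂ)) P μ :=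
      (((hG 1 0).sub (hG 0 1)).mul_const 2⁻¹).ofReal.const_mul _
    refine (h1.add h2).ae_eq (Eventually.of_forall fun x => ?_)
    apply Complex.ext <;> simp [cA]
  have hB : MemLp (fun x => cB (G x)) P μ := by
    have h1 : MemLp (fun x => (((G x 0 0 - G x 1 1) / 2 : ℝ) : ℂ)) P μ :=
      (((hG 0 0).sub (hG 1 1)).mul_const 2⁻¹).ofReal
    have h2 : MemLp (fun x => Complex.I * (((G x 1 0 + G x 0 1) / 2 : ℝ) : ℂ)) P μ :=
      (((hG 1 0).add (hG 0 1)).mul_const 2⁻¹).ofReal.const_mul _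
    refine (h1.add h2).ae_eq (Eventually.of_forall fun x => ?_)
    apply Complex.ext <;> simp [cB]
  obtain ⟨e, he, hle⟩ := H u G hG hW hA hB
  have hdn : ∀ F, 0 ≤ distSO2 F := fun F => by rw [distSO2_eq]; exact Real.sqrt_nonneg _
  have hA1 : MemLp (fun x => ‖cA (G x)‖ - 1) P μ := hA.norm.sub (memLp_const 1)
  have hDm : AEStronglyMeasurable (fun x => distSO2 (G x)) μ := by
    simp only [distSO2_eq]
    have h1 := hA.1.aemeasurable
    have h2 := hB.1.aemeasurable
    exact AEMeasurable.aestronglyMeasurable (by fun_prop)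
  have hD : MemLp (fun x => distSO2 (G x)) P μ := by
    refine ((hA1.norm.add hB.norm).const_mul 2).mono hDm (Eventually.of_forall fun x => ?_)
    rw [Real.norm_of_nonneg (hdn _), distSO2_eq]
    refine le_trans ?_ (le_abs_self _)
    have := sqrt_le_aux (norm_nonneg (‖cA (G x)‖ - 1)) (norm_nonneg (cB (G x)))
    rw [Real.norm_eq_abs, sq_abs] at this
    exact this
  have hX : MemLp (fun x => frob (G x - rotM e)) P μ := by
    have hm : AEStronglyMeasurable (fun x => frob (G x - rotM e)) μ := by
      simp only [frob_sub]
      have h1 := hA.1.aemeasurable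
      have h2 := hB.1.aemeasurable
      exact AEMeasurable.aestronglyMeasurable (by fun_prop)
    refine (((hA.sub (memLp_const e)).norm.add hB.norm).const_mul 2).mono hm (Eventually.of_forall fun x => ?_)
    rw [Real.norm_of_nonneg (frob_nonneg _), frob_sub]
    refine le_trans ?_ (le_abs_self _)
    exact sqrt_le_aux (norm_nonneg _) (norm_nonneg _)
  refine ⟨rotM e, rotM_mem he, ?_⟩
  have e1 : eLpNorm (fun x => frob (G x - rotM e)) P μ = ENNReal.ofReal (lpM p Ω (fun x => G x - rotM e)) := by
    rw [hX.eLpNorm_eq_integral_rpow_norm hP0 hPt, hPr, lpM, one_div]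
    simp only [Real.norm_of_nonneg (frob_nonneg _)]
    rfl
  have e2 : eLpNorm (fun x => distSO2 (G x)) P μ = ENNReal.ofReal ((∫ x in Ω, distSO2 (G x) ^ p) ^ (1/p)) := by
    rw [hD.eLpNorm_eq_integral_rpow_norm hP0 hPt, hPr, one_div]
    simp only [Real.norm_of_nonneg (hdn _)]
    rfl
  have m1 : eLpNorm (fun x => ‖cA (G x)‖ - 1) P μ ≤ eLpNorm (fun x => distSO2 (G x)) P μ := by
    apply eLpNorm_mono
    intro x
    rw [Real.norm_of_nonneg (hdn _), distSO2_eq]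
    exact le_sqrt_aux _ _
  have m2 : eLpNorm (fun x => cB (G x)) P μ ≤ eLpNorm (fun x => distSO2 (G x)) P μ := by
    apply eLpNorm_mono
    intro x
    rw [Real.norm_of_nonneg (hdn _), distSO2_eq]
    have := le_sqrt_aux' (‖cA (G x)‖ - 1) ‖cB (G x)‖
    rwa [abs_norm] at this
  have m3 : eLpNorm (fun x => frob (G x - rotM e)) P μ ≤
      2 * (eLpNorm (fun x => cA (G x) - e) P μ + eLpNorm (fun x => cB (G x)) P μ) := by
    have k1 : eLpNorm (fun x => frob (G x - rotM e)) P μ ≤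
        eLpNorm ((2 : ℝ) • ((fun x => ‖cA (G x) - e‖) + fun x => ‖cB (G x)‖)) P μ := by
      apply eLpNorm_mono
      intro x
      rw [Real.norm_of_nonneg (frob_nonneg _), frob_sub]
      refine le_trans ?_ (le_abs_self _)
      exact sqrt_le_aux (norm_nonneg _) (norm_nonneg _)
    rw [eLpNorm_const_smul] at k1
    have k2 := eLpNorm_add_le (p := P) (hA.sub (memLp_const e)).norm.1 hB.norm.1 hP1
    have k3 : ‖(2:ℝ)‖ₑ = 2 := by simp [Real.enorm_eq_ofReal]
    rw [k3] at k1
    refine k1.trans (mul_le_mul_right (k2.trans ?_) _)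
    rw [eLpNorm_norm, eLpNorm_norm]
    exact le_rfl
  set D := eLpNorm (fun x => distSO2 (G x)) P μ with hDd
  have m4 : ENNReal.ofReal (lpM p Ω (fun x => G x - rotM e)) ≤ 2 * (C * 2 + 1) * D := by
    rw [← e1]
    calc _ ≤ _ := m3
      _ ≤ 2 * (C * (D + D) + D) := by
          refine mul_le_mul_right (add_le_add (hle.trans (mul_le_mul_right (add_le_add m1 m2) _)) m2) _
      _ = _ := by ring
  rw [e2, ← ENNReal.ofReal_toReal hCne, ← ENNReal.ofReal_mul ENNReal.toReal_nonneg] at m4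
  rw [ENNReal.ofReal_le_ofReal_iff] at m4
  · exact m4
  · refine mul_nonneg ENNReal.toReal_nonneg (Real.rpow_nonneg (integral_nonneg fun x => ?_) _)
    exact Real.rpow_nonneg (hdn _) _
end
end

section
/- Let Ω ⊂ ℝ² be a bounded domain, p ≥ 2, and let A : Ω → ℝ^{2×2}_sym be continuous. Suppose (t_k) is a sequence of positive numbers with t_k → 0, and for each k we have v_k ∈ C¹(Ω̄, ℝ) and w_k ∈ W^{1,p}(Ω, ℝ²) satisfying 2 sym∇w_k + t_k² (∇w_k)ᵀ(∇w_k) = A − ∇v_k⊗∇v_k pointwise a.e. on Ω. If ∇v_k converges uniformly on Ω to ∇v̄ for some v̄ ∈ C¹(Ω̄, ℝ), and ∇w_k converges weakly in L^p(Ω) to ∇w̄ for some w̄ ∈ W^{1,p}(Ω, ℝ²) with sup_k ‖∇w_k‖_{L^p(Ω)} < ∞, then 2 sym∇w̄ = A − ∇v̄⊗∇v̄ a.e. on Ω, and ‖∇w̄‖_{L^p(Ω)} ≤ liminf_k ‖∇w_k‖_{L^p(Ω)}. -/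
open MeasureTheory Matrix Topology

noncomputable section

/-- Gradient of a scalar function. -/
def grad (f : V2 → ℝ) (x : V2) : V2 := fun i => pd i f x

/-- `∇v ⊗ ∇v`. -/
def gradOuter (v : V2 → ℝ) (x : V2) : Mat2 := Matrix.of fun i j => pd i v x * pd j v x

/-- Derivative matrix `(∇w)ᵢⱼ = ∂ⱼwᵢ`. -/
def Dm (w : V2 → V2) (x : V2) : Mat2 := Matrix.of fun i j => fderiv ℝ w x (Pi.single j 1) i

/-- Symmetrised gradient `sym ∇w = (∇w + (∇w)ᵀ)/2`. -/
def symGrad (w : V2 → V2) (x : V2) : Mat2 := (1/2 : ℝ) • (Dm w x + (Dm w x)ᵀ)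

/-- Supremum norm over `Ω` of a matrix field. -/
def supM (Ω : Set V2) (M : V2 → Mat2) : ℝ := ⨆ x : Ω, frob (M x)

/-- Supremum norm over `Ω` of a vector field. -/
def supV (Ω : Set V2) (f : V2 → V2) : ℝ := ⨆ x : Ω, norm2 (f x)

/-- `f ∈ C^k(Ω̄)`: `f` is `C^k` on an open neighbourhood of the closure of `Ω`. -/
def CkCl (k : ℕ∞) (Ω : Set V2) {F : Type*} [NormedAddCommGroup F] [NormedSpace ℝ F]
    (f : V2 → F) : Prop :=
  ∃ U : Set V2, IsOpen U ∧ closure Ω ⊆ U ∧ ContDiffOn ℝ k f U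

/-- `A ∈ C^{0,β}(Ω̄)`: `A` is `β`-Hölder continuous on the closure of `Ω`. -/
def HolderCl (β : ℝ) (Ω : Set V2) (A : V2 → Mat2) : Prop :=
  ∃ C : ℝ, ∀ x ∈ closure Ω, ∀ y ∈ closure Ω, frob (A x - A y) ≤ C * norm2 (x - y) ^ β

/-- `f ∈ C^{1,α}(Ω̄)`: continuously differentiable with `α`-Hölder gradient. -/
def C1Holder (α : ℝ) (Ω : Set V2) {F : Type*} [NormedAddCommGroup F] [NormedSpace ℝ F]
    (f : V2 → F) : Prop :=
  ContinuousOn f (closure Ω) ∧ DifferentiableOn ℝ f Ω ∧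
    ∃ C : ℝ, ∀ x ∈ Ω, ∀ y ∈ Ω, ‖fderiv ℝ f x - fderiv ℝ f y‖ ≤ C * norm2 (x - y) ^ α

/-- `Ω` has smooth boundary: it is the sublevel set of a smooth function with
nonvanishing gradient on the boundary. -/
def HasSmoothBoundary (Ω : Set V2) : Prop :=
  ∃ ρ : V2 → ℝ, ContDiff ℝ (⊤ : ℕ∞) ρ ∧ Ω = ρ ⁻¹' Set.Iio 0 ∧
    ∀ x ∈ frontier Ω, fderiv ℝ ρ x ≠ 0

lemma frob_nonneg (M : Mat2) : 0 ≤ frob M := Real.sqrt_nonneg _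

lemma frob_sq (M : Mat2) : frob M ^ 2 = ∑ i, ∑ j, (M i j)^2 :=
  Real.sq_sqrt (by positivity)

lemma abs_entry_le (M : Mat2) (i j : Fin 2) : |M i j| ≤ frob M := by
  refine abs_le_of_sq_le_sq ?_ (frob_nonneg M)
  rw [frob_sq]
  simp only [Fin.sum_univ_two]
  fin_cases i <;> fin_cases j <;> simp <;>
    nlinarith [sq_nonneg (M 0 0), sq_nonneg (M 0 1), sq_nonneg (M 1 0), sq_nonneg (M 1 1)]

lemma frob_cs (M N : Mat2) : |∑ i, ∑ j, M i j * N i j| ≤ frob M * frob N := by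
  refine abs_le_of_sq_le_sq ?_ (mul_nonneg (frob_nonneg M) (frob_nonneg N))
  rw [mul_pow, frob_sq, frob_sq]
  have h := Finset.sum_mul_sq_le_sq_mul_sq (Finset.univ : Finset (Fin 2 × Fin 2))
    (fun a => M a.1 a.2) (fun a => N a.1 a.2)
  simpa only [Fintype.sum_prod_type] using h

lemma abs_gram_le (M : Mat2) (i j : Fin 2) : |(Mᵀ * M) i j| ≤ frob M ^ 2 := by
  rw [frob_sq, Matrix.mul_apply, abs_le]
  simp only [Fin.sum_univ_two, Matrix.transpose_apply]
  fin_cases i <;> fin_cases j <;> simp <;> constructor <;>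
    nlinarith [sq_nonneg (M 0 0), sq_nonneg (M 0 1), sq_nonneg (M 1 0), sq_nonneg (M 1 1),
      sq_nonneg (M 0 0 + M 0 1), sq_nonneg (M 0 0 - M 0 1),
      sq_nonneg (M 1 0 + M 1 1), sq_nonneg (M 1 0 - M 1 1)]

lemma frob_smul (c : ℝ) (hc : 0 ≤ c) (M : Mat2) : frob (c • M) = c * frob M := by
  unfold frob
  rw [← Real.sqrt_sq hc, ← Real.sqrt_mul (sq_nonneg c), Real.sqrt_sq hc]
  congr 1
  simp only [Matrix.smul_apply, smul_eq_mul, mul_pow, Finset.mul_sum]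

lemma sq_le_one_add_rpow (x p : ℝ) (hx : 0 ≤ x) (hp : 2 ≤ p) : x ^ 2 ≤ 1 + x ^ p := by
  have h0 : 0 ≤ x ^ p := Real.rpow_nonneg hx p
  rcases le_total x 1 with h | h
  · nlinarith
  · have := Real.rpow_le_rpow_of_exponent_le h hp
    rw [Real.rpow_two] at this
    linarith

lemma aemeas_frob {μ : Measure V2} {G : V2 → Mat2}
    (h : ∀ i j, AEMeasurable (fun x => G x i j) μ) : AEMeasurable (fun x => frob (G x)) μ := by
  unfold frob
  simp only [Fin.sum_univ_two]
  have h00 := h 0 0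
  have h01 := h 0 1
  have h10 := h 1 0
  have h11 := h 1 1
  fun_prop

lemma integrable_frob_sq {μ : Measure V2} [IsFiniteMeasure μ] {G : V2 → Mat2} {p : ℝ} (hp : 2 ≤ p)
    (h : ∀ i j, AEMeasurable (fun x => G x i j) μ)
    (hG : Integrable (fun x => frob (G x) ^ p) μ) : Integrable (fun x => frob (G x) ^ 2) μ := by
  refine Integrable.mono' ((integrable_const (1:ℝ)).add hG)
    ((aemeas_frob h).pow_const 2).aestronglyMeasurable (ae_of_all _ fun x => ?_)
  rw [Real.norm_of_nonneg (sq_nonneg _)]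
  exact sq_le_one_add_rpow _ _ (frob_nonneg _) hp

lemma integrable_entry {μ : Measure V2} [IsFiniteMeasure μ] {G : V2 → Mat2} {p : ℝ} (hp : 2 ≤ p)
    (h : ∀ i j, AEMeasurable (fun x => G x i j) μ)
    (hG : Integrable (fun x => frob (G x) ^ p) μ) (i j : Fin 2) :
    Integrable (fun x => G x i j) μ := by
  refine Integrable.mono' ((integrable_const (1:ℝ)).add (integrable_frob_sq hp h hG))
    (h i j).aestronglyMeasurable (ae_of_all _ fun x => ?_)
  have h1 := abs_entry_le (G x) i j
  rw [Real.norm_eq_abs]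
  simp only [Pi.add_apply]
  nlinarith [sq_nonneg (frob (G x) - 1)]

lemma integrable_gram {μ : Measure V2} [IsFiniteMeasure μ] {G : V2 → Mat2} {p : ℝ} (hp : 2 ≤ p)
    (h : ∀ i j, AEMeasurable (fun x => G x i j) μ)
    (hG : Integrable (fun x => frob (G x) ^ p) μ) (i j : Fin 2) :
    Integrable (fun x => ((G x)ᵀ * G x) i j) μ := by
  refine Integrable.mono' (integrable_frob_sq hp h hG) ?_
    (ae_of_all _ fun x => abs_gram_le (G x) i j)
  simp only [Matrix.mul_apply, Fin.sum_univ_two, Matrix.transpose_apply]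
  have h1 := h 0 i
  have h2 := h 0 j
  have h3 := h 1 i
  have h4 := h 1 j
  exact AEMeasurable.aestronglyMeasurable (by fun_prop)

lemma pd_contOn {Ω : Set V2} {v : V2 → ℝ} (hv : CkCl 1 Ω v) (i : Fin 2) :
    ContinuousOn (pd i v) (closure Ω) := by
  obtain ⟨U, hU, hs, hc⟩ := hv
  have h := hc.continuousOn_fderiv_of_isOpen hU (by simp)
  exact (h.clm_apply continuousOn_const).mono hs

lemma pd_bound {Ω : Set V2} (hΩb : Bornology.IsBounded Ω) {v : V2 → ℝ} (hv : CkCl 1 Ω v) :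
    ∃ C : ℝ, 0 ≤ C ∧ ∀ x ∈ Ω, ∀ i, |pd i v x| ≤ C := by
  have hK := hΩb.isCompact_closure
  obtain ⟨C0, h0⟩ := hK.exists_bound_of_continuousOn (pd_contOn hv 0)
  obtain ⟨C1, h1⟩ := hK.exists_bound_of_continuousOn (pd_contOn hv 1)
  refine ⟨max 0 (max C0 C1), le_max_left _ _, fun x hx i => ?_⟩
  have a0 := h0 x (subset_closure hx)
  have a1 := h1 x (subset_closure hx)
  rw [Real.norm_eq_abs] at a0 a1
  fin_cases i
  · exact a0.trans (by simp)
  · exact a1.trans (by simp)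

lemma integrable_outer {Ω : Set V2} (hΩo : IsOpen Ω) (hΩb : Bornology.IsBounded Ω)
    {v : V2 → ℝ} (hv : CkCl 1 Ω v) (i j : Fin 2) :
    IntegrableOn (fun x => gradOuter v x i j) Ω := by
  have hc : ContinuousOn (fun x => gradOuter v x i j) (closure Ω) :=
    (pd_contOn hv i).mul (pd_contOn hv j)
  exact (hc.integrableOn_compact hΩb.isCompact_closure).mono_set subset_closure

lemma frob_zero : frob 0 = 0 := by simp [frob]

lemma weak_entry {μ : Measure V2} [IsFiniteMeasure μ] {p : ℝ} (hp : 2 ≤ p)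
    {G : ℕ → V2 → Mat2} {Gbar : V2 → Mat2}
    (hweak : ∀ g : V2 → Mat2,
      (∀ i j, AEMeasurable (fun x => g x i j) μ) →
      Integrable (fun x => frob (g x) ^ (p / (p - 1))) μ →
      Filter.Tendsto (fun k => ∫ x, ∑ i, ∑ j, G k x i j * g x i j ∂μ) Filter.atTop
        (nhds (∫ x, ∑ i, ∑ j, Gbar x i j * g x i j ∂μ)))
    (S : Set V2) (hS : MeasurableSet S) (i j : Fin 2) :
    Filter.Tendsto (fun k => ∫ x in S, G k x i j ∂μ) Filter.atTop
        (nhds (∫ x in S, Gbar x i j ∂μ)) := by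
  classical
  have hq : p / (p - 1) ≠ 0 := by
    have : 0 < p / (p-1) := div_pos (by linarith) (by linarith)
    exact this.ne'
  have key : ∀ H : V2 → Mat2, ∫ x, ∑ a, ∑ b, H x a b *
      (S.indicator (fun _ => Matrix.single i j (1:ℝ)) x : Mat2) a b ∂μ = ∫ x in S, H x i j ∂μ := by
    intro H
    rw [← integral_indicator hS]
    congr 1
    funext x
    by_cases hx : x ∈ S
    · simp only [Set.indicator_of_mem hx, Fin.sum_univ_two]
      fin_cases i <;> fin_cases j <;> simp [Matrix.single]
    · simp [Set.indicator_of_notMem hx]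
  have := hweak (fun x => S.indicator (fun _ => Matrix.single i j (1:ℝ)) x) ?_ ?_
  · simpa only [key] using this
  · intro a b
    have : (fun x => (S.indicator (fun _ => Matrix.single i j (1:ℝ)) x : Mat2) a b) =
        S.indicator (fun _ => (Matrix.single i j (1:ℝ) : Mat2) a b) := by
      funext x
      by_cases hx : x ∈ S <;> simp [hx]
    rw [this]
    exact (measurable_const.indicator hS).aemeasurable
  · have : (fun x => frob (S.indicator (fun _ => Matrix.single i j (1:ℝ)) x : Mat2) ^ (p/(p-1))) =
        S.indicator (fun _ => frob (Matrix.single i j (1:ℝ) : Mat2) ^ (p/(p-1))) := by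
      funext x
      by_cases hx : x ∈ S <;> simp [hx, frob_zero, Real.zero_rpow hq]
    rw [this]
    exact (integrable_const _).indicator hS

lemma lower_semi {μ : Measure V2} [IsFiniteMeasure μ] {p : ℝ} (hp : 2 ≤ p)
    {G : ℕ → V2 → Mat2} {Gbar : V2 → Mat2}
    (hGmeas : ∀ k, ∀ i j, AEMeasurable (fun x => G k x i j) μ)
    (hGLp : ∀ k, Integrable (fun x => frob (G k x) ^ p) μ)
    (hGbarmeas : ∀ i j, AEMeasurable (fun x => Gbar x i j) μ)
    (hGbarLp : Integrable (fun x => frob (Gbar x) ^ p) μ)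
    (hweak : ∀ g : V2 → Mat2,
      (∀ i j, AEMeasurable (fun x => g x i j) μ) →
      Integrable (fun x => frob (g x) ^ (p / (p - 1))) μ →
      Filter.Tendsto (fun k => ∫ x, ∑ i, ∑ j, G k x i j * g x i j ∂μ) Filter.atTop
        (nhds (∫ x, ∑ i, ∑ j, Gbar x i j * g x i j ∂μ)))
    (hbound : ∃ M : ℝ, ∀ k, (∫ x, frob (G k x) ^ p ∂μ) ^ (1/p) ≤ M) :
    (∫ x, frob (Gbar x) ^ p ∂μ) ^ (1/p) ≤
      Filter.liminf (fun k => (∫ x, frob (G k x) ^ p ∂μ) ^ (1/p)) Filter.atTop := by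
  obtain ⟨M, hM⟩ := hbound
  have hp0 : 0 < p := by linarith
  have hp1 : 0 < p - 1 := by linarith
  have hcob : Filter.IsCoboundedUnder (· ≥ ·) Filter.atTop
      (fun k => (∫ x, frob (G k x) ^ p ∂μ) ^ (1/p)) :=
    (Filter.isBoundedUnder_of ⟨M, hM⟩ : Filter.IsBoundedUnder (· ≤ ·) Filter.atTop
      (fun k => (∫ x, frob (G k x) ^ p ∂μ) ^ (1/p))).isCoboundedUnder_ge
  have hI0 : 0 ≤ ∫ x, frob (Gbar x) ^ p ∂μ :=
    integral_nonneg fun x => Real.rpow_nonneg (frob_nonneg _) _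
  rcases hI0.eq_or_lt with hI | hI
  · rw [← hI, Real.zero_rpow (by positivity)]
    exact Filter.le_liminf_of_le hcob (Filter.Eventually.of_forall fun k =>
      Real.rpow_nonneg (integral_nonneg fun x => Real.rpow_nonneg (frob_nonneg _) _) _)
  set I := ∫ x, frob (Gbar x) ^ p ∂μ with hIdef
  have hpq : p.HolderConjugate (p / (p - 1)) := Real.HolderConjugate.conjExponent (by linarith)
  set q := p / (p - 1) with hqdef
  have hq0 : 0 < q := div_pos hp0 hp1
  let g : V2 → Mat2 := fun x => frob (Gbar x) ^ (p - 2) • Gbar x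
  have hgm : ∀ i j, AEMeasurable (fun x => g x i j) μ := by
    intro i j
    exact ((aemeas_frob hGbarmeas).pow_const (p-2)).mul (hGbarmeas i j)
  have hfg : ∀ x, frob (g x) = frob (Gbar x) ^ (p - 1) := by
    intro x
    simp only [g]
    rw [frob_smul _ (Real.rpow_nonneg (frob_nonneg _) _)]
    rcases (frob_nonneg (Gbar x)).eq_or_lt with h | h
    · rw [← h, Real.zero_rpow hp1.ne', mul_zero]
    · rw [show p - 1 = (p - 2) + 1 by ring, Real.rpow_add h, Real.rpow_one]
  have hfgq : ∀ x, frob (g x) ^ q = frob (Gbar x) ^ p := by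
    intro x
    rw [hfg, ← Real.rpow_mul (frob_nonneg _), hqdef]
    congr 1
    field_simp
  have hgint : Integrable (fun x => frob (g x) ^ q) μ := by simpa only [hfgq] using hGbarLp
  have hlim := hweak g hgm hgint
  have hpair : ∀ x, ∑ i, ∑ j, Gbar x i j * g x i j = frob (Gbar x) ^ p := by
    intro x
    have h1 : ∑ i, ∑ j, Gbar x i j * g x i j
        = frob (Gbar x) ^ (p - 2) * ∑ i, ∑ j, (Gbar x i j) ^ 2 := by
      simp only [g, Matrix.smul_apply, smul_eq_mul, Finset.mul_sum]
      refine Finset.sum_congr rfl fun i _ => Finset.sum_congr rfl fun j _ => by ring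
    rw [h1, ← frob_sq]
    rcases (frob_nonneg (Gbar x)).eq_or_lt with h | h
    · rw [← h, Real.zero_rpow hp0.ne']; simp
    · rw [← Real.rpow_two, ← Real.rpow_add h]; congr 1; ring
  simp only [hpair] at hlim
  rw [← hIdef] at hlim
  have memLp : ∀ {f : V2 → ℝ} {r : ℝ}, 0 < r → AEMeasurable f μ → (∀ x, 0 ≤ f x) →
      Integrable (fun x => f x ^ r) μ → MemLp f (ENNReal.ofReal r) μ := by
    intro f r hr hf hf0 hi
    rw [← integrable_norm_rpow_iff hf.aestronglyMeasurable (by simpa using hr) (by simp),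
      ENNReal.toReal_ofReal hr.le]
    simpa only [Real.norm_of_nonneg (hf0 _)] using hi
  have hle : ∀ k, ∫ x, ∑ i, ∑ j, G k x i j * g x i j ∂μ ≤
      (∫ x, frob (G k x) ^ p ∂μ) ^ (1/p) * I ^ (1/q) := by
    intro k
    have hF := memLp hp0 (aemeas_frob (hGmeas k)) (fun x => frob_nonneg _) (hGLp k)
    have hg' := memLp hq0 (aemeas_frob hgm) (fun x => frob_nonneg _) hgint
    have hh := integral_mul_le_Lp_mul_Lq_of_nonneg hpq (μ := μ)
      (ae_of_all _ fun x => frob_nonneg (G k x)) (ae_of_all _ fun x => frob_nonneg (g x)) hF hg'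
    simp only [hfgq] at hh
    refine le_trans ?_ hh
    have : ENNReal.HolderConjugate (ENNReal.ofReal p) (ENNReal.ofReal q) := hpq.ennrealOfReal
    refine integral_mono_ae ?_ (hF.integrable_mul hg') (ae_of_all _ fun x =>
      (le_abs_self _).trans (frob_cs _ _))
    refine Integrable.mono' (hF.integrable_mul hg') ?_ (ae_of_all _ fun x => frob_cs _ _)
    simp only [Fin.sum_univ_two]
    have m := hGmeas k
    exact ((((m 0 0).mul (hgm 0 0)).add ((m 0 1).mul (hgm 0 1))).add
      (((m 1 0).mul (hgm 1 0)).add ((m 1 1).mul (hgm 1 1)))).aestronglyMeasurable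
  have hlim2 := hlim.div_const (I ^ (1/q))
  have e : I / I ^ (1/q) = I ^ (1/p) := by
    rw [div_eq_iff (Real.rpow_pos_of_pos hI _).ne', ← Real.rpow_add hI]
    have := hpq.inv_add_inv_eq_one
    rw [one_div, one_div, this, Real.rpow_one]
  rw [e] at hlim2
  rw [← hlim2.liminf_eq]
  refine Filter.liminf_le_liminf (Filter.Eventually.of_forall fun k => ?_)
    hlim2.isBoundedUnder_ge hcob
  rw [div_le_iff₀ (Real.rpow_pos_of_pos hI _)]
  exact hle k

/-- Passing to the limit in the perturbed von Kármán constraint. -/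
theorem vonKarman_constraint_limit
    (Ω : Set V2) (hΩo : IsOpen Ω) (hΩb : Bornology.IsBounded Ω) (hΩc : IsConnected Ω)
    (p : ℝ) (hp : 2 ≤ p)
    (A : V2 → Mat2) (hAsymm : ∀ x, (A x).IsSymm)
    (hAcont : ∀ i j, ContinuousOn (fun x => A x i j) Ω)
    (t : ℕ → ℝ) (ht : ∀ k, 0 < t k) (htlim : Filter.Tendsto t Filter.atTop (nhds 0))
    (v : ℕ → V2 → ℝ) (hv : ∀ k, CkCl 1 Ω (v k))
    (w : ℕ → V2 → V2) (G : ℕ → V2 → Mat2)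
    (hwG : ∀ k, IsWeakGradient Ω (w k) (G k))
    (hGmeas : ∀ k, ∀ i j, AEMeasurable (fun x => G k x i j) (volume.restrict Ω))
    (hGLp : ∀ k, IntegrableOn (fun x => frob (G k x) ^ p) Ω)
    -- the constraint 2 sym∇w_k + t_k² (∇w_k)ᵀ(∇w_k) = A − ∇v_k ⊗ ∇v_k a.e. on Ω
    (heq : ∀ k, ∀ᵐ x ∂(volume.restrict Ω),
      (G k x + (G k x)ᵀ) + (t k) ^ 2 • ((G k x)ᵀ * G k x) = A x - gradOuter (v k) x)
    (vbar : V2 → ℝ) (hvbar : CkCl 1 Ω vbar)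
    (hgradconv : TendstoUniformlyOn (fun k x => grad (v k) x) (fun x => grad vbar x)
      Filter.atTop Ω)
    (wbar : V2 → V2) (Gbar : V2 → Mat2)
    (hwbarG : IsWeakGradient Ω wbar Gbar)
    (hGbarmeas : ∀ i j, AEMeasurable (fun x => Gbar x i j) (volume.restrict Ω))
    (hGbarLp : IntegrableOn (fun x => frob (Gbar x) ^ p) Ω)
    -- weak convergence ∇w_k ⇀ ∇w̄ in L^p(Ω)
    (hweak : ∀ g : V2 → Mat2,
      (∀ i j, AEMeasurable (fun x => g x i j) (volume.restrict Ω)) →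
      IntegrableOn (fun x => frob (g x) ^ (p / (p - 1))) Ω →
      Filter.Tendsto (fun k => ∫ x in Ω, ∑ i, ∑ j, G k x i j * g x i j) Filter.atTop
        (nhds (∫ x in Ω, ∑ i, ∑ j, Gbar x i j * g x i j)))
    -- uniform L^p bound on ∇w_k
    (hbound : ∃ M : ℝ, ∀ k, lpM p Ω (G k) ≤ M) :
    (∀ᵐ x ∂(volume.restrict Ω), Gbar x + (Gbar x)ᵀ = A x - gradOuter vbar x) ∧
    lpM p Ω Gbar ≤ Filter.liminf (fun k => lpM p Ω (G k)) Filter.atTop := by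
  have hfin : IsFiniteMeasure (volume.restrict Ω) :=
    ⟨by rw [Measure.restrict_apply_univ]; exact hΩb.measure_lt_top⟩
  refine ⟨?_, lower_semi hp hGmeas hGLp hGbarmeas hGbarLp hweak hbound⟩
  obtain ⟨M, hM⟩ := hbound
  have hp0 : 0 < p := by linarith
  -- uniform L² bound
  have hL2 : ∃ B : ℝ, 0 ≤ B ∧ ∀ k, ∫ x in Ω, frob (G k x) ^ 2 ≤ B := by
    have hM0 : 0 ≤ M := le_trans (Real.rpow_nonneg
      (integral_nonneg fun x => Real.rpow_nonneg (frob_nonneg _) _) _) (hM 0)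
    refine ⟨(∫ x in Ω, (1:ℝ)) + M ^ p, add_nonneg (integral_nonneg fun _ => zero_le_one)
      (Real.rpow_nonneg hM0 _), fun k => ?_⟩
    have h0 : 0 ≤ ∫ x in Ω, frob (G k x) ^ p :=
      integral_nonneg fun x => Real.rpow_nonneg (frob_nonneg _) _
    have h1 : ∫ x in Ω, frob (G k x) ^ p ≤ M ^ p := by
      have := Real.rpow_le_rpow (Real.rpow_nonneg h0 _) (hM k) hp0.le
      rwa [← Real.rpow_mul h0, one_div_mul_cancel hp0.ne', Real.rpow_one] at this
    calc ∫ x in Ω, frob (G k x) ^ 2 ≤ ∫ x in Ω, (1 + frob (G k x) ^ p) :=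
          integral_mono (integrable_frob_sq hp (hGmeas k) (hGLp k))
            ((integrable_const _).add (hGLp k))
            fun x => sq_le_one_add_rpow _ _ (frob_nonneg _) hp
      _ = (∫ x in Ω, (1:ℝ)) + ∫ x in Ω, frob (G k x) ^ p :=
          integral_add (integrable_const _) (hGLp k)
      _ ≤ _ := by linarith
  obtain ⟨B, hB0, hB⟩ := hL2
  obtain ⟨C, hC0, hC⟩ := pd_bound hΩb hvbar
  have hent : ∀ k, ∀ᵐ x ∂(volume.restrict Ω), ∀ i j, A x i j =
      G k x i j + G k x j i + t k ^ 2 * ((G k x)ᵀ * G k x) i j + gradOuter (v k) x i j := by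
    intro k
    filter_upwards [heq k] with x hx i j
    have := congrFun (congrFun hx i) j
    simp only [Matrix.add_apply, Matrix.sub_apply, Matrix.smul_apply, smul_eq_mul,
      Matrix.transpose_apply] at this
    linarith
  have hAint : ∀ i j, Integrable (fun x => A x i j) (volume.restrict Ω) := by
    intro i j
    have e := integrable_entry hp (hGmeas 0) (hGLp 0)
    refine ((((e i j).add (e j i)).add
      ((integrable_gram hp (hGmeas 0) (hGLp 0) i j).const_mul (t 0 ^ 2))).add
      (integrable_outer hΩo hΩb (hv 0) i j)).congr ?_
    filter_upwards [hent 0] with x hx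
    simp only [Pi.add_apply, hx i j]
  have hmain : ∀ i j, (fun x => Gbar x i j + Gbar x j i) =ᵐ[volume.restrict Ω]
      (fun x => A x i j - gradOuter vbar x i j) := by
    intro i j
    have eb := integrable_entry hp hGbarmeas hGbarLp
    have hHint : Integrable (fun x => A x i j - gradOuter vbar x i j) (volume.restrict Ω) :=
      (hAint i j).sub (integrable_outer hΩo hΩb hvbar i j)
    refine Integrable.ae_eq_of_forall_setIntegral_eq _ _ ((eb i j).add (eb j i)) hHint
      fun S hS _ => ?_
    have l1 : Filter.Tendsto (fun k => ∫ x in S, (G k x i j + G k x j i) ∂(volume.restrict Ω))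
        Filter.atTop (nhds (∫ x in S, (Gbar x i j + Gbar x j i) ∂(volume.restrict Ω))) := by
      rw [integral_add (eb i j).integrableOn (eb j i).integrableOn]
      refine ((weak_entry hp hweak S hS i j).add (weak_entry hp hweak S hS j i)).congr fun k => ?_
      have e := integrable_entry hp (hGmeas k) (hGLp k)
      rw [integral_add (e i j).integrableOn (e j i).integrableOn]
    refine tendsto_nhds_unique l1 ?_
    -- convergence in L¹
    have hdist : ∀ ε > 0, ε ≤ 1 → ∀ᶠ k in Filter.atTop,
        |(∫ x in S, (G k x i j + G k x j i) ∂(volume.restrict Ω)) -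
          ∫ x in S, (A x i j - gradOuter vbar x i j) ∂(volume.restrict Ω)| ≤
        t k ^ 2 * B + ε * ((2 * C + 1) * ∫ x in Ω, (1:ℝ)) := by
      intro ε hε hε1
      filter_upwards [Metric.tendstoUniformlyOn_iff.mp hgradconv ε hε] with k hk
      have e := integrable_entry hp (hGmeas k) (hGLp k)
      have hFi : Integrable (fun x => G k x i j + G k x j i) (volume.restrict Ω) :=
        (e i j).add (e j i)
      rw [← integral_sub hFi.integrableOn hHint.integrableOn]
      have hpt : ∀ᵐ x ∂(volume.restrict Ω),
          ‖G k x i j + G k x j i - (A x i j - gradOuter vbar x i j)‖ ≤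
            t k ^ 2 * frob (G k x) ^ 2 + ε * ((2 * C + 1) * 1) := by
        filter_upwards [hent k, ae_restrict_mem hΩo.measurableSet] with x hx hxΩ
        have hd : ∀ l, |pd l (v k) x - pd l vbar x| ≤ ε := by
          intro l
          have h1 := (dist_le_pi_dist (grad vbar x) (grad (v k) x) l).trans (hk x hxΩ).le
          rw [dist_comm, Real.dist_eq] at h1
          exact h1
        rw [hx i j, Real.norm_eq_abs]
        have hg : |gradOuter (v k) x i j - gradOuter vbar x i j| ≤ ε * (2 * C + 1) := by
          have e1 : gradOuter (v k) x i j - gradOuter vbar x i j =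
              (pd i (v k) x - pd i vbar x) * (pd j (v k) x - pd j vbar x) +
              (pd i (v k) x - pd i vbar x) * pd j vbar x +
              pd i vbar x * (pd j (v k) x - pd j vbar x) := by
            simp only [gradOuter, Matrix.of_apply]; ring
          rw [e1]
          refine (abs_add_three _ _ _).trans ?_
          simp only [abs_mul]
          have a1 := mul_le_mul (hd i) ((hd j).trans hε1) (abs_nonneg _) hε.le
          have a2 := mul_le_mul (hd i) (hC x hxΩ j) (abs_nonneg _) hε.le
          have a3 := mul_le_mul (hC x hxΩ i) (hd j) (abs_nonneg _) hC0
          linarith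
        have hgr : |t k ^ 2 * ((G k x)ᵀ * G k x) i j| ≤ t k ^ 2 * frob (G k x) ^ 2 := by
          rw [abs_mul, abs_of_nonneg (sq_nonneg (t k))]
          exact mul_le_mul_of_nonneg_left (abs_gram_le _ _ _) (sq_nonneg _)
        rw [abs_le] at hg hgr ⊢
        constructor <;> linarith [hg.1, hg.2, hgr.1, hgr.2]
      have hbi : Integrable (fun x => t k ^ 2 * frob (G k x) ^ 2 + ε * ((2 * C + 1) * 1))
          (volume.restrict Ω) :=
        ((integrable_frob_sq hp (hGmeas k) (hGLp k)).const_mul _).add (integrable_const _)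
      calc _ ≤ ∫ x in S, (t k ^ 2 * frob (G k x) ^ 2 + ε * ((2 * C + 1) * 1))
            ∂(volume.restrict Ω) :=
            norm_integral_le_of_norm_le hbi.integrableOn (ae_restrict_of_ae hpt)
        _ ≤ ∫ x in Ω, (t k ^ 2 * frob (G k x) ^ 2 + ε * ((2 * C + 1) * 1)) :=
            setIntegral_le_integral hbi (ae_of_all _ fun x => by
              simp only [Pi.zero_apply]; positivity)
        _ = t k ^ 2 * (∫ x in Ω, frob (G k x) ^ 2) + ε * ((2 * C + 1) * ∫ x in Ω, (1:ℝ)) := by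
            rw [integral_add ((integrable_frob_sq hp (hGmeas k) (hGLp k)).const_mul _)
              (integrable_const _), integral_const_mul, integral_const_mul, integral_const_mul]
        _ ≤ _ := by
            have := mul_le_mul_of_nonneg_left (hB k) (sq_nonneg (t k))
            linarith
    have hD0 : 0 ≤ (2 * C + 1) * ∫ x in Ω, (1:ℝ) :=
      mul_nonneg (by linarith) (integral_nonneg fun _ => zero_le_one)
    generalize (2 * C + 1) * (∫ x in Ω, (1:ℝ)) = D at hdist hD0
    have htB : Filter.Tendsto (fun k => t k ^ 2 * B) Filter.atTop (nhds 0) := by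
      simpa using (htlim.pow 2).mul_const B
    rw [Metric.tendsto_nhds]
    intro η hη
    have hε : 0 < min 1 (η / (2 * (D + 1))) := lt_min one_pos (by positivity)
    filter_upwards [hdist _ hε (min_le_left _ _),
      htB.eventually (gt_mem_nhds (half_pos hη))] with k h1 h2
    rw [Real.dist_eq]
    have h3 : min 1 (η / (2 * (D + 1))) * D ≤ η / 2 := by
      calc _ ≤ η / (2 * (D + 1)) * (D + 1) :=
            mul_le_mul (min_le_right _ _) (by linarith) hD0 (by positivity)
        _ = η / 2 := by field_simp
    linarith
  filter_upwards [hmain 0 0, hmain 0 1, hmain 1 0, hmain 1 1] with x h1 h2 h3 h4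
  ext i j
  simp only [Matrix.add_apply, Matrix.sub_apply, Matrix.transpose_apply]
  fin_cases i <;> fin_cases j <;> assumption
end
end
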